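/- Let π be a set of primes with 2 ∈ π, and let G be a finite π-separable group. Let χ ∈ Irr(G) be a lift of φ ∈ I_π(G), and suppose N is a normal subgroup of G such that all irreducible constituents of χ_N are π-factored. Suppose U ≤ G and ψ ∈ Irr(U) is π-factored with ψ^G = χ. Then the index |NU : U| is a π-number. -/

import Mathlib

open scoped Classical

noncomputable section

/-- All prime divisors of `n` belong to the set of primes `σ`. -/
def IsPiNumber (σ : Set ℕ) (n : ℕ) : Prop :=
  ∀ q : ℕ, q.Prime → q ∣ n → q ∈ σ

/-- `g` is a `σ`-element: its order is a `σ`-number. -/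
def IsPiElt (σ : Set ℕ) {G : Type} [Group G] (g : G) : Prop :=
  IsPiNumber σ (orderOf g)

/-- The `p`-part of a natural number. -/
def pPart (p n : ℕ) : ℕ := p ^ (n.factorization p)

/-- `χ` is the character of a finite-dimensional complex representation of `G`. -/
def IsCharacter (G : Type) [Group G] (χ : G → ℂ) : Prop :=
  ∃ V : FDRep ℂ G, ∀ g, χ g = V.character g

/-- `χ` is an irreducible (ordinary, complex) character of `G`: a nonzero character
which is not the sum of two nonzero characters. -/
def IsIrrChar (G : Type) [Group G] (χ : G → ℂ) : Prop :=
  IsCharacter G χ ∧ χ ≠ 0 ∧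
    ¬ ∃ χ₁ χ₂ : G → ℂ, IsCharacter G χ₁ ∧ χ₁ ≠ 0 ∧ IsCharacter G χ₂ ∧ χ₂ ≠ 0 ∧ χ = χ₁ + χ₂

/-- Restriction of a class function on `G` to a subgroup `H`. -/
def resChar {G : Type} [Group G] (H : Subgroup G) (χ : G → ℂ) : ↥H → ℂ :=
  fun h => χ (h : G)

/-- Restriction of a class function between nested subgroups. -/
def resCharLe {G : Type} [Group G] {K H : Subgroup G} (hKH : K ≤ H) (χ : ↥H → ℂ) : ↥K → ℂ :=
  fun k => χ ⟨(k : G), hKH k.2⟩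

/-- The induced class function from a subgroup `H` of `G`, given by the usual
induction formula. -/
def indChar {G : Type} [Group G] [Fintype G] (H : Subgroup G) (ψ : ↥H → ℂ) : G → ℂ :=
  fun g => (Nat.card ↥H : ℂ)⁻¹ *
    ∑ x : G, if h : x * g * x⁻¹ ∈ H then ψ ⟨x * g * x⁻¹, h⟩ else 0

/-- Induction of a class function between nested subgroups. -/
def indCharLe {G : Type} [Group G] [Fintype G] {K H : Subgroup G} (_ : K ≤ H)
    (ψ : ↥K → ℂ) : ↥H → ℂ :=
  fun x => (Nat.card ↥K : ℂ)⁻¹ *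
    ∑ y : ↥H, if h : (y : G) * (x : G) * (y : G)⁻¹ ∈ K then ψ ⟨(y : G) * (x : G) * (y : G)⁻¹, h⟩ else 0

/-- `θ` is an irreducible constituent of the class function `χ`. -/
def IsConstituent {G : Type} [Group G] (θ χ : G → ℂ) : Prop :=
  IsIrrChar G θ ∧ ∃ ξ : G → ℂ, (ξ = 0 ∨ IsCharacter G ξ) ∧ χ = θ + ξ

/-- The restriction `χ^o` of a class function to the `σ`-elements of `G`
(extended by zero elsewhere). -/
def piRestrict (σ : Set ℕ) {G : Type} [Group G] (χ : G → ℂ) : G → ℂ :=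
  fun g => if IsPiElt σ g then χ g else 0

/-- `φ` is a `σ`-partial character of `G`: the restriction to the `σ`-elements of an
ordinary character. -/
def IsPartialChar (σ : Set ℕ) (G : Type) [Group G] (φ : G → ℂ) : Prop :=
  ∃ χ : G → ℂ, IsCharacter G χ ∧ χ ≠ 0 ∧ φ = piRestrict σ χ

/-- `φ ∈ I_σ(G)`: an irreducible `σ`-partial character, i.e. one which is not the
sum of two `σ`-partial characters. -/
def IsIPiChar (σ : Set ℕ) (G : Type) [Group G] (φ : G → ℂ) : Prop :=
  IsPartialChar σ G φ ∧
    ¬ ∃ φ₁ φ₂ : G → ℂ, IsPartialChar σ G φ₁ ∧ IsPartialChar σ G φ₂ ∧ φ = φ₁ + φ₂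

/-- `φ ∈ IBr(G)` (at the prime `p`): irreducible Brauer characters are the irreducible
`p'`-partial characters, where the `p`-regular elements are the `{p}ᶜ`-elements. -/
def IsIBrChar (p : ℕ) (G : Type) [Group G] (φ : G → ℂ) : Prop :=
  IsIPiChar ({p}ᶜ) G φ

/-- The restriction `χ^o` of `χ` to the `p`-regular elements of `G`. -/
def brRestrict (p : ℕ) {G : Type} [Group G] (χ : G → ℂ) : G → ℂ :=
  piRestrict ({p}ᶜ) χ

/-- `χ` is a lift of the `σ`-partial character `φ`. -/
def IsLiftOfPi (σ : Set ℕ) (G : Type) [Group G] (χ φ : G → ℂ) : Prop :=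
  IsIrrChar G χ ∧ piRestrict σ χ = φ

/-- `χ` is a lift: `χ` is irreducible and `χ^o` is an irreducible `σ`-partial character. -/
def IsLiftPi (σ : Set ℕ) (G : Type) [Group G] (χ : G → ℂ) : Prop :=
  IsIrrChar G χ ∧ IsIPiChar σ G (piRestrict σ χ)

/-- `H` is a subnormal subgroup of `G`. -/
def IsSubnormalSubgroup {G : Type} [Group G] (H : Subgroup G) : Prop :=
  ∃ (n : ℕ) (c : Fin (n + 1) → Subgroup G),
    c 0 = H ∧ c (Fin.last n) = ⊤ ∧
    ∀ i : Fin n, c i.castSucc ≤ c i.succ ∧ ((c i.castSucc).subgroupOf (c i.succ)).Normal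

/-- The determinantal order `o(det θ)` of `θ` is a `σ`-number. -/
def HasPiDetOrder (σ : Set ℕ) (G : Type) [Group G] (θ : G → ℂ) : Prop :=
  ∃ V : FDRep ℂ G, (∀ g, θ g = V.character g) ∧
    IsPiNumber σ (orderOf (fun g : G => LinearMap.det (V.ρ g)))

/-- `χ` is a `σ`-special character of `G`: `χ` is irreducible, `χ(1)` is a `σ`-number,
and for every subnormal subgroup `M` of `G`, every irreducible constituent of `χ_M`
has determinantal order a `σ`-number. -/
def IsPiSpecial (σ : Set ℕ) (G : Type) [Group G] (χ : G → ℂ) : Prop :=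
  IsIrrChar G χ ∧ (∃ n : ℕ, χ 1 = (n : ℂ) ∧ IsPiNumber σ n) ∧
    ∀ M : Subgroup G, IsSubnormalSubgroup M →
      ∀ θ : ↥M → ℂ, IsConstituent θ (resChar M χ) → HasPiDetOrder σ ↥M θ

/-- `χ` is `σ`-factored: `χ = αβ` with `α` `σ`-special and `β` `σ'`-special. -/
def IsPiFactored (σ : Set ℕ) (G : Type) [Group G] (χ : G → ℂ) : Prop :=
  ∃ α β : G → ℂ, IsPiSpecial σ G α ∧ IsPiSpecial σᶜ G β ∧ χ = α * β

/-- `G` is `σ`-separable: it has a subnormal series each of whose factors is a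
`σ`-group or a `σ'`-group (equivalently, every composition factor is a `σ`-group or a
`σ'`-group). -/
def IsPiSeparable (σ : Set ℕ) (G : Type) [Group G] : Prop :=
  ∃ (n : ℕ) (c : Fin (n + 1) → Subgroup G),
    c 0 = ⊥ ∧ c (Fin.last n) = ⊤ ∧
    ∀ i : Fin n, c i.castSucc ≤ c i.succ ∧ ((c i.castSucc).subgroupOf (c i.succ)).Normal ∧
      (IsPiNumber σ (Nat.card (↥(c i.succ) ⧸ (c i.castSucc).subgroupOf (c i.succ))) ∨
        IsPiNumber σᶜ (Nat.card (↥(c i.succ) ⧸ (c i.castSucc).subgroupOf (c i.succ))))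

/-- `G` is `p`-solvable: every composition factor is a `p`-group or a `p'`-group. -/
def IsPSolvable (p : ℕ) (G : Type) [Group G] : Prop :=
  IsPiSeparable {p} G

/-- The character `δ` of the subgroup `Q` is invariant under (conjugation by the
elements of) the subgroup `S`. -/
def InvariantUnder {G : Type} [Group G] (Q : Subgroup G) (δ : ↥Q → ℂ) (S : Subgroup G) : Prop :=
  ∀ g ∈ S, ∀ x : ↥Q, ∀ h : g * (x : G) * g⁻¹ ∈ Q, δ ⟨g * (x : G) * g⁻¹, h⟩ = δ x

/-- `(Q, δ)` is a vertex pair for `χ ∈ Irr(G)` (at the prime `p`): `Q` is a `p`-subgroup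
of `G`, `δ ∈ Irr(Q)`, and there are a subgroup `U ≤ G` and an irreducible character
`ψ = αβ` of `U` with `α` `p'`-special and `β` `p`-special, such that `ψ^G = χ`, `Q` is a
Sylow `p`-subgroup of `U`, and `β_Q = δ`. -/
def IsVertexPair (p : ℕ) {G : Type} [Group G] [Fintype G] (χ : G → ℂ)
    (Q : Subgroup G) (δ : ↥Q → ℂ) : Prop :=
  IsPGroup p ↥Q ∧ IsIrrChar ↥Q δ ∧
    ∃ (U : Subgroup G) (hQU : Q ≤ U) (α β : ↥U → ℂ),
      IsPiSpecial ({p}ᶜ) ↥U α ∧ IsPiSpecial {p} ↥U β ∧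
      IsIrrChar ↥U (α * β) ∧ indChar U (α * β) = χ ∧
      ¬ p ∣ (Q.subgroupOf U).index ∧
      ∀ x : ↥Q, δ x = β ⟨(x : G), hQU x.2⟩

/-- `(Q, δ)` is a generalized `σ`-vertex for `χ ∈ Irr(G)`: there are `U ≤ G` and an
irreducible `ψ = αβ ∈ Irr(U)` with `α` `σ`-special and `β` `σ'`-special such that
`ψ^G = χ`, `Q` is a Hall `σ'`-subgroup of `U` and `δ = β_Q`. -/
def IsGenPiVertex (σ : Set ℕ) {G : Type} [Group G] [Fintype G] (χ : G → ℂ)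
    (Q : Subgroup G) (δ : ↥Q → ℂ) : Prop :=
  ∃ (U : Subgroup G) (hQU : Q ≤ U) (α β : ↥U → ℂ),
    IsPiSpecial σ ↥U α ∧ IsPiSpecial σᶜ ↥U β ∧
    IsIrrChar ↥U (α * β) ∧ indChar U (α * β) = χ ∧
    IsPiNumber σᶜ (Nat.card ↥Q) ∧ IsPiNumber σ ((Q.subgroupOf U).index) ∧
    ∀ x : ↥Q, δ x = β ⟨(x : G), hQU x.2⟩

/-- The pair `(Q₂, δ₂)` is the conjugate of the pair `(Q₁, δ₁)` by the element `g`. -/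
def IsConjPair {G : Type} [Group G] (g : G)
    (Q₁ : Subgroup G) (δ₁ : ↥Q₁ → ℂ) (Q₂ : Subgroup G) (δ₂ : ↥Q₂ → ℂ) : Prop :=
  Q₂ = Subgroup.map (MulAut.conj g).toMonoidHom Q₁ ∧
    ∀ x : ↥Q₁, ∀ h : g * (x : G) * g⁻¹ ∈ Q₂, δ₂ ⟨g * (x : G) * g⁻¹, h⟩ = δ₁ x

/-- `Q` is a vertex (subgroup) of the irreducible `σ`-partial character `φ` of `G`:
`Q` is a Hall `σ'`-subgroup of a subgroup `U ≤ G` possessing an irreducible `σ`-partial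
character `κ` of `σ`-degree with `κ^G = φ`. -/
def IsVertexSubgroup (σ : Set ℕ) {G : Type} [Group G] [Fintype G] (φ : G → ℂ)
    (Q : Subgroup G) : Prop :=
  ∃ (U : Subgroup G) (κ : ↥U → ℂ), Q ≤ U ∧
    IsPiNumber σᶜ (Nat.card ↥Q) ∧ IsPiNumber σ ((Q.subgroupOf U).index) ∧
    IsIPiChar σ ↥U κ ∧ (∃ n : ℕ, κ 1 = (n : ℂ) ∧ IsPiNumber σ n) ∧
    indChar U κ = φ

/-- `θ ∈ I_σ(M)` is an irreducible constituent of the restriction `φ_M`. -/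
def IsIPiConstituent (σ : Set ℕ) {G : Type} [Group G] (M : Subgroup G)
    (θ : ↥M → ℂ) (φ : G → ℂ) : Prop :=
  IsIPiChar σ ↥M θ ∧ ∃ ξ : ↥M → ℂ, (ξ = 0 ∨ IsPartialChar σ ↥M ξ) ∧ resChar M φ = θ + ξ

section RepresentationSplitting

variable {G V : Type} [Group G] [AddCommGroup V] [Module ℂ V]

theorem Representation.exists_invariant_isCompl [Finite G]
    (ρ : Representation ℂ G V) (W : Submodule ℂ V) (hW : ∀ g, W ≤ W.comap (ρ g)) :
    ∃ W' : Submodule ℂ V, (∀ g, W' ≤ W'.comap (ρ g)) ∧ IsCompl W W' := by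
  have : ComplementedLattice (Subrepresentation ρ) :=
    (OrderIso.complementedLattice_iff
      (Subrepresentation.subrepresentationSubmoduleOrderIso (ρ := ρ))).2 inferInstance
  obtain ⟨Q, hQ⟩ := exists_isCompl (⟨W, fun g v hv => hW g hv⟩ : Subrepresentation ρ)
  refine ⟨Q.toSubmodule, fun g v hv => Q.apply_mem_toSubmodule g hv, ?_⟩
  constructor
  · rw [disjoint_iff]
    have := congrArg Subrepresentation.toSubmodule hQ.inf_eq_bot
    exact this
  · rw [codisjoint_iff]
    have := congrArg Subrepresentation.toSubmodule hQ.sup_eq_top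
    exact this

variable (ρ : Representation ℂ G V) (W W' : Submodule ℂ V)
  (hW : ∀ g, W ≤ W.comap (ρ g)) (hW' : ∀ g, W' ≤ W'.comap (ρ g)) (hc : IsCompl W W')

include hc in
theorem Representation.conj_prodMap_subrepresentation (g : G) :
    (W.prodEquivOfIsCompl W' hc).conj
      (LinearMap.prodMap (ρ.subrepresentation W hW g) (ρ.subrepresentation W' hW' g)) = ρ g := by
  ext v
  obtain ⟨⟨a, b⟩, rfl⟩ := (W.prodEquivOfIsCompl W' hc).surjective v
  simp [LinearEquiv.conj_apply]

variable [FiniteDimensional ℂ V]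

include hc in
theorem Representation.character_eq_add_of_isCompl (g : G) :
    ρ.character g = (ρ.subrepresentation W hW).character g +
      (ρ.subrepresentation W' hW').character g := by
  unfold Representation.character
  rw [← ρ.conj_prodMap_subrepresentation W W' hW hW' hc g, LinearMap.trace_conj',
    LinearMap.trace_prodMap']

include hc in
theorem Representation.det_eq_mul_of_isCompl (g : G) :
    LinearMap.det (ρ g) = LinearMap.det (ρ.subrepresentation W hW g) *
      LinearMap.det (ρ.subrepresentation W' hW' g) := by
  rw [← ρ.conj_prodMap_subrepresentation W W' hW hW' hc g, LinearEquiv.conj_apply,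
    LinearMap.comp_assoc, LinearMap.det_conj, LinearMap.det_prodMap]

end RepresentationSplitting

section CharacterClosure

variable {G H : Type} [Group G] [Group H]

theorem isCharacter_of_representation {V : Type} [AddCommGroup V] [Module ℂ V]
    [FiniteDimensional ℂ V] (ρ : Representation ℂ G V) : IsCharacter G ρ.character :=
  ⟨FDRep.of ρ, fun _ => rfl⟩

theorem IsCharacter.exists_representation {χ : G → ℂ} (h : IsCharacter G χ) :
    ∃ (V : Type) (_ : AddCommGroup V) (_ : Module ℂ V) (_ : FiniteDimensional ℂ V)
      (ρ : Representation ℂ G V), χ = ρ.character := by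
  obtain ⟨V, hV⟩ := h
  exact ⟨V, inferInstance, inferInstance, inferInstance, V.ρ, funext hV⟩

theorem IsCharacter.zero : IsCharacter G (0 : G → ℂ) := by
  have := isCharacter_of_representation (Representation.trivial ℂ G PUnit)
  convert this using 1
  ext g
  simp [Representation.character, Subsingleton.elim (_ : PUnit →ₗ[ℂ] PUnit) 0]

theorem IsCharacter.one : IsCharacter G (1 : G → ℂ) := by
  have := isCharacter_of_representation (Representation.trivial ℂ G ℂ)
  convert this using 1
  ext g
  simp [Representation.character]

theorem IsCharacter.add {χ ψ : G → ℂ} (h : IsCharacter G χ) (h' : IsCharacter G ψ) :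
    IsCharacter G (χ + ψ) := by
  obtain ⟨V, _, _, _, ρ, rfl⟩ := h.exists_representation
  obtain ⟨W, _, _, _, σ, rfl⟩ := h'.exists_representation
  convert isCharacter_of_representation (ρ.prod σ) using 1
  ext g
  simp only [Pi.add_apply, Representation.character]
  exact (LinearMap.trace_prodMap' _ _).symm

theorem IsCharacter.mul {χ ψ : G → ℂ} (h : IsCharacter G χ) (h' : IsCharacter G ψ) :
    IsCharacter G (χ * ψ) := by
  obtain ⟨V, _, _, _, ρ, rfl⟩ := h.exists_representation
  obtain ⟨W, _, _, _, σ, rfl⟩ := h'.exists_representation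
  rw [← Representation.char_tensor]
  exact isCharacter_of_representation _

theorem IsCharacter.comp {χ : G → ℂ} (h : IsCharacter G χ) (f : H →* G) :
    IsCharacter H (χ ∘ f) := by
  obtain ⟨V, _, _, _, ρ, rfl⟩ := h.exists_representation
  exact isCharacter_of_representation (ρ.comp f)

/-- The dual (contragredient) of a class function. -/
def dualFn (χ : G → ℂ) : G → ℂ := fun g => χ g⁻¹

@[simp] theorem dualFn_apply (χ : G → ℂ) (g : G) : dualFn χ g = χ g⁻¹ := rfl

@[simp] theorem dualFn_dualFn (χ : G → ℂ) : dualFn (dualFn χ) = χ := by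
  ext g
  simp

theorem IsCharacter.dual {χ : G → ℂ} (h : IsCharacter G χ) : IsCharacter G (dualFn χ) := by
  obtain ⟨V, _, _, _, ρ, rfl⟩ := h.exists_representation
  convert isCharacter_of_representation ρ.dual using 1
  ext g
  exact (ρ.char_dual g).symm

theorem IsCharacter.mul_comm_apply {χ : G → ℂ} (h : IsCharacter G χ) (a b : G) :
    χ (a * b) = χ (b * a) := by
  obtain ⟨V, _, _, _, ρ, rfl⟩ := h.exists_representation
  exact ρ.char_mul_comm b a

theorem IsCharacter.conj_apply {χ : G → ℂ} (h : IsCharacter G χ) (x g : G) :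
    χ (x * g * x⁻¹) = χ g := by
  rw [h.mul_comm_apply, inv_mul_cancel_left]

theorem IsCharacter.exists_degree {χ : G → ℂ} (h : IsCharacter G χ) : ∃ n : ℕ, χ 1 = n := by
  obtain ⟨V, _, _, _, ρ, rfl⟩ := h.exists_representation
  exact ⟨_, ρ.char_one⟩

theorem Representation.character_eq_zero_iff {V : Type} [AddCommGroup V] [Module ℂ V]
    [FiniteDimensional ℂ V] (ρ : Representation ℂ G V) :
    ρ.character = 0 ↔ Subsingleton V := by
  constructor
  · intro h
    have := congrFun h 1
    rw [ρ.char_one, Pi.zero_apply] at this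
    exact Module.finrank_zero_iff.1 (by exact_mod_cast this)
  · intro h
    ext g
    simp [Representation.character, Subsingleton.elim (ρ g) 0]

theorem IsCharacter.eq_zero_of_apply_one {χ : G → ℂ} (h : IsCharacter G χ) (h1 : χ 1 = 0) :
    χ = 0 := by
  obtain ⟨V, _, _, _, ρ, rfl⟩ := h.exists_representation
  rw [Representation.character_eq_zero_iff]
  rw [ρ.char_one] at h1
  exact Module.finrank_zero_iff.1 (by exact_mod_cast h1)

theorem IsCharacter.nsmul {χ : G → ℂ} (h : IsCharacter G χ) (n : ℕ) :
    IsCharacter G (n • χ) := by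
  induction n with
  | zero => simpa using IsCharacter.zero
  | succ n ih => rw [succ_nsmul]; exact ih.add h

theorem IsCharacter.sum {ι : Type*} (s : Finset ι) {f : ι → G → ℂ}
    (h : ∀ i ∈ s, IsCharacter G (f i)) : IsCharacter G (∑ i ∈ s, f i) :=
  Finset.sum_induction _ _ (fun _ _ => IsCharacter.add) IsCharacter.zero h

theorem isCharacter_of_monoidHom (l : G →* ℂ) : IsCharacter G l := by
  let ρ : Representation ℂ G ℂ :=
    ((Module.toModuleEnd ℂ (S := ℂ) ℂ).toMonoidHom : ℂ →* Module.End ℂ ℂ).comp l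
  convert isCharacter_of_representation ρ using 1
  ext g
  simp only [Representation.character]
  rw [LinearMap.trace_eq_matrix_trace ℂ (Module.Basis.singleton Unit ℂ)]
  simp [Matrix.trace, ρ]

end CharacterClosure

section InnerProduct

variable {G : Type} [Group G] [Finite G]

/-- The bilinear pairing `|G|⁻¹ ∑ f(g) h(g⁻¹)` on complex functions on a finite group. -/
def ip (f h : G → ℂ) : ℂ :=
  letI := Fintype.ofFinite G
  (Nat.card G : ℂ)⁻¹ * ∑ g : G, f g * h g⁻¹

theorem ip_eq [Fintype G] (f h : G → ℂ) :
    ip f h = (Nat.card G : ℂ)⁻¹ * ∑ g : G, f g * h g⁻¹ := by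
  unfold ip
  congr!

theorem card_ne_zero' : (Nat.card G : ℂ) ≠ 0 := by
  exact_mod_cast Nat.card_pos.ne'

theorem ip_comm (f h : G → ℂ) : ip f h = ip h f := by
  let := Fintype.ofFinite G
  rw [ip_eq, ip_eq]
  congr 1
  rw [← Equiv.sum_comp (Equiv.inv G)]
  simp [mul_comm]

theorem ip_add_left (f f' h : G → ℂ) : ip (f + f') h = ip f h + ip f' h := by
  let := Fintype.ofFinite G
  simp only [ip_eq, ← mul_add, ← Finset.sum_add_distrib, Pi.add_apply, add_mul]

theorem ip_add_right (f h h' : G → ℂ) : ip f (h + h') = ip f h + ip f h' := by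
  rw [ip_comm, ip_add_left, ip_comm h, ip_comm h']

theorem ip_smul_left (c : ℂ) (f h : G → ℂ) : ip (c • f) h = c * ip f h := by
  let := Fintype.ofFinite G
  simp only [ip_eq, Pi.smul_apply, smul_eq_mul, Finset.mul_sum]
  exact Finset.sum_congr rfl fun _ _ => by ring

theorem ip_smul_right (c : ℂ) (f h : G → ℂ) : ip f (c • h) = c * ip f h := by
  rw [ip_comm, ip_smul_left, ip_comm]

@[simp] theorem ip_zero_left (h : G → ℂ) : ip 0 h = 0 := by
  simpa using ip_smul_left 0 (0 : G → ℂ) h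

@[simp] theorem ip_zero_right (h : G → ℂ) : ip h 0 = 0 := by
  rw [ip_comm, ip_zero_left]

theorem ip_sub_left (f f' h : G → ℂ) : ip (f - f') h = ip f h - ip f' h := by
  have := ip_add_left (f - f') f' h
  rw [sub_add_cancel] at this
  rw [this, add_sub_cancel_right]

theorem ip_sum_left {ι : Type*} (s : Finset ι) (f : ι → G → ℂ) (h : G → ℂ) :
    ip (∑ i ∈ s, f i) h = ∑ i ∈ s, ip (f i) h := by
  induction s using Finset.induction with
  | empty => simp
  | insert a s ha ih => rw [Finset.sum_insert ha, ip_add_left, ih, Finset.sum_insert ha]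

theorem ip_sum_right {ι : Type*} (s : Finset ι) (f : ι → G → ℂ) (h : G → ℂ) :
    ip h (∑ i ∈ s, f i) = ∑ i ∈ s, ip h (f i) := by
  rw [ip_comm, ip_sum_left]
  exact Finset.sum_congr rfl fun i _ => ip_comm _ _

theorem ip_mul_left (a f h : G → ℂ) : ip (a * f) h = ip f (dualFn a * h) := by
  let := Fintype.ofFinite G
  simp only [ip_eq, Pi.mul_apply, dualFn_apply, inv_inv]
  congr 1
  exact Finset.sum_congr rfl fun _ _ => by ring

theorem ip_mul_right (a f h : G → ℂ) : ip f (a * h) = ip (dualFn a * f) h := by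
  rw [ip_mul_left, dualFn_dualFn]

theorem ip_dual_dual (f h : G → ℂ) : ip (dualFn f) (dualFn h) = ip f h := by
  let := Fintype.ofFinite G
  rw [ip_comm]
  simp only [ip_eq, dualFn_apply, inv_inv, mul_comm]

theorem Representation.ip_character_eq_finrank {V W : Type} [AddCommGroup V] [Module ℂ V]
    [FiniteDimensional ℂ V] [AddCommGroup W] [Module ℂ W] [FiniteDimensional ℂ W]
    (ρ : Representation ℂ G V) (σ : Representation ℂ G W) :
    ip σ.character ρ.character = Module.finrank ℂ (Representation.IntertwiningMap ρ σ) := by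
  let := Fintype.ofFinite G
  let : Invertible (Nat.card G : ℂ) := invertibleOfNonzero card_ne_zero'
  rw [ip_eq, Representation.card_inv_mul_sum_char_mul_char_eq_finrank]

theorem Representation.ip_character_one_eq_finrank {V : Type} [AddCommGroup V] [Module ℂ V]
    [FiniteDimensional ℂ V] (ρ : Representation ℂ G V) :
    ip ρ.character 1 = Module.finrank ℂ ρ.invariants := by
  let := Fintype.ofFinite G
  let : Invertible (Nat.card G : ℂ) := invertibleOfNonzero card_ne_zero'
  rw [ip_eq, ← Representation.card_inv_mul_sum_char_eq_finrank]
  simp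

theorem IsCharacter.exists_ip {χ ψ : G → ℂ} (h : IsCharacter G χ) (h' : IsCharacter G ψ) :
    ∃ n : ℕ, ip χ ψ = n := by
  obtain ⟨V, _, _, _, ρ, rfl⟩ := h.exists_representation
  obtain ⟨W, _, _, _, σ, rfl⟩ := h'.exists_representation
  exact ⟨_, σ.ip_character_eq_finrank ρ⟩

theorem IsCharacter.ip_self_ne_zero {χ : G → ℂ} (h : IsCharacter G χ) (h0 : χ ≠ 0) :
    ip χ χ ≠ 0 := by
  obtain ⟨V, _, _, _, ρ, rfl⟩ := h.exists_representation
  rw [ρ.ip_character_eq_finrank, Nat.cast_ne_zero]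
  rw [Ne, Representation.character_eq_zero_iff] at h0
  have : Nontrivial V := not_subsingleton_iff_nontrivial.1 h0
  have : Nontrivial (Representation.IntertwiningMap ρ ρ) := by
    refine ⟨1, 0, fun h => ?_⟩
    obtain ⟨v, hv⟩ := exists_ne (0 : V)
    exact hv congr($h v)
  have : FiniteDimensional ℂ (Representation.IntertwiningMap ρ ρ) :=
    FiniteDimensional.of_injective (Representation.IntertwiningMap.toLinearMapl ρ ρ)
      (fun a b h => Representation.IntertwiningMap.toLinearMap_injective _ _ h)
  exact Module.finrank_pos.ne'

theorem IsIrrChar.isIrreducible {V : Type} [AddCommGroup V] [Module ℂ V]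
    [FiniteDimensional ℂ V] {ρ : Representation ℂ G V} (h : IsIrrChar G ρ.character) :
    ρ.IsIrreducible := by
  obtain ⟨-, h0, hi⟩ := h
  rw [Ne, Representation.character_eq_zero_iff] at h0
  have : Nontrivial V := not_subsingleton_iff_nontrivial.1 h0
  have hbt : (⊥ : Subrepresentation ρ) ≠ ⊤ := fun h =>
    bot_ne_top (α := Submodule ℂ V) (congrArg Subrepresentation.toSubmodule h)
  refine { exists_pair_ne := ⟨⊥, ⊤, hbt⟩, eq_bot_or_eq_top := fun W => ?_ }
  by_contra! hW
  have hinv : ∀ g, W.toSubmodule ≤ W.toSubmodule.comap (ρ g) :=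
    fun g v hv => W.apply_mem_toSubmodule g hv
  obtain ⟨W', hinv', hc⟩ := ρ.exists_invariant_isCompl W.toSubmodule hinv
  refine hi ⟨_, _, isCharacter_of_representation (ρ.subrepresentation _ hinv), ?_,
    isCharacter_of_representation (ρ.subrepresentation _ hinv'), ?_,
    funext fun g => ρ.character_eq_add_of_isCompl _ _ hinv hinv' hc g⟩
  · rw [Ne, Representation.character_eq_zero_iff]
    intro hs
    have hb : W.toSubmodule = ⊥ := Submodule.eq_bot_of_subsingleton
    exact hW.1 (Subrepresentation.toSubmodule_injective hb)
  · rw [Ne, Representation.character_eq_zero_iff]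
    intro hs
    have hb : W' = ⊥ := Submodule.eq_bot_of_subsingleton
    have ht : W.toSubmodule = ⊤ := by simpa [hb] using hc.sup_eq_top
    exact hW.2 (Subrepresentation.toSubmodule_injective ht)

theorem IsIrrChar.ip_eq_ite {χ ψ : G → ℂ} (h : IsIrrChar G χ) (h' : IsIrrChar G ψ) :
    ip χ ψ = if χ = ψ then 1 else 0 := by
  obtain ⟨V, _, _, _, ρ, rfl⟩ := h.1.exists_representation
  obtain ⟨W, _, _, _, σ, rfl⟩ := h'.1.exists_representation
  have := h.isIrreducible
  have := h'.isIrreducible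
  let := Fintype.ofFinite G
  let : Invertible (Nat.card G : ℂ) := invertibleOfNonzero card_ne_zero'
  have key := Representation.char_orthonormal ρ σ
  rw [← ip_eq] at key
  rw [key]
  by_cases hn : Nonempty (σ.Equiv ρ)
  · have : ρ.character = σ.character := (Representation.char_iso hn.some).symm
    simp [hn, this]
  · have : ρ.character ≠ σ.character := by
      intro he
      rw [if_neg hn, ← he] at key
      exact h.1.ip_self_ne_zero h.2.1 (by simpa using key)
    simp [hn, this]

theorem IsIrrChar.ip_self {χ : G → ℂ} (h : IsIrrChar G χ) : ip χ χ = 1 := by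
  simp [h.ip_eq_ite h]

theorem IsIrrChar.ip_of_ne {χ ψ : G → ℂ} (h : IsIrrChar G χ) (h' : IsIrrChar G ψ)
    (hne : χ ≠ ψ) : ip χ ψ = 0 := by
  simp [h.ip_eq_ite h', hne]

theorem IsIrrChar.eq_of_ip_ne_zero {χ ψ : G → ℂ} (h : IsIrrChar G χ) (h' : IsIrrChar G ψ)
    (hne : ip χ ψ ≠ 0) : χ = ψ := by
  by_contra hc
  exact hne (h.ip_of_ne h' hc)

theorem IsCharacter.isIrrChar_of_ip_self {χ : G → ℂ} (h : IsCharacter G χ) (h1 : ip χ χ = 1) :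
    IsIrrChar G χ := by
  refine ⟨h, fun h0 => by simp [h0] at h1, ?_⟩
  rintro ⟨χ₁, χ₂, hc₁, h₁, hc₂, h₂, rfl⟩
  obtain ⟨a, ha⟩ := hc₁.exists_ip hc₁
  obtain ⟨b, hb⟩ := hc₂.exists_ip hc₂
  obtain ⟨c, hc⟩ := hc₁.exists_ip hc₂
  have ha0 := hc₁.ip_self_ne_zero h₁
  have hb0 := hc₂.ip_self_ne_zero h₂
  rw [ip_add_left, ip_add_right, ip_add_right, ip_comm χ₂ χ₁] at h1
  rw [ha, hb, hc] at h1
  rw [ha, Nat.cast_ne_zero] at ha0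
  rw [hb, Nat.cast_ne_zero] at hb0
  have : a + c + (c + b) = 1 := by exact_mod_cast h1
  omega

omit [Finite G] in
theorem IsCharacter.degree_pos {χ : G → ℂ} (h : IsCharacter G χ) (h0 : χ ≠ 0) :
    ∃ n : ℕ, χ 1 = n ∧ 0 < n := by
  obtain ⟨n, hn⟩ := h.exists_degree
  refine ⟨n, hn, Nat.pos_of_ne_zero fun hz => h0 (h.eq_zero_of_apply_one ?_)⟩
  rw [hn, hz, Nat.cast_zero]

omit [Finite G] in
/-- Every property of functions that holds for zero and is preserved under adding an irreducible
character to a character holds for all characters. -/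
theorem IsCharacter.induction_on {P : (G → ℂ) → Prop} {χ : G → ℂ} (h : IsCharacter G χ)
    (zero : P 0)
    (add : ∀ θ ψ, IsIrrChar G θ → IsCharacter G ψ → P ψ → P (θ + ψ)) : P χ := by
  suffices ∀ n : ℕ, ∀ χ ψ, IsCharacter G χ → IsCharacter G ψ → P ψ → χ 1 = n → P (χ + ψ) by
    obtain ⟨n, hn⟩ := h.exists_degree
    simpa using this n χ 0 h IsCharacter.zero zero hn
  intro n
  induction n using Nat.strong_induction_on with
  | _ n ih =>
    intro χ ψ hχ hψ hP hn
    by_cases h0 : χ = 0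
    · simpa [h0] using hP
    by_cases hi : IsIrrChar G χ
    · exact add _ _ hi hψ hP
    obtain ⟨χ₁, χ₂, hc₁, h₁, hc₂, h₂, rfl⟩ : ∃ χ₁ χ₂ : G → ℂ, IsCharacter G χ₁ ∧ χ₁ ≠ 0 ∧
        IsCharacter G χ₂ ∧ χ₂ ≠ 0 ∧ χ = χ₁ + χ₂ := by
      by_contra hne
      exact hi ⟨hχ, h0, hne⟩
    obtain ⟨a, ha, ha0⟩ := hc₁.degree_pos h₁
    obtain ⟨b, hb, hb0⟩ := hc₂.degree_pos h₂
    have hab : a + b = n := by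
      have : (a + b : ℂ) = n := by rw [← hn, Pi.add_apply, ha, hb]
      exact_mod_cast this
    rw [add_assoc]
    exact ih a (by omega) _ _ hc₁ (hc₂.add hψ) (ih b (by omega) _ _ hc₂ hψ hP hb) ha

theorem IsCharacter.eq_zero_of_ip_irr {χ : G → ℂ} (h : IsCharacter G χ)
    (h0 : ∀ θ, IsIrrChar G θ → ip χ θ = 0) : χ = 0 := by
  by_contra hne
  apply h.ip_self_ne_zero hne
  suffices ∀ ψ, IsCharacter G ψ → ip χ ψ = 0 from this χ h
  intro ψ hψ
  refine hψ.induction_on (P := fun ψ => ip χ ψ = 0) (by simp) fun θ ψ hθ _ ih => ?_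
  rw [ip_add_right, h0 θ hθ, ih, add_zero]

theorem IsCharacter.exists_irr_ip_ne_zero {χ : G → ℂ} (h : IsCharacter G χ) (h0 : χ ≠ 0) :
    ∃ θ, IsIrrChar G θ ∧ ip χ θ ≠ 0 := by
  by_contra! hc
  exact h0 (h.eq_zero_of_ip_irr hc)

/-- A positive multiplicity lets an irreducible character be split off. -/
theorem IsCharacter.exists_eq_add {χ θ : G → ℂ} (h : IsCharacter G χ) (hθ : IsIrrChar G θ)
    (hne : ip χ θ ≠ 0) : ∃ ξ, IsCharacter G ξ ∧ χ = θ + ξ := by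
  revert hne
  refine h.induction_on (P := fun χ => ip χ θ ≠ 0 → ∃ ξ, IsCharacter G ξ ∧ χ = θ + ξ)
    (by simp) fun η ψ hη hψ ih hne => ?_
  by_cases he : η = θ
  · exact ⟨ψ, hψ, by rw [he]⟩
  · rw [ip_add_left, hη.ip_of_ne hθ he, zero_add] at hne
    obtain ⟨ξ, hξ, rfl⟩ := ih hne
    exact ⟨η + ξ, hη.1.add hξ, by rw [add_left_comm]⟩

theorem isConstituent_iff {χ θ : G → ℂ} (h : IsCharacter G χ) :
    IsConstituent θ χ ↔ IsIrrChar G θ ∧ ip χ θ ≠ 0 := by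
  constructor
  · rintro ⟨hθ, ξ, hξ, rfl⟩
    refine ⟨hθ, ?_⟩
    have hξ' : IsCharacter G ξ := by
      rcases hξ with rfl | hξ
      · exact IsCharacter.zero
      · exact hξ
    obtain ⟨n, hn⟩ := hξ'.exists_ip hθ.1
    rw [ip_add_left, hθ.ip_self, hn]
    exact_mod_cast (by omega : 1 + n ≠ 0)
  · rintro ⟨hθ, hne⟩
    obtain ⟨ξ, hξ, he⟩ := h.exists_eq_add hθ hne
    exact ⟨hθ, ξ, Or.inr hξ, he⟩

omit [Finite G] in
theorem IsIrrChar.exists_degree_pos {χ : G → ℂ} (h : IsIrrChar G χ) :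
    ∃ n : ℕ, χ 1 = n ∧ 0 < n := h.1.degree_pos h.2.1

end InnerProduct

section Completeness

variable {G : Type} [Group G]

/-- `f` is constant on conjugacy classes. -/
def IsClassFn (f : G → ℂ) : Prop := ∀ x g, f (x * g * x⁻¹) = f g

theorem IsCharacter.isClassFn {χ : G → ℂ} (h : IsCharacter G χ) : IsClassFn χ := h.conj_apply

theorem IsClassFn.add {f h : G → ℂ} (hf : IsClassFn f) (hh : IsClassFn h) : IsClassFn (f + h) :=
  fun x g => by simp [hf x g, hh x g]

theorem IsClassFn.sub {f h : G → ℂ} (hf : IsClassFn f) (hh : IsClassFn h) : IsClassFn (f - h) :=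
  fun x g => by simp [hf x g, hh x g]

theorem IsClassFn.smul {f : G → ℂ} (c : ℂ) (hf : IsClassFn f) : IsClassFn (c • f) :=
  fun x g => by simp [hf x g]

theorem IsClassFn.sum {ι : Type*} (s : Finset ι) {f : ι → G → ℂ}
    (h : ∀ i ∈ s, IsClassFn (f i)) : IsClassFn (∑ i ∈ s, f i) :=
  Finset.sum_induction _ _ (fun _ _ => IsClassFn.add) (fun _ _ => rfl) h

theorem IsClassFn.comp {H : Type} [Group H] {f : G → ℂ} (hf : IsClassFn f) (i : H →* G) :
    IsClassFn (f ∘ i) := fun x g => by simp [hf (i x)]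

variable {V : Type} [AddCommGroup V] [Module ℂ V]

/-- The operator `∑ f(g) ρ(g)`. -/
def Representation.sumOp [Fintype G] (ρ : Representation ℂ G V) (f : G → ℂ) : V →ₗ[ℂ] V :=
  ∑ g : G, f g • ρ g

theorem Representation.sumOp_comm [Fintype G] (ρ : Representation ℂ G V) {f : G → ℂ}
    (hf : IsClassFn f) (x : G) : ρ x ∘ₗ ρ.sumOp f = ρ.sumOp f ∘ₗ ρ x := by
  ext v
  simp only [sumOp, LinearMap.comp_apply, LinearMap.sum_apply, LinearMap.smul_apply, map_sum,
    map_smul]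
  rw [← Equiv.sum_comp (MulAut.conj x).toEquiv]
  conv_rhs => rw [← Equiv.sum_comp (MulAut.conj x).toEquiv]
  rw [Equiv.sum_comp (MulAut.conj x).toEquiv (fun g => f g • ρ x (ρ g v))]
  refine Finset.sum_congr rfl fun g _ => ?_
  have : (MulAut.conj x).toEquiv g = x * g * x⁻¹ := rfl
  rw [this, hf, ← Module.End.mul_apply, ← Module.End.mul_apply, ← map_mul, ← map_mul]
  simp

variable [FiniteDimensional ℂ V]

omit [FiniteDimensional ℂ V] in
theorem Representation.trace_sumOp [Fintype G] (ρ : Representation ℂ G V) (f : G → ℂ) :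
    LinearMap.trace ℂ V (ρ.sumOp f) = ∑ g : G, f g * ρ.character g := by
  simp [sumOp, Representation.character]

theorem Representation.exists_sumOp_eq_smul [Fintype G] (ρ : Representation ℂ G V)
    [ρ.IsIrreducible] {f : G → ℂ} (hf : IsClassFn f) :
    ∃ c : ℂ, ρ.sumOp f = c • LinearMap.id := by
  let T : Representation.IntertwiningMap ρ ρ :=
    ⟨ρ.sumOp f, fun g => (ρ.sumOp_comm hf g).symm⟩
  obtain ⟨c, hc⟩ := Representation.IsIrreducible.algebraMap_intertwiningMap_bijective_of_isAlgClosed.2 T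
  refine ⟨c, ?_⟩
  ext v
  have := congr($hc v)
  simpa [T] using this.symm

omit [FiniteDimensional ℂ V] in
theorem Representation.isIrreducible_of_subsingleton_or [Nontrivial V] (ρ : Representation ℂ G V)
    (h : ∀ W : Submodule ℂ V, (∀ g, W ≤ W.comap (ρ g)) → W = ⊥ ∨ W = ⊤) : ρ.IsIrreducible := by
  have hbt : (⊥ : Subrepresentation ρ) ≠ ⊤ := fun h =>
    bot_ne_top (α := Submodule ℂ V) (congrArg Subrepresentation.toSubmodule h)
  refine { exists_pair_ne := ⟨⊥, ⊤, hbt⟩, eq_bot_or_eq_top := fun W => ?_ }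
  rcases h W.toSubmodule (fun g v hv => W.apply_mem_toSubmodule g hv) with h | h
  · exact Or.inl (Subrepresentation.toSubmodule_injective h)
  · exact Or.inr (Subrepresentation.toSubmodule_injective h)

variable [Finite G]

theorem Representation.isIrrChar_character (ρ : Representation ℂ G V) [ρ.IsIrreducible] :
    IsIrrChar G ρ.character := by
  apply (isCharacter_of_representation ρ).isIrrChar_of_ip_self
  rw [ρ.ip_character_eq_finrank, Representation.IsIrreducible.finrank_intertwiningMap_self]
  simp

omit [Finite G] in
omit [FiniteDimensional ℂ V] in
theorem Representation.sumOp_subrepresentation [Fintype G] (ρ : Representation ℂ G V)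
    (f : G → ℂ) (W : Submodule ℂ V) (hW : ∀ g, W ≤ W.comap (ρ g)) (w : W) :
    ((ρ.subrepresentation W hW).sumOp f w : V) = ρ.sumOp f w := by
  simp [sumOp]

theorem Representation.sumOp_eq_zero [Fintype G] {f : G → ℂ} (hf : IsClassFn f)
    (h0 : ∀ θ, IsIrrChar G θ → ip (dualFn f) θ = 0) (n : ℕ) :
    ∀ (V : Type) [AddCommGroup V] [Module ℂ V] [FiniteDimensional ℂ V]
      (ρ : Representation ℂ G V), Module.finrank ℂ V = n → ρ.sumOp f = 0 := by
  induction n using Nat.strong_induction_on with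
  | _ n ih =>
    intro V _ _ _ ρ hn
    rcases subsingleton_or_nontrivial V with hs | hs
    · exact Subsingleton.elim _ _
    by_cases hi : ρ.IsIrreducible
    · obtain ⟨c, hc⟩ := ρ.exists_sumOp_eq_smul hf
      have h1 := h0 _ ρ.isIrrChar_character
      rw [ip_eq, ← Equiv.sum_comp (Equiv.inv G)] at h1
      have h2 : ∑ g : G, f g * ρ.character g = 0 := by
        simpa [card_ne_zero'] using h1
      rw [← ρ.trace_sumOp, hc] at h2
      have h3 : (Module.finrank ℂ V : ℂ) ≠ 0 := by exact_mod_cast Module.finrank_pos.ne'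
      have : c = 0 := by simpa [h3] using h2
      rw [hc, this, zero_smul]
    · obtain ⟨W, hW, hb, ht⟩ : ∃ W : Submodule ℂ V, (∀ g, W ≤ W.comap (ρ g)) ∧ W ≠ ⊥ ∧ W ≠ ⊤ := by
        by_contra! hc
        exact hi (ρ.isIrreducible_of_subsingleton_or fun W hW => or_iff_not_imp_left.2 (hc W hW))
      obtain ⟨W', hW', hcpl⟩ := ρ.exists_invariant_isCompl W hW
      have hdim := Submodule.finrank_add_eq_of_isCompl hcpl
      have hpos : 0 < Module.finrank ℂ W := by
        rw [Module.finrank_pos_iff]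
        exact Submodule.nontrivial_iff_ne_bot.2 hb
      have hlt : Module.finrank ℂ W < n := hn ▸ Submodule.finrank_lt ht
      have e1 := ih _ hlt W (ρ.subrepresentation W hW) rfl
      have e2 := ih _ (by omega) W' (ρ.subrepresentation W' hW') rfl
      ext v
      obtain ⟨⟨a, b⟩, rfl⟩ := (W.prodEquivOfIsCompl W' hcpl).surjective v
      have h1 := ρ.sumOp_subrepresentation f W hW a
      have h2 := ρ.sumOp_subrepresentation f W' hW' b
      rw [e1] at h1
      rw [e2] at h2
      simp [← h1, ← h2]

/-- The right regular representation on functions. -/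
def rightRegular (G : Type) [Group G] : Representation ℂ G (G → ℂ) where
  toFun g := LinearMap.funLeft ℂ ℂ (fun x => x * g)
  map_one' := by ext; simp [LinearMap.funLeft]
  map_mul' a b := by
    refine LinearMap.ext fun φ => funext fun x => ?_
    simp [LinearMap.funLeft, mul_assoc]

theorem IsClassFn.eq_zero_of_ip {f : G → ℂ} (hf : IsClassFn f)
    (h0 : ∀ θ, IsIrrChar G θ → ip f θ = 0) : f = 0 := by
  let _ := Fintype.ofFinite G
  have hd : IsClassFn (dualFn f) := fun x g => by
    simp only [dualFn_apply]
    rw [← hf x g⁻¹]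
    group
  have := Representation.sumOp_eq_zero hd (by simpa using h0) _ (G → ℂ) (rightRegular G) rfl
  ext x
  have h1 := congrFun (congr($this (Pi.single 1 1))) x
  simp only [Representation.sumOp, LinearMap.sum_apply, Finset.sum_apply, LinearMap.smul_apply,
    Pi.smul_apply, rightRegular, MonoidHom.coe_mk, OneHom.coe_mk, LinearMap.funLeft_apply,
    dualFn_apply, smul_eq_mul, LinearMap.zero_apply, Pi.zero_apply] at h1
  rw [Finset.sum_eq_single x⁻¹] at h1
  · simpa using h1
  · intro b _ hb
    rw [Pi.single_eq_of_ne, mul_zero]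
    intro hx
    exact hb (eq_inv_of_mul_eq_one_right hx)
  · simp

theorem IsClassFn.ext_ip {f h : G → ℂ} (hf : IsClassFn f) (hh : IsClassFn h)
    (he : ∀ θ, IsIrrChar G θ → ip f θ = ip h θ) : f = h := by
  rw [← sub_eq_zero]
  apply (hf.sub hh).eq_zero_of_ip
  intro θ hθ
  rw [ip_sub_left, he θ hθ, sub_self]

theorem finite_isIrrChar (G : Type) [Group G] [Finite G] : {θ : G → ℂ | IsIrrChar G θ}.Finite := by
  have : LinearIndependent ℂ (fun θ : {θ : G → ℂ // IsIrrChar G θ} => θ.1) := by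
    rw [linearIndependent_iff']
    intro s c hs i hi
    have := congrArg (fun f => ip f i.1) hs
    simp only [ip_sum_left, ip_zero_left, ip_smul_left] at this
    rw [Finset.sum_eq_single i] at this
    · simpa [i.2.ip_self] using this
    · intro j _ hj
      rw [j.2.ip_of_ne i.2 (fun h => hj (Subtype.ext h)), mul_zero]
    · exact fun h => absurd hi h
  exact this.finite

/-- The finite set of irreducible characters. -/
def irrChars (G : Type) [Group G] [Finite G] : Finset (G → ℂ) := (finite_isIrrChar G).toFinset

@[simp] theorem mem_irrChars {θ : G → ℂ} : θ ∈ irrChars G ↔ IsIrrChar G θ := by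
  simp [irrChars]

theorem ip_sum_irr {c : (G → ℂ) → ℂ} {θ : G → ℂ} (hθ : IsIrrChar G θ) (s : Finset (G → ℂ))
    (hs : s ⊆ irrChars G) : ip (∑ η ∈ s, c η • η) θ = if θ ∈ s then c θ else 0 := by
  rw [ip_sum_left]
  have : ∀ η ∈ s, ip (c η • η) θ = if η = θ then c η else 0 := by
    intro η hη
    rw [ip_smul_left, (mem_irrChars.1 (hs hη)).ip_eq_ite hθ]
    simp
  rw [Finset.sum_congr rfl this]
  simp

theorem IsClassFn.eq_sum_irr {f : G → ℂ} (hf : IsClassFn f) :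
    f = ∑ θ ∈ irrChars G, ip f θ • θ := by
  refine hf.ext_ip (IsClassFn.sum _ fun θ hθ => ((mem_irrChars.1 hθ).1.isClassFn).smul _) ?_
  intro θ hθ
  rw [ip_sum_irr hθ _ subset_rfl, if_pos (mem_irrChars.2 hθ)]

theorem IsClassFn.isCharacter_of_ip {f : G → ℂ} (hf : IsClassFn f)
    (h : ∀ θ, IsIrrChar G θ → ∃ n : ℕ, ip f θ = n) : IsCharacter G f := by
  rw [hf.eq_sum_irr]
  refine IsCharacter.sum _ fun θ hθ => ?_
  obtain ⟨n, hn⟩ := h θ (mem_irrChars.1 hθ)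
  rw [hn, Nat.cast_smul_eq_nsmul]
  exact (mem_irrChars.1 hθ).1.nsmul n

end Completeness

section Push

variable {G H : Type} [Group G] [Group H] [Finite G] [Finite H]

/-- Induction of a function along an arbitrary homomorphism of finite groups. -/
def push (f : H →* G) (ψ : H → ℂ) : G → ℂ := fun g =>
  letI := Fintype.ofFinite G
  letI := Fintype.ofFinite H
  (Nat.card H : ℂ)⁻¹ * ∑ x : G, ∑ h : H, if f h = x * g * x⁻¹ then ψ h else 0

theorem push_apply [Fintype G] [Fintype H] (f : H →* G) (ψ : H → ℂ) (g : G) :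
    push f ψ g =
      (Nat.card H : ℂ)⁻¹ * ∑ x : G, ∑ h : H, if f h = x * g * x⁻¹ then ψ h else 0 := by
  unfold push
  congr!

theorem isClassFn_push (f : H →* G) (ψ : H → ℂ) : IsClassFn (push f ψ) := by
  let _ := Fintype.ofFinite G
  let _ := Fintype.ofFinite H
  intro y g
  rw [push_apply, push_apply]
  congr 1
  rw [← Equiv.sum_comp (Equiv.mulRight y⁻¹)]
  refine Finset.sum_congr rfl fun x _ => Finset.sum_congr rfl fun h _ => ?_
  simp [mul_assoc]

/-- Frobenius reciprocity. -/
theorem ip_push (f : H →* G) (ψ : H → ℂ) {χ : G → ℂ} (hχ : IsClassFn χ) :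
    ip (push f ψ) χ = ip ψ (χ ∘ f) := by
  let _ := Fintype.ofFinite G
  let _ := Fintype.ofFinite H
  rw [ip_eq, ip_eq]
  simp only [push_apply, mul_assoc, ← Finset.mul_sum, Finset.sum_mul]
  have : ∑ g : G, ∑ x : G, ∑ h : H, (if f h = x * (g * x⁻¹) then ψ h else 0) * χ g⁻¹ =
      Nat.card G * ∑ h : H, ψ h * χ (f h⁻¹) := by
    rw [Finset.sum_comm]
    simp_rw [Finset.sum_comm (s := (Finset.univ : Finset G)) (t := (Finset.univ : Finset H))]
    rw [Finset.mul_sum]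
    refine Finset.sum_congr rfl fun h _ => ?_
    have : ∀ x : G, ∑ g : G, (if f h = x * (g * x⁻¹) then ψ h else 0) * χ g⁻¹ =
        ψ h * χ (f h⁻¹) := by
      intro x
      rw [Finset.sum_eq_single (x⁻¹ * f h * x)]
      · have : χ (x⁻¹ * f h * x)⁻¹ = χ (f h⁻¹) := by
          rw [map_inv, ← hχ x⁻¹ (f h)⁻¹]
          group
        rw [this, if_pos (by group)]
      · intro g _ hg
        rw [if_neg, zero_mul]
        intro he
        apply hg
        rw [he]
        group
      · simp
    rw [Finset.sum_congr rfl fun x _ => this x]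
    simp
  rw [this]
  have h0 := card_ne_zero' (G := G)
  field_simp
  rfl

theorem IsCharacter.push {ψ : H → ℂ} (h : IsCharacter H ψ) (f : H →* G) :
    IsCharacter G (push f ψ) := by
  apply (isClassFn_push f ψ).isCharacter_of_ip
  intro θ hθ
  rw [ip_push f ψ hθ.1.isClassFn]
  exact h.exists_ip (hθ.1.comp f)

theorem push_add (f : H →* G) (ψ ψ' : H → ℂ) : push f (ψ + ψ') = push f ψ + push f ψ' := by
  let _ := Fintype.ofFinite G
  let _ := Fintype.ofFinite H
  ext g
  simp only [push_apply, Pi.add_apply, ← mul_add, ← Finset.sum_add_distrib]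
  congr 1
  refine Finset.sum_congr rfl fun x _ => Finset.sum_congr rfl fun h _ => ?_
  split_ifs <;> simp

theorem push_push {K : Type} [Group K] [Finite K] (i : K →* H) (j : H →* G) (ψ : K → ℂ) :
    push j (push i ψ) = push (j.comp i) ψ := by
  refine (isClassFn_push _ _).ext_ip (isClassFn_push _ _) fun θ hθ => ?_
  rw [ip_push _ _ hθ.1.isClassFn, ip_push _ _ hθ.1.isClassFn,
    ip_push _ _ (hθ.1.isClassFn.comp j)]
  rfl

theorem push_comp_mul (f : H →* G) (ψ : H → ℂ) {χ : G → ℂ} (hχ : IsClassFn χ) :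
    push f ((χ ∘ f) * ψ) = χ * push f ψ := by
  let _ := Fintype.ofFinite G
  let _ := Fintype.ofFinite H
  ext g
  simp only [push_apply, Pi.mul_apply, Function.comp_apply, mul_left_comm (χ g), Finset.mul_sum]
  refine Finset.sum_congr rfl fun x _ => Finset.sum_congr rfl fun h _ => ?_
  split_ifs with he
  · rw [he, hχ]
  · simp

theorem push_one_apply (f : H →* G) (ψ : H → ℂ) :
    push f ψ 1 = Nat.card G * ip (ψ ∘ f.ker.subtype) 1 * (Nat.card f.ker / Nat.card H) := by
  let _ := Fintype.ofFinite G
  let _ := Fintype.ofFinite H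
  rw [push_apply, ip_eq]
  have : ∑ h : H, (if f h = 1 then ψ h else 0) = ∑ k : f.ker, ψ k := by
    rw [← Finset.sum_filter]
    exact (Finset.sum_subtype _ (by simp [MonoidHom.mem_ker]) _)
  have h0 := card_ne_zero' (G := f.ker)
  simp only [mul_one, mul_inv_cancel, this]
  simp only [Finset.sum_const, Finset.card_univ, Fintype.card_eq_nat_card, nsmul_eq_mul,
    Function.comp_apply, Subgroup.coe_subtype, Pi.one_apply, mul_one]
  field_simp

theorem push_one_of_injective {f : H →* G} (hf : Function.Injective f) (ψ : H → ℂ) :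
    push f ψ 1 = (Nat.card G / Nat.card H : ℂ) * ψ 1 := by
  let _ := Fintype.ofFinite G
  let _ := Fintype.ofFinite H
  rw [push_apply]
  have : ∀ h : H, f h = 1 ↔ h = 1 := fun h => map_eq_one_iff f hf
  simp [this]
  field_simp

theorem indChar_eq_push {G : Type} [Group G] [Fintype G] (U : Subgroup G) (ψ : U → ℂ) :
    indChar U ψ = push U.subtype ψ := by
  ext g
  rw [push_apply]
  unfold indChar
  congr 1
  refine Finset.sum_congr rfl fun x _ => ?_
  split_ifs with hx
  · rw [Finset.sum_eq_single ⟨_, hx⟩]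
    · simp
    · intro b _ hb
      rw [if_neg]
      intro h
      exact hb (Subtype.ext h)
    · simp
  · rw [Finset.sum_eq_zero]
    intro b _
    rw [if_neg]
    intro h
    exact hx (h ▸ b.2)

end Push

section Determinants

variable {G H : Type} [Group G] [Group H]

/-- The determinant of a representation as a homomorphism. -/
def Representation.detHom {V : Type} [AddCommGroup V] [Module ℂ V]
    (ρ : Representation ℂ G V) : G →* ℂ := LinearMap.det.comp ρ

@[simp] theorem Representation.detHom_apply {V : Type} [AddCommGroup V] [Module ℂ V]
    (ρ : Representation ℂ G V) (g : G) : ρ.detHom g = LinearMap.det (ρ g) := rfl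

/-- An irreducible constituent can be split off a representation, compatibly with determinants. -/
theorem Representation.exists_split [Finite G] {V : Type} [AddCommGroup V] [Module ℂ V]
    [FiniteDimensional ℂ V] (ρ : Representation ℂ G V) {W : Type} [AddCommGroup W] [Module ℂ W]
    [FiniteDimensional ℂ W] (τ : Representation ℂ G W) [τ.IsIrreducible]
    (h : ip ρ.character τ.character ≠ 0) :
    ∃ (S : Submodule ℂ V) (hS : ∀ g, S ≤ S.comap (ρ g)),
      (∀ g, ρ.character g = τ.character g + (ρ.subrepresentation S hS).character g) ∧
      (∀ g, LinearMap.det (ρ g) =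
        LinearMap.det (τ g) * LinearMap.det (ρ.subrepresentation S hS g)) := by
  rw [τ.ip_character_eq_finrank ρ, Nat.cast_ne_zero] at h
  have : Nontrivial (Representation.IntertwiningMap τ ρ) := by
    by_contra hc
    rw [not_nontrivial_iff_subsingleton] at hc
    exact h Module.finrank_zero_of_subsingleton
  obtain ⟨f, hf⟩ := exists_ne (0 : Representation.IntertwiningMap τ ρ)
  have hinj : Function.Injective f := (Representation.IsIrreducible.injective_or_eq_zero f).resolve_right hf
  have hR : ∀ g, LinearMap.range f.toLinearMap ≤ (LinearMap.range f.toLinearMap).comap (ρ g) := by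
    rintro g _ ⟨w, rfl⟩
    exact ⟨τ g w, f.isIntertwining _ _ g w⟩
  obtain ⟨S, hS, hc⟩ := ρ.exists_invariant_isCompl _ hR
  let e : W ≃ₗ[ℂ] LinearMap.range f.toLinearMap := LinearEquiv.ofInjective f.toLinearMap hinj
  have he : ∀ g, e.conj (τ g) = ρ.subrepresentation _ hR g := by
    intro g
    ext v
    obtain ⟨w, rfl⟩ := e.surjective v
    simp only [LinearEquiv.conj_apply, LinearMap.comp_apply, LinearEquiv.coe_coe,
      LinearEquiv.symm_apply_apply]
    exact f.isIntertwining _ _ g w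
  refine ⟨S, hS, fun g => ?_, fun g => ?_⟩
  · rw [ρ.character_eq_add_of_isCompl _ _ hR hS hc]
    congr 1
    unfold Representation.character
    rw [← he, LinearMap.trace_conj']
  · rw [ρ.det_eq_mul_of_isCompl _ _ hR hS hc]
    congr 1
    rw [← he, LinearEquiv.conj_apply, LinearMap.comp_assoc, LinearMap.det_conj]

theorem Representation.det_eq_of_character_eq [Finite G] (n : ℕ) :
    ∀ (V W : Type) [AddCommGroup V] [Module ℂ V] [FiniteDimensional ℂ V] [AddCommGroup W]
      [Module ℂ W] [FiniteDimensional ℂ W] (ρ : Representation ℂ G V) (σ : Representation ℂ G W),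
      Module.finrank ℂ V = n → ρ.character = σ.character →
      ∀ g, LinearMap.det (ρ g) = LinearMap.det (σ g) := by
  induction n using Nat.strong_induction_on with
  | _ n ih =>
    intro V W _ _ _ _ _ _ ρ σ hn he g
    by_cases h0 : ρ.character = 0
    · have h0' := h0
      rw [he] at h0'
      rw [Representation.character_eq_zero_iff] at h0 h0'
      rw [LinearMap.det_eq_one_of_subsingleton, LinearMap.det_eq_one_of_subsingleton]
    · obtain ⟨θ, hθ, hne⟩ := (isCharacter_of_representation ρ).exists_irr_ip_ne_zero h0
      obtain ⟨U, _, _, _, τ, rfl⟩ := hθ.1.exists_representation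
      have := hθ.isIrreducible
      obtain ⟨S, hS, hc, hd⟩ := ρ.exists_split τ hne
      obtain ⟨S', hS', hc', hd'⟩ := σ.exists_split τ (he ▸ hne)
      rw [hd, hd']
      congr 1
      refine ih (Module.finrank ℂ S) ?_ _ _ _ _ rfl ?_ g
      · have h1 := hc 1
        rw [Representation.char_one, Representation.char_one, Representation.char_one] at h1
        have h2 : Module.finrank ℂ V = Module.finrank ℂ U + Module.finrank ℂ S := by
          exact_mod_cast h1
        have h3 : Module.finrank ℂ U ≠ 0 := by
          intro hz
          apply hθ.2.1
          rw [Representation.character_eq_zero_iff]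
          exact Module.finrank_zero_iff.1 hz
        omega
      · ext x
        have := hc x
        rw [he, hc' x] at this
        exact (add_left_cancel this).symm

/-- The determinant of a character, as a homomorphism (`1` for functions that are not
characters). -/
def charDet (χ : G → ℂ) : G →* ℂ :=
  if h : IsCharacter G χ then Representation.detHom h.choose.ρ else 1

variable [Finite G] [Finite H]

theorem charDet_character {V : Type} [AddCommGroup V] [Module ℂ V] [FiniteDimensional ℂ V]
    (ρ : Representation ℂ G V) : charDet ρ.character = ρ.detHom := by
  have h : IsCharacter G ρ.character := isCharacter_of_representation ρ
  ext g
  rw [charDet, dif_pos h]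
  have hs := h.choose_spec
  exact Representation.det_eq_of_character_eq _ _ _ _ _ rfl (funext hs).symm g

theorem hasPiDetOrder_iff {σ : Set ℕ} {θ : G → ℂ} :
    HasPiDetOrder σ G θ ↔ IsCharacter G θ ∧ IsPiNumber σ (orderOf (charDet θ)) := by
  have key : ∀ V : FDRep ℂ G, (∀ g, θ g = V.character g) →
      orderOf (charDet θ) = orderOf (fun g : G => LinearMap.det (V.ρ g)) := by
    intro V hV
    have : θ = Representation.character V.ρ := funext hV
    rw [this, charDet_character]
    exact (orderOf_injective (MonoidHom.coeFn G ℂ) DFunLike.coe_injective _).symm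
  constructor
  · rintro ⟨V, hV, ho⟩
    exact ⟨⟨V, hV⟩, by rwa [key V hV]⟩
  · rintro ⟨⟨V, hV⟩, ho⟩
    exact ⟨V, hV, by rwa [← key V hV]⟩

theorem charDet_add {χ ψ : G → ℂ} (h : IsCharacter G χ) (h' : IsCharacter G ψ) :
    charDet (χ + ψ) = charDet χ * charDet ψ := by
  obtain ⟨V, _, _, _, ρ, rfl⟩ := h.exists_representation
  obtain ⟨W, _, _, _, σ, rfl⟩ := h'.exists_representation
  have : ρ.character + σ.character = (ρ.prod σ).character := by
    ext g
    exact (LinearMap.trace_prodMap' _ _).symm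
  rw [this, charDet_character, charDet_character, charDet_character]
  ext g
  exact LinearMap.det_prodMap _ _

theorem charDet_comp {χ : G → ℂ} (h : IsCharacter G χ) (f : H →* G) :
    charDet (χ ∘ f) = (charDet χ).comp f := by
  obtain ⟨V, _, _, _, ρ, rfl⟩ := h.exists_representation
  have : ρ.character ∘ f = Representation.character (ρ.comp f) := rfl
  rw [this, charDet_character, charDet_character]
  rfl

theorem charDet_zero : charDet (0 : G → ℂ) = 1 := by
  have : (0 : G → ℂ) = (Representation.trivial ℂ G PUnit).character := by
    rw [eq_comm, Representation.character_eq_zero_iff]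
    infer_instance
  rw [this, charDet_character]
  ext g
  exact LinearMap.det_eq_one_of_subsingleton _

theorem charDet_nsmul {χ : G → ℂ} (h : IsCharacter G χ) (n : ℕ) :
    charDet (n • χ) = charDet χ ^ n := by
  induction n with
  | zero => rw [zero_nsmul, charDet_zero, pow_zero]
  | succ n ih => rw [succ_nsmul, charDet_add (h.nsmul n) h, ih, pow_succ]

theorem charDet_mul_linear {χ : G → ℂ} (h : IsCharacter G χ) (l : G →* ℂ) {n : ℕ}
    (hn : χ 1 = n) : charDet ((l : G → ℂ) * χ) = l ^ n * charDet χ := by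
  obtain ⟨V, _, _, _, ρ, rfl⟩ := h.exists_representation
  let σ : Representation ℂ G V :=
    { toFun := fun g => l g • ρ g
      map_one' := by simp
      map_mul' := fun a b => by rw [map_mul, map_mul, smul_mul_smul_comm] }
  have hσ : (l : G → ℂ) * ρ.character = σ.character := by
    ext g
    simp [Representation.character, σ]
  rw [ρ.char_one] at hn
  have hn' : Module.finrank ℂ V = n := by exact_mod_cast hn
  rw [hσ, charDet_character, charDet_character]
  ext g
  simp [σ, hn']

omit [Finite G] in
theorem MonoidHom.character_linear (l : G →* ℂ) :
    ∃ ρ : Representation ℂ G ℂ, (l : G → ℂ) = ρ.character ∧ ρ.detHom = l := by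
  let ρ : Representation ℂ G ℂ :=
    ((Module.toModuleEnd ℂ (S := ℂ) ℂ).toMonoidHom : ℂ →* Module.End ℂ ℂ).comp l
  have h : ∀ g, ρ g = l g • LinearMap.id := fun g => by ext; simp [ρ]
  exact ⟨ρ, by ext g; simp [Representation.character, h], by ext g; simp [h]⟩

theorem charDet_linear (l : G →* ℂ) : charDet l = l := by
  obtain ⟨ρ, h1, h2⟩ := l.character_linear
  rw [h1, charDet_character, h2]

omit [Finite G] in
theorem MonoidHom.mul_apply_inv (l : G →* ℂ) (g : G) : l g * l g⁻¹ = 1 := by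
  rw [← map_mul, mul_inv_cancel, map_one]

theorem isIrrChar_linear (l : G →* ℂ) : IsIrrChar G l := by
  apply (isCharacter_of_monoidHom l).isIrrChar_of_ip_self
  let _ := Fintype.ofFinite G
  rw [ip_eq]
  simp only [MonoidHom.mul_apply_inv, Finset.sum_const, Finset.card_univ,
    Fintype.card_eq_nat_card, nsmul_eq_mul, mul_one]
  exact inv_mul_cancel₀ card_ne_zero'

theorem isIrrChar_one : IsIrrChar G (1 : G → ℂ) := isIrrChar_linear (1 : G →* ℂ)

omit [Finite G] in
theorem IsCharacter.exists_linear {χ : G → ℂ} (h : IsCharacter G χ) (h1 : χ 1 = 1) :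
    ∃ l : G →* ℂ, χ = l := by
  obtain ⟨V, _, _, _, ρ, rfl⟩ := h.exists_representation
  rw [ρ.char_one] at h1
  have h1' : Module.finrank ℂ V = 1 := by exact_mod_cast h1
  refine ⟨ρ.detHom, ?_⟩
  ext g
  obtain ⟨v, hv, hspan⟩ := finrank_eq_one_iff'.1 h1'
  obtain ⟨c, hc⟩ := hspan (ρ g v)
  have : ρ g = c • LinearMap.id := by
    ext w
    obtain ⟨d, rfl⟩ := hspan w
    rw [map_smul, ← hc, smul_comm]
    rfl
  simp [Representation.character, this, h1']

theorem IsIrrChar.mul_linear {χ : G → ℂ} (h : IsIrrChar G χ) (l : G →* ℂ) :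
    IsIrrChar G ((l : G → ℂ) * χ) := by
  apply ((isCharacter_of_monoidHom l).mul h.1).isIrrChar_of_ip_self
  rw [ip_mul_left, ← mul_assoc]
  have : dualFn (l : G → ℂ) * l = 1 := by
    ext g
    rw [Pi.mul_apply, dualFn_apply, mul_comm, l.mul_apply_inv, Pi.one_apply]
  rw [this, one_mul, h.ip_self]

theorem IsIrrChar.dual {χ : G → ℂ} (h : IsIrrChar G χ) : IsIrrChar G (dualFn χ) := by
  apply h.1.dual.isIrrChar_of_ip_self
  rw [ip_dual_dual, h.ip_self]

theorem IsIrrChar.exists_linear_of_comm [IsMulCommutative G] {χ : G → ℂ} (h : IsIrrChar G χ) :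
    ∃ l : G →* ℂ, χ = l := by
  apply h.1.exists_linear
  obtain ⟨V, _, _, _, ρ, rfl⟩ := h.1.exists_representation
  have := h.isIrreducible
  rw [ρ.char_one, Representation.IsIrreducible.finrank_eq_one_of_isMulCommutative ρ]
  simp

end Determinants

section Integrality

variable {G : Type} [Group G] [Finite G]

theorem IsCharacter.comp_zpowers_sum (P : ℂ → Prop) {χ : G → ℂ} (h : IsCharacter G χ) (g : G)
    (zero : P 0) (add : ∀ a b, P a → P b → P (a + b))
    (root : ∀ z : ℂ, z ^ orderOf g = 1 → P z) : P (χ g) := by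
  let i := (Subgroup.zpowers g).subtype
  have hc : IsCharacter (Subgroup.zpowers g) (χ ∘ i) := h.comp i
  let x : Subgroup.zpowers g := ⟨g, Subgroup.mem_zpowers g⟩
  suffices P ((χ ∘ i) x) from this
  refine hc.induction_on (P := fun ψ => P (ψ x)) zero fun θ ψ hθ _ ih => add _ _ ?_ ih
  obtain ⟨l, rfl⟩ := hθ.exists_linear_of_comm
  apply root
  rw [← map_pow]
  have : x ^ orderOf g = 1 := Subtype.ext (pow_orderOf_eq_one g)
  rw [this, map_one]

theorem IsCharacter.isIntegral_apply {χ : G → ℂ} (h : IsCharacter G χ) (g : G) :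
    IsIntegral ℤ (χ g) := by
  refine h.comp_zpowers_sum (IsIntegral ℤ) g isIntegral_zero (fun _ _ => IsIntegral.add) ?_
  intro z hz
  exact IsIntegral.of_pow (orderOf_pos g) (hz ▸ isIntegral_one)

theorem IsIrrChar.convolution [Fintype G] {χ a : G → ℂ} (h : IsIrrChar G χ) (ha : IsClassFn a)
    (y : G) : ∑ x, a x * χ (x * y) = (∑ x, a x * χ x) / χ 1 * χ y := by
  have h1 : χ 1 ≠ 0 := fun h0 => h.2.1 (h.1.eq_zero_of_apply_one h0)
  obtain ⟨V, _, _, _, ρ, rfl⟩ := h.1.exists_representation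
  have := h.isIrreducible
  obtain ⟨c, hc⟩ := ρ.exists_sumOp_eq_smul ha
  have ht := ρ.trace_sumOp a
  rw [hc, map_smul, LinearMap.trace_id, ← ρ.char_one, smul_eq_mul] at ht
  rw [← ht, mul_div_cancel_right₀ _ h1]
  have : LinearMap.trace ℂ V (ρ.sumOp a * ρ y) = ∑ x, a x * ρ.character (x * y) := by
    simp only [Representation.sumOp, Representation.character, Finset.sum_mul, map_sum,
      smul_mul_assoc, map_smul, smul_eq_mul, map_mul]
  rw [← this, hc]
  rw [smul_mul_assoc, map_smul, smul_eq_mul]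
  rfl

theorem IsIrrChar.isIntegral_card_div {χ : G → ℂ} (h : IsIrrChar G χ) :
    IsIntegral ℤ ((Nat.card G : ℂ) / χ 1) := by
  let _ := Fintype.ofFinite G
  have h1 : χ 1 ≠ 0 := fun h0 => h.2.1 (h.1.eq_zero_of_apply_one h0)
  let R := integralClosure ℤ ℂ
  let N : Matrix G G R := Matrix.of fun a b => ⟨χ (b⁻¹ * a), h.1.isIntegral_apply _⟩
  let q := (Nat.card G : ℂ) / χ 1
  have key : ∀ y, ∑ x, χ (x⁻¹ * y) * χ x = q * χ y := by
    intro y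
    have hs := h.ip_self
    rw [ip_eq, inv_mul_eq_one₀ card_ne_zero'] at hs
    have h2 := h.convolution (h.dual.1.isClassFn) y
    simp only [dualFn_apply] at h2
    rw [← Equiv.sum_comp (Equiv.inv G)] at h2
    simp only [Equiv.inv_apply, inv_inv, mul_comm (χ _⁻¹)] at h2
    rw [← hs] at h2
    rw [← h2]
    exact Finset.sum_congr rfl fun _ _ => mul_comm _ _
  have hdet : (Matrix.scalar G q - N.map (algebraMap R ℂ)).det = 0 := by
    rw [← Matrix.exists_mulVec_eq_zero_iff]
    refine ⟨χ, h.2.1, ?_⟩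
    ext y
    rw [Matrix.sub_mulVec, Pi.sub_apply, Pi.zero_apply, sub_eq_zero]
    have e1 : (N.map (algebraMap R ℂ)).mulVec χ y = q * χ y := key y
    rw [e1, Matrix.scalar_apply, Matrix.mulVec_diagonal]
  have hint : IsIntegral R q := by
    refine ⟨N.charpoly, N.charpoly_monic, ?_⟩
    rw [← Polynomial.eval_map, ← Matrix.charpoly_map, Matrix.eval_charpoly]
    exact hdet
  exact isIntegral_trans q hint

theorem IsIrrChar.degree_dvd_card {χ : G → ℂ} (h : IsIrrChar G χ) {n : ℕ} (hn : χ 1 = n) :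
    n ∣ Nat.card G := by
  have h1 : χ 1 ≠ 0 := fun h0 => h.2.1 (h.1.eq_zero_of_apply_one h0)
  have h2 := h.isIntegral_card_div
  rw [hn] at h1 h2
  have h1' : n ≠ 0 := by exact_mod_cast h1
  have h3 : IsIntegral ℤ ((Nat.card G : ℚ) / n) := by
    have : ((Nat.card G : ℂ) / n) = algebraMap ℚ ℂ ((Nat.card G : ℚ) / n) := by simp
    rw [this] at h2
    exact (isIntegral_algebraMap_iff (algebraMap ℚ ℂ).injective).1 h2
  obtain ⟨k, hk⟩ := IsIntegrallyClosed.isIntegral_iff.1 h3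
  rw [eq_div_iff (by exact_mod_cast h1')] at hk
  rw [eq_intCast] at hk
  have : k * n = Nat.card G := by exact_mod_cast hk
  exact_mod_cast (Dvd.intro_left k this : (n : ℤ) ∣ Nat.card G)

end Integrality

section Restriction

variable {G H : Type} [Group G] [Group H] [Finite G] [Finite H]

omit [Finite G] [Finite H] in
theorem Representation.invariants_le_comp {V : Type} [AddCommGroup V] [Module ℂ V]
    (ρ : Representation ℂ G V) (f : H →* G) :
    ρ.invariants ≤ Representation.invariants (ρ.comp f) := by
  intro v hv h
  exact hv (f h)

theorem IsCharacter.ip_one_le {χ : G → ℂ} (h : IsCharacter G χ) (f : H →* G) :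
    ∃ m n : ℕ, ip χ 1 = m ∧ ip (χ ∘ f) 1 = n ∧ m ≤ n := by
  obtain ⟨V, _, _, _, ρ, rfl⟩ := h.exists_representation
  refine ⟨_, _, ρ.ip_character_one_eq_finrank,
    Representation.ip_character_one_eq_finrank (ρ.comp f),
    Submodule.finrank_mono (ρ.invariants_le_comp f)⟩

theorem IsCharacter.ip_one_eq_zero {χ : G → ℂ} (h : IsCharacter G χ) (f : H →* G)
    (h0 : ip (χ ∘ f) 1 = 0) : ip χ 1 = 0 := by
  obtain ⟨m, n, hm, hn, hle⟩ := h.ip_one_le f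
  rw [hn, Nat.cast_eq_zero] at h0
  rw [hm, Nat.cast_eq_zero]
  omega

theorem ip_eq_ip_one (χ ψ : G → ℂ) : ip χ ψ = ip (χ * dualFn ψ) 1 := by
  rw [mul_comm, ip_mul_left, dualFn_dualFn, mul_one]

theorem ip_one_eq_apply_one {χ : G → ℂ} (h : ∀ g, χ g = χ 1) : ip χ 1 = χ 1 := by
  let _ := Fintype.ofFinite G
  rw [ip_eq]
  have h0 := card_ne_zero' (G := G)
  simp [h]

omit [Finite G] in
theorem IsCharacter.apply_mul_of_ip_one {χ : G → ℂ} (h : IsCharacter G χ) (f : H →* G)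
    (he : ip (χ ∘ f) 1 = χ 1) (x : H) (g : G) : χ (f x * g) = χ g := by
  obtain ⟨V, _, _, _, ρ, rfl⟩ := h.exists_representation
  have h1 := Representation.ip_character_one_eq_finrank (ρ.comp f)
  change ip (ρ.character ∘ f) 1 = _ at h1
  rw [he, ρ.char_one] at h1
  have h2 : Representation.invariants (ρ.comp f) = ⊤ := by
    apply Submodule.eq_top_of_finrank_eq
    exact_mod_cast h1.symm
  have h3 : ρ (f x) = 1 := by
    ext v
    have : v ∈ Representation.invariants (ρ.comp f) := h2 ▸ Submodule.mem_top
    exact this x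
  simp [Representation.character, h3]

omit [Finite G] in
theorem IsCharacter.apply_mul_of_trivial {χ : G → ℂ} (h : IsCharacter G χ) (f : H →* G)
    (he : ∀ x, χ (f x) = χ 1) (x : H) (g : G) : χ (f x * g) = χ g := by
  apply h.apply_mul_of_ip_one
  have : ∀ y, (χ ∘ f) y = (χ ∘ f) 1 := fun y => by simp [he]
  rw [ip_one_eq_apply_one this]
  simp

theorem ip_comp_of_surjective {f : H →* G} (hf : Function.Surjective f) (a b : G → ℂ) :
    ip (a ∘ f) (b ∘ f) = ip a b := by
  let _ := Fintype.ofFinite G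
  let _ := Fintype.ofFinite H
  rw [ip_eq, ip_eq]
  have hcard : Nat.card H = Nat.card G * Nat.card f.ker := by
    rw [mul_comm, ← Subgroup.card_mul_index f.ker, Subgroup.index_ker,
      MonoidHom.range_eq_top.2 hf, Subgroup.card_top]
  have hfib : ∀ g : G, (Finset.univ.filter fun h : H => f h = g).card = Nat.card f.ker := by
    intro g
    obtain ⟨y, rfl⟩ := hf g
    rw [Nat.card_eq_fintype_card, ← Finset.card_univ]
    symm
    refine Finset.card_bij (fun k _ => y * k.1) ?_ ?_ ?_
    · intro k _
      simp [MonoidHom.mem_ker.1 k.2]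
    · intro k _ k' _ hk
      exact Subtype.ext (mul_left_cancel hk)
    · intro z hz
      refine ⟨⟨y⁻¹ * z, ?_⟩, Finset.mem_univ _, by simp⟩
      rw [MonoidHom.mem_ker, map_mul, map_inv, (Finset.mem_filter.1 hz).2, inv_mul_cancel]
  have hs : ∑ h : H, (a ∘ f) h * (b ∘ f) h⁻¹ = Nat.card f.ker * ∑ g : G, a g * b g⁻¹ := by
    have : ∀ h : H, (a ∘ f) h * (b ∘ f) h⁻¹ = (fun g => a g * b g⁻¹) (f h) := fun h => by simp
    simp_rw [this]
    rw [Finset.sum_comp (fun g => a g * b g⁻¹) f]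
    rw [Finset.mul_sum, ← Finset.sum_subset (Finset.subset_univ (Finset.image f Finset.univ))]
    · refine Finset.sum_congr rfl fun g _ => ?_
      rw [hfib, nsmul_eq_mul]
    · intro g _ hg
      obtain ⟨y, rfl⟩ := hf g
      exact absurd (Finset.mem_image_of_mem f (Finset.mem_univ y)) hg
  rw [hs, hcard]
  have h1 := card_ne_zero' (G := f.ker)
  have h2 := card_ne_zero' (G := G)
  push_cast
  field_simp

theorem IsCharacter.isIrrChar_of_comp {χ : G → ℂ} (h : IsCharacter G χ) (f : H →* G)
    (hi : IsIrrChar H (χ ∘ f)) : IsIrrChar G χ := by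
  apply h.isIrrChar_of_ip_self
  have h0 : χ ≠ 0 := by
    rintro rfl
    exact hi.2.1 rfl
  obtain ⟨m, n, hm, hn, hle⟩ := (h.mul h.dual).ip_one_le f
  have h1 : ip (χ ∘ f) (χ ∘ f) = n := by
    rw [ip_eq_ip_one, ← hn]
    congr 1
    ext x
    simp
  rw [hi.ip_self] at h1
  have h2 := h.ip_self_ne_zero h0
  rw [ip_eq_ip_one, hm] at h2 ⊢
  have h3 : n = 1 := by exact_mod_cast h1.symm
  have h4 : m ≠ 0 := by exact_mod_cast h2
  have : m = 1 := by omega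
  rw [this, Nat.cast_one]

theorem isIrrChar_comp_iff {f : H →* G} (hf : Function.Surjective f) {χ : G → ℂ}
    (h : IsCharacter G χ) : IsIrrChar H (χ ∘ f) ↔ IsIrrChar G χ := by
  refine ⟨h.isIrrChar_of_comp f, fun hi => (h.comp f).isIrrChar_of_ip_self ?_⟩
  rw [ip_comp_of_surjective hf, hi.ip_self]

omit [Finite G] in
theorem IsCharacter.exists_descent {f : H →* G} (hf : Function.Surjective f) {χ : H → ℂ}
    (h : IsCharacter H χ) (hk : ∀ k ∈ f.ker, χ k = χ 1) :
    ∃ χ' : G → ℂ, IsCharacter G χ' ∧ χ = χ' ∘ f := by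
  obtain ⟨V, _, _, _, ρ, rfl⟩ := h.exists_representation
  have h1 := Representation.ip_character_one_eq_finrank (ρ.comp f.ker.subtype)
  have h1' : ip (ρ.character ∘ f.ker.subtype) 1 = ρ.character 1 := by
    rw [ip_one_eq_apply_one]
    · simp
    · intro k
      simpa using hk k k.2
  change ip (ρ.character ∘ f.ker.subtype) 1 = _ at h1
  rw [h1', ρ.char_one] at h1
  have h2 : Representation.invariants (ρ.comp f.ker.subtype) = ⊤ := by
    apply Submodule.eq_top_of_finrank_eq
    exact_mod_cast h1.symm
  have h3 : f.ker ≤ MonoidHom.ker ρ := by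
    intro k hk
    rw [MonoidHom.mem_ker]
    ext v
    have : v ∈ Representation.invariants (ρ.comp f.ker.subtype) := h2 ▸ Submodule.mem_top
    exact this ⟨k, hk⟩
  let r : G → H := Function.surjInv hf
  have hr : ∀ g, f (r g) = g := Function.surjInv_eq hf
  have h4 : ∀ x y, f x = f y → ρ x = ρ y := by
    intro x y hxy
    have : ρ (x * y⁻¹) = 1 := h3 (by rw [MonoidHom.mem_ker, map_mul, map_inv, hxy, mul_inv_cancel])
    rw [← inv_mul_cancel_right x y, map_mul, this, one_mul]
  let σ : Representation ℂ G V :=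
    { toFun := fun g => ρ (r g)
      map_one' := by rw [h4 (r 1) 1 (by rw [hr, map_one]), map_one]
      map_mul' := fun a b => by rw [← map_mul]; exact h4 _ _ (by rw [map_mul, hr, hr, hr]) }
  have hσ : ∀ y, σ (f y) = ρ y := fun y => h4 _ _ (hr _)
  refine ⟨σ.character, isCharacter_of_representation σ, ?_⟩
  ext y
  simp [Representation.character, hσ]

end Restriction

section Constituents

variable {G H : Type} [Group G] [Group H] [Finite G] [Finite H]

theorem IsCharacter.ip_add_ne_zero {χ ξ θ : G → ℂ} (hχ : IsCharacter G χ) (hξ : IsCharacter G ξ)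
    (hθ : IsCharacter G θ) (h : ip χ θ ≠ 0) : ip (χ + ξ) θ ≠ 0 := by
  obtain ⟨m, hm⟩ := hχ.exists_ip hθ
  obtain ⟨n, hn⟩ := hξ.exists_ip hθ
  rw [ip_add_left, hm, hn]
  rw [hm] at h
  have : m ≠ 0 := by exact_mod_cast h
  exact_mod_cast (by omega : m + n ≠ 0)

theorem IsCharacter.ip_comp_ne_zero_trans {χ ζ : G → ℂ} (hχ : IsCharacter G χ)
    (hζ : IsIrrChar G ζ) (h : ip χ ζ ≠ 0) (f : H →* G) {θ : H → ℂ} (hθ : IsCharacter H θ)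
    (h' : ip (ζ ∘ f) θ ≠ 0) : ip (χ ∘ f) θ ≠ 0 := by
  obtain ⟨ξ, hξ, rfl⟩ := hχ.exists_eq_add hζ h
  exact (hζ.1.comp f).ip_add_ne_zero (hξ.comp f) hθ h'

theorem IsCharacter.exists_between {χ : G → ℂ} (hχ : IsCharacter G χ) (f : H →* G)
    {θ : H → ℂ} (h : ip (χ ∘ f) θ ≠ 0) :
    ∃ ζ, IsIrrChar G ζ ∧ ip χ ζ ≠ 0 ∧ ip (ζ ∘ f) θ ≠ 0 := by
  suffices H : ip (χ ∘ f) θ ≠ 0 → ∃ ζ, IsIrrChar G ζ ∧ ip χ ζ ≠ 0 ∧ ip (ζ ∘ f) θ ≠ 0 from H h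
  refine hχ.induction_on
    (P := fun χ => ip (χ ∘ f) θ ≠ 0 → ∃ ζ, IsIrrChar G ζ ∧ ip χ ζ ≠ 0 ∧ ip (ζ ∘ f) θ ≠ 0)
    ?_ ?_
  · intro h0
    exact absurd (ip_zero_left θ) h0
  · intro ζ ψ hζ hψ ih h0
    by_cases h1 : ip (ζ ∘ f) θ = 0
    · obtain ⟨ζ', h2, h3, h4⟩ := ih fun h2 => h0 (by
        rw [show (ζ + ψ) ∘ f = ζ ∘ f + ψ ∘ f from rfl, ip_add_left, h1, h2, add_zero])
      refine ⟨ζ', h2, ?_, h4⟩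
      rw [add_comm]
      exact hψ.ip_add_ne_zero hζ.1 h2.1 h3
    · exact ⟨ζ, hζ, hζ.1.ip_add_ne_zero hψ hζ.1 (by rw [hζ.ip_self]; exact one_ne_zero), h1⟩

omit [Finite G] in
theorem IsCharacter.exists_irr_comp {χ : G → ℂ} (hχ : IsCharacter G χ) (h0 : χ ≠ 0)
    (f : H →* G) : ∃ θ, IsIrrChar H θ ∧ ip (χ ∘ f) θ ≠ 0 := by
  refine (hχ.comp f).exists_irr_ip_ne_zero fun h => h0 (hχ.eq_zero_of_apply_one ?_)
  have := congrFun h 1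
  simpa using this

/-- A character all of whose irreducible constituents equal `θ` is a multiple of `θ`. -/
theorem IsCharacter.eq_smul_of_constituents {χ θ : G → ℂ} (hχ : IsCharacter G χ)
    (hθ : IsIrrChar G θ) (h : ∀ ζ, IsIrrChar G ζ → ip χ ζ ≠ 0 → ζ = θ) :
    χ = ip χ θ • θ := by
  refine hχ.isClassFn.ext_ip (hθ.1.isClassFn.smul _) fun ζ hζ => ?_
  rw [ip_smul_left, hθ.ip_eq_ite hζ]
  split_ifs with h1
  · rw [h1, mul_one]
  · rw [mul_zero]
    by_contra h2
    exact h1 (h ζ hζ h2).symm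

omit [Finite G] in
theorem IsIrrChar.apply_one_ne_zero {χ : G → ℂ} (h : IsIrrChar G χ) : χ 1 ≠ 0 :=
  fun h0 => h.2.1 (h.1.eq_zero_of_apply_one h0)

theorem IsIrrChar.comp_mulEquiv {χ : G → ℂ} (h : IsIrrChar G χ) (e : H ≃* G) :
    IsIrrChar H (χ ∘ e) :=
  (isIrrChar_comp_iff (f := e.toMonoidHom) e.surjective h.1).2 h

theorem ip_comp_mulEquiv (e : H ≃* G) (a b : G → ℂ) : ip (a ∘ e) (b ∘ e) = ip a b :=
  ip_comp_of_surjective (f := e.toMonoidHom) e.surjective a b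

/-- If `χ` restricts to `f.ker` as a multiple of an irreducible character that extends to `κ`,
then `χ` is the product of `κ` with a character inflated from the quotient. -/
theorem IsIrrChar.exists_eq_mul_inflated {f : G →* H} (hf : Function.Surjective f)
    {χ κ : G → ℂ} (hχ : IsIrrChar G χ) (hκ : IsCharacter G κ)
    (hi : IsIrrChar f.ker (κ ∘ f.ker.subtype)) {e : ℂ} (he : ∀ k ∈ f.ker, χ k = e * κ k) :
    ∃ ρ, IsIrrChar H ρ ∧ χ = κ * (ρ ∘ f) ∧ ρ 1 = e := by
  have hk1 : κ 1 ≠ 0 := by simpa using hi.apply_one_ne_zero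
  have he1 : χ 1 = e * κ 1 := he 1 (one_mem _)
  have he0 : e ≠ 0 := fun h => hχ.apply_one_ne_zero (by rw [he1, h, zero_mul])
  let ρ := push f (dualFn κ * χ)
  have hρ : IsCharacter H ρ := (hκ.dual.mul hχ.1).push f
  have hρ1 : ρ 1 = e := by
    have h1 : (dualFn κ * χ) ∘ f.ker.subtype =
        e • ((κ ∘ f.ker.subtype) * dualFn (κ ∘ f.ker.subtype)) := by
      ext k
      simp only [Function.comp_apply, Pi.mul_apply, dualFn_apply, Pi.smul_apply, smul_eq_mul,
        Subgroup.coe_subtype, he k k.2]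
      rw [Subgroup.coe_inv]
      ring
    have hcard : (Nat.card G : ℂ) = Nat.card H * Nat.card f.ker := by
      rw [mul_comm, ← Nat.cast_mul, ← Subgroup.card_mul_index f.ker, Subgroup.index_ker,
        MonoidHom.range_eq_top.2 hf, Subgroup.card_top]
    change push f _ 1 = e
    rw [push_one_apply, h1, ip_smul_left, ← ip_eq_ip_one, hi.ip_self, hcard]
    have h2 := card_ne_zero' (G := H)
    have h3 := card_ne_zero' (G := f.ker)
    field_simp
  have hρ0 : ρ ≠ 0 := fun h => he0 (by rw [← hρ1, h, Pi.zero_apply])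
  have hrec : ip χ (κ * (ρ ∘ f)) = ip ρ ρ := by
    rw [ip_mul_right, ← ip_push f _ hρ.isClassFn]
  have hprod : IsCharacter G (κ * (ρ ∘ f)) := hκ.mul (hρ.comp f)
  obtain ⟨ξ, hξ, heq⟩ := hprod.exists_eq_add hχ (by
    rw [ip_comm, hrec]
    exact hρ.ip_self_ne_zero hρ0)
  have hξ0 : ξ = 0 := by
    apply hξ.eq_zero_of_apply_one
    have := congrFun heq 1
    simp only [Pi.mul_apply, Function.comp_apply, map_one, hρ1, Pi.add_apply, he1] at this
    rw [mul_comm] at this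
    simpa using this
  rw [hξ0, add_zero] at heq
  refine ⟨ρ, hρ.isIrrChar_of_ip_self ?_, heq.symm, hρ1⟩
  rw [← hrec, heq, hχ.ip_self]

theorem IsIrrChar.exists_linear_of_ker {f : G →* H} (hf : Function.Surjective f)
    {χ κ : G → ℂ} (hχ : IsIrrChar G χ) (hκ : IsCharacter G κ)
    (hi : IsIrrChar f.ker (κ ∘ f.ker.subtype)) (he : ∀ k ∈ f.ker, χ k = κ k) :
    ∃ l : H →* ℂ, χ = (l.comp f : G →* ℂ) * κ := by
  obtain ⟨ρ, hρ, h1, h2⟩ := hχ.exists_eq_mul_inflated hf hκ hi (e := 1) (by simpa using he)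
  obtain ⟨l, rfl⟩ := hρ.1.exists_linear h2
  exact ⟨l, by rw [h1, mul_comm]; rfl⟩

end Constituents

section Clifford

variable {G : Type} [Group G] [Finite G] (N : Subgroup G) [hN : N.Normal]

/-- The conjugate of a function on a normal subgroup. -/
def conjFn (g : G) (θ : N → ℂ) : N → ℂ := θ ∘ MulAut.conjNormal g

variable {N}

omit [Finite G] in
theorem conjFn_apply (g : G) (θ : N → ℂ) (n : N) :
    conjFn N g θ n = θ ⟨g * n * g⁻¹, hN.conj_mem (n : G) n.2 g⟩ := by
  simp only [conjFn, Function.comp_apply]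
  congr 1

omit [Finite G] in
theorem conjFn_one (θ : N → ℂ) : conjFn N 1 θ = θ := by
  ext n
  simp [conjFn]

omit [Finite G] in
theorem conjFn_conjFn (g h : G) (θ : N → ℂ) : conjFn N g (conjFn N h θ) = conjFn N (h * g) θ := by
  ext n
  simp [conjFn]

theorem IsIrrChar.conj {θ : N → ℂ} (h : IsIrrChar N θ) (g : G) : IsIrrChar N (conjFn N g θ) :=
  h.comp_mulEquiv _

omit [Finite G] in
theorem IsClassFn.conjFn_comp {χ : G → ℂ} (h : IsClassFn χ) (g : G) :
    conjFn N g (χ ∘ N.subtype) = χ ∘ N.subtype := by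
  ext n
  rw [conjFn_apply]
  exact h g n

/-- Restriction to `N` of the character induced from an overgroup `T` of `N`. -/
theorem push_subtype_apply_of_normal [Fintype G] {T : Subgroup G} (hNT : N ≤ T) (ζ : T → ℂ)
    (n : N) : push T.subtype ζ n = (Nat.card T : ℂ)⁻¹ *
      ∑ x : G, ζ ⟨x * n * x⁻¹, hNT (hN.conj_mem (n : G) n.2 x)⟩ := by
  let _ := Fintype.ofFinite T
  rw [push_apply]
  congr 1
  refine Finset.sum_congr rfl fun x _ => ?_
  rw [Finset.sum_eq_single ⟨x * n * x⁻¹, hNT (hN.conj_mem (n : G) n.2 x)⟩]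
  · simp
  · intro b _ hb
    rw [if_neg]
    intro h
    exact hb (Subtype.ext h)
  · simp

theorem push_comp_subtype [Fintype G] (θ : N → ℂ) :
    push N.subtype θ ∘ N.subtype = (Nat.card N : ℂ)⁻¹ • ∑ x : G, conjFn N x θ := by
  ext n
  simp only [Function.comp_apply, Subgroup.coe_subtype, push_subtype_apply_of_normal le_rfl,
    Pi.smul_apply, Finset.sum_apply, conjFn_apply, smul_eq_mul]

theorem IsIrrChar.constituents_conj {χ : G → ℂ} (hχ : IsIrrChar G χ) {θ θ' : N → ℂ}
    (hθ : IsIrrChar N θ) (hθ' : IsIrrChar N θ') (h : ip (χ ∘ N.subtype) θ ≠ 0)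
    (h' : ip (χ ∘ N.subtype) θ' ≠ 0) : ∃ g, θ' = conjFn N g θ := by
  let _ := Fintype.ofFinite G
  by_contra! hc
  have h1 : ip (push N.subtype θ ∘ N.subtype) θ' = 0 := by
    rw [push_comp_subtype, ip_smul_left, ip_sum_left, Finset.sum_eq_zero, mul_zero]
    intro x _
    exact (hθ.conj x).ip_of_ne hθ' (hc x).symm
  refine (hθ.1.push N.subtype).ip_comp_ne_zero_trans hχ ?_ N.subtype hθ'.1 h' h1
  rw [ip_push _ _ hχ.1.isClassFn, ip_comm]
  exact h

theorem IsIrrChar.eq_smul_of_invariant {χ : G → ℂ} (hχ : IsIrrChar G χ) {θ : N → ℂ}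
    (hθ : IsIrrChar N θ) (h : ip (χ ∘ N.subtype) θ ≠ 0) (hinv : ∀ g, conjFn N g θ = θ) :
    χ ∘ N.subtype = ip (χ ∘ N.subtype) θ • θ := by
  refine (hχ.1.comp _).eq_smul_of_constituents hθ fun ζ hζ hne => ?_
  obtain ⟨g, rfl⟩ := hχ.constituents_conj hθ hζ h hne
  exact hinv g

variable (N) in
/-- The stabilizer of `θ` in `G`. -/
def stab (θ : N → ℂ) : Subgroup G where
  carrier := {g | conjFn N g θ = θ}
  one_mem' := conjFn_one θ
  mul_mem' {a b} ha hb := by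
    change conjFn N (a * b) θ = θ
    rw [← conjFn_conjFn, ha, hb]
  inv_mem' {a} ha := by
    change conjFn N a⁻¹ θ = θ
    conv_lhs => rw [← (show conjFn N a θ = θ from ha)]
    rw [conjFn_conjFn, mul_inv_cancel, conjFn_one]

omit [Finite G] in
theorem mem_stab {θ : N → ℂ} {g : G} : g ∈ stab N θ ↔ conjFn N g θ = θ := Iff.rfl

omit [Finite G] in
theorem IsClassFn.le_stab {θ : N → ℂ} (h : IsClassFn θ) : N ≤ stab N θ := by
  intro n hn
  rw [mem_stab]
  ext m
  rw [conjFn_apply]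
  exact h ⟨n, hn⟩ m

/-- The Clifford correspondence. -/
theorem IsIrrChar.exists_clifford {χ : G → ℂ} (hχ : IsIrrChar G χ) {θ : N → ℂ}
    (hθ : IsIrrChar N θ) (h : ip (χ ∘ N.subtype) θ ≠ 0) :
    ∃ ζ : stab N θ → ℂ, IsIrrChar (stab N θ) ζ ∧ χ = push (stab N θ).subtype ζ ∧
      ∃ a : ℕ, 0 < a ∧
        ∀ n : N, ζ ⟨n, hθ.1.isClassFn.le_stab n.2⟩ = a * θ n := by
  let _ := Fintype.ofFinite G
  let T := stab N θ
  have hNT : N ≤ T := hθ.1.isClassFn.le_stab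
  let i : N →* T := Subgroup.inclusion hNT
  have hi : T.subtype.comp i = N.subtype := rfl
  obtain ⟨ζ, hζ, h1, h2⟩ := (hχ.1.comp T.subtype).exists_between (f := i) (θ := θ) (by exact h)
  have hhom : ζ ∘ i = ip (ζ ∘ i) θ • θ := by
    let e : N.subgroupOf T ≃* N := Subgroup.subgroupOfEquivOfLe hNT
    have he : (N.subgroupOf T).subtype = i.comp e.toMonoidHom := rfl
    have h3 : ip (ζ ∘ (N.subgroupOf T).subtype) (θ ∘ e) = ip (ζ ∘ i) θ := by
      rw [← ip_comp_mulEquiv e]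
      rfl
    have h4 := hζ.eq_smul_of_invariant (hθ.comp_mulEquiv e) (by rw [h3]; exact h2) (by
      intro g
      ext n
      rw [conjFn_apply]
      have := congrFun (mem_stab.1 g.2) (e n)
      rw [conjFn_apply] at this
      exact this)
    rw [h3] at h4
    ext n
    have h5 := congrFun h4 (e.symm n)
    simp only [Pi.smul_apply, Function.comp_apply, e.apply_symm_apply] at h5
    exact h5
  obtain ⟨a, ha⟩ := (hζ.1.comp i).exists_ip hθ.1
  have ha0 : 0 < a := by
    rw [ha] at h2
    exact Nat.pos_of_ne_zero (by exact_mod_cast h2)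
  have hval : ∀ n : N, ζ ⟨n, hNT n.2⟩ = a * θ n := by
    intro n
    have := congrFun hhom n
    rw [ha] at this
    exact this
  refine ⟨ζ, hζ, ?_, a, ha0, hval⟩
  let X := push T.subtype ζ
  have hX : IsCharacter G X := hζ.1.push _
  have hXθ : ip (X ∘ N.subtype) θ = a := by
    have h3 : X ∘ N.subtype = ((Nat.card T : ℂ)⁻¹ * a) • ∑ x : G, conjFn N x θ := by
      ext n
      simp only [X, Function.comp_apply, Subgroup.coe_subtype, Pi.smul_apply, Finset.sum_apply,
        conjFn_apply, smul_eq_mul]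
      rw [push_subtype_apply_of_normal hNT, mul_assoc]
      congr 1
      rw [Finset.mul_sum]
      refine Finset.sum_congr rfl fun x _ => ?_
      exact hval ⟨x * n * x⁻¹, _⟩
    rw [h3, ip_smul_left, ip_sum_left]
    have h4 : ∀ x : G, ip (conjFn N x θ) θ = if x ∈ T then 1 else 0 := by
      intro x
      rw [(hθ.conj x).ip_eq_ite hθ]
      rfl
    simp only [h4, Finset.sum_boole]
    have h5 : (Finset.univ.filter fun x : G => x ∈ T).card = Nat.card T := by
      rw [Nat.card_eq_fintype_card, Fintype.card_subtype]
    rw [h5]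
    have := card_ne_zero' (G := T)
    field_simp
  have hge : ∀ χ' : G → ℂ, IsIrrChar G χ' → ip X χ' ≠ 0 →
      ∃ b : ℕ, ip (χ' ∘ N.subtype) θ = (a + b : ℕ) := by
    intro χ' hχ' hne
    rw [ip_push _ _ hχ'.1.isClassFn, ip_comm] at hne
    obtain ⟨ξ, hξ, h6⟩ := (hχ'.1.comp T.subtype).exists_eq_add hζ hne
    obtain ⟨b, hb⟩ := (hξ.comp i).exists_ip hθ.1
    refine ⟨b, ?_⟩
    have h7 : χ' ∘ N.subtype = ζ ∘ i + ξ ∘ i := by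
      have : χ' ∘ N.subtype = (χ' ∘ T.subtype) ∘ i := rfl
      rw [this, h6]
      rfl
    rw [h7, ip_add_left, ha, hb, Nat.cast_add]
  have hXχ : ip X χ ≠ 0 := by
    rw [ip_push _ _ hχ.1.isClassFn, ip_comm]
    exact h1
  obtain ⟨R, hR, hXR⟩ := hX.exists_eq_add hχ hXχ
  suffices R = 0 by
    change χ = X
    rw [hXR, this, add_zero]
  by_contra hR0
  obtain ⟨χ', hχ', h8⟩ := hR.exists_irr_ip_ne_zero hR0
  obtain ⟨b, hb⟩ := hge χ hχ hXχ
  obtain ⟨c, hc⟩ := hge χ' hχ' (by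
    rw [hXR, add_comm]
    exact hR.ip_add_ne_zero hχ.1 hχ'.1 h8)
  obtain ⟨R', hR', h9⟩ := hR.exists_eq_add hχ' h8
  obtain ⟨d, hd⟩ := (hR'.comp N.subtype).exists_ip hθ.1
  have : X ∘ N.subtype = χ ∘ N.subtype + (χ' ∘ N.subtype + R' ∘ N.subtype) := by
    rw [hXR, h9]
    rfl
  rw [this, ip_add_left, ip_add_left, hb, hc, hd] at hXθ
  have : a + b + (a + c + d) = a := by exact_mod_cast hXθ
  omega

theorem IsIrrChar.exists_degree_eq {χ : G → ℂ} (hχ : IsIrrChar G χ) {θ : N → ℂ}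
    (hθ : IsIrrChar N θ) (h : ip (χ ∘ N.subtype) θ ≠ 0) :
    ∃ a : ℕ, 0 < a ∧ χ 1 = (stab N θ).index * a * θ 1 := by
  obtain ⟨ζ, hζ, h1, a, ha, h2⟩ := hχ.exists_clifford hθ h
  refine ⟨a, ha, ?_⟩
  have h3 : ζ 1 = a * θ 1 := h2 1
  rw [h1, push_one_of_injective (stab N θ).subtype_injective, h3, mul_assoc]
  congr 1
  rw [← (stab N θ).index_mul_card, Nat.cast_mul, mul_div_cancel_right₀ _ card_ne_zero']

theorem IsIrrChar.degree_dvd {χ : G → ℂ} (hχ : IsIrrChar G χ) {θ : N → ℂ}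
    (hθ : IsIrrChar N θ) (h : ip (χ ∘ N.subtype) θ ≠ 0) {m n : ℕ} (hm : θ 1 = m)
    (hn : χ 1 = n) : m ∣ n := by
  obtain ⟨a, ha, h1⟩ := hχ.exists_degree_eq hθ h
  rw [hm, hn] at h1
  exact ⟨(stab N θ).index * a, by rw [mul_comm]; exact_mod_cast h1⟩

end Clifford

section PiNumbers

theorem isPiNumber_one (σ : Set ℕ) : IsPiNumber σ 1 :=
  fun _ hq h => absurd (Nat.dvd_one.1 h) hq.one_lt.ne'

theorem IsPiNumber.dvd {σ : Set ℕ} {m n : ℕ} (h : IsPiNumber σ n) (hmn : m ∣ n) :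
    IsPiNumber σ m := fun q hq hm => h q hq (hm.trans hmn)

theorem IsPiNumber.mul {σ : Set ℕ} {m n : ℕ} (hm : IsPiNumber σ m) (hn : IsPiNumber σ n) :
    IsPiNumber σ (m * n) := fun q hq h => (hq.dvd_mul.1 h).elim (hm q hq) (hn q hq)

theorem IsPiNumber.coprime {σ : Set ℕ} {m n : ℕ} (hm : IsPiNumber σ m) (hn : IsPiNumber σᶜ n) :
    m.Coprime n := by
  by_contra h
  obtain ⟨q, hq, h1⟩ := Nat.exists_prime_and_dvd h
  exact hn q hq (h1.trans (Nat.gcd_dvd_right _ _)) (hm q hq (h1.trans (Nat.gcd_dvd_left _ _)))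

theorem IsPiNumber.coprime' {σ : Set ℕ} {m n : ℕ} (hm : IsPiNumber σᶜ m) (hn : IsPiNumber σ n) :
    m.Coprime n := (hn.coprime hm).symm

theorem IsPiNumber.eq_one {σ : Set ℕ} {m : ℕ} (hm : IsPiNumber σ m) (hm' : IsPiNumber σᶜ m) :
    m = 1 := by
  have := hm.coprime hm'
  rwa [Nat.coprime_self] at this

theorem exists_pi_factorization (σ : Set ℕ) {n : ℕ} (hn : n ≠ 0) :
    ∃ a b, n = a * b ∧ IsPiNumber σ a ∧ IsPiNumber σᶜ b := by
  induction n using Nat.recOnMul with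
  | zero => exact absurd rfl hn
  | one => exact ⟨1, 1, rfl, isPiNumber_one _, isPiNumber_one _⟩
  | prime p hp =>
    by_cases h : p ∈ σ
    · refine ⟨p, 1, (mul_one p).symm, fun q hq hqp => ?_, isPiNumber_one _⟩
      rwa [(Nat.prime_dvd_prime_iff_eq hq hp).1 hqp]
    · refine ⟨1, p, (one_mul p).symm, isPiNumber_one _, fun q hq hqp => ?_⟩
      rwa [(Nat.prime_dvd_prime_iff_eq hq hp).1 hqp]
  | mul x y hx hy =>
    obtain ⟨a, b, rfl, ha, hb⟩ := hx (left_ne_zero_of_mul hn)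
    obtain ⟨c, d, rfl, hc, hd⟩ := hy (right_ne_zero_of_mul hn)
    exact ⟨a * c, b * d, by ring, ha.mul hc, hb.mul hd⟩

end PiNumbers

section LinearCharacters

variable {G : Type} [Group G]

theorem MonoidHom.pow_card_eq_one [Finite G] (l : G →* ℂ) : l ^ Nat.card G = 1 := by
  ext g
  rw [MonoidHom.pow_apply, ← map_pow, pow_card_eq_one', map_one, MonoidHom.one_apply]

theorem eq_one_of_pow_coprime {M : Type} [CommMonoid M] {l : M} {m n : ℕ} (h : m.Coprime n)
    (hm : l ^ m = 1) (hn : l ^ n = 1) : l = 1 := by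
  rw [← orderOf_eq_one_iff]
  exact Nat.eq_one_of_dvd_coprimes h (orderOf_dvd_of_pow_eq_one hm) (orderOf_dvd_of_pow_eq_one hn)

/-- Two characters with the same irreducible restriction to the kernel of `f` and with
determinantal orders coprime to the order of the quotient coincide. -/
theorem IsIrrChar.eq_of_restrict_ker {Q : Type} [Group Q] [Finite G] [Finite Q] {f : G →* Q}
    (hf : Function.Surjective f) {σ : Set ℕ} {χ κ : G → ℂ} (hχ : IsIrrChar G χ)
    (hκ : IsIrrChar G κ) (hi : IsIrrChar f.ker (κ ∘ f.ker.subtype)) (he : ∀ k ∈ f.ker, χ k = κ k)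
    (hQ : IsPiNumber σᶜ (Nat.card Q)) {d : ℕ} (hd : χ 1 = d) (hdσ : IsPiNumber σ d)
    (h1 : IsPiNumber σ (orderOf (charDet χ))) (h2 : IsPiNumber σ (orderOf (charDet κ))) :
    χ = κ := by
  obtain ⟨l, hl⟩ := hχ.exists_linear_of_ker hf hκ.1 hi he
  have hd' : κ 1 = d := by rw [← hd, he 1 (one_mem _)]
  have h3 : charDet χ = (l.comp f) ^ d * charDet κ := by
    rw [hl, charDet_mul_linear hκ.1 _ hd']
  have hlQ : (l.comp f) ^ Nat.card Q = 1 := by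
    ext g
    have := DFunLike.congr_fun l.pow_card_eq_one (f g)
    simpa using this
  have h4 : l.comp f = 1 := by
    refine eq_one_of_pow_coprime
      (IsPiNumber.coprime (hdσ.mul (h1.mul h2)) hQ) ?_ hlQ
    have h5 := congrArg (· ^ (orderOf (charDet χ) * orderOf (charDet κ))) h3
    simp only [mul_pow] at h5
    rw [pow_mul, pow_orderOf_eq_one, one_pow, mul_comm (orderOf (charDet χ)),
      pow_mul (charDet κ), pow_orderOf_eq_one, one_pow, mul_one, ← pow_mul] at h5
    rw [mul_comm (orderOf (charDet χ))]
    exact h5.symm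
  rw [hl, h4]
  exact one_mul κ

end LinearCharacters

section Linearization

variable {G : Type} [Group G] [Finite G]

omit [Finite G] in
theorem Representation.exists_eq_smul_of_commute {V : Type} [AddCommGroup V] [Module ℂ V]
    [FiniteDimensional ℂ V] (ρ : Representation ℂ G V) [ρ.IsIrreducible] (X : Module.End ℂ V)
    (h : ∀ g, X * ρ g = ρ g * X) : ∃ c : ℂ, X = c • 1 := by
  let T : Representation.IntertwiningMap ρ ρ := ⟨X, h⟩
  obtain ⟨c, hc⟩ :=
    (Representation.IsIrreducible.algebraMap_intertwiningMap_bijective_of_isAlgClosed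
      (ρ := ρ)).2 T
  refine ⟨c, ?_⟩
  ext v
  have := congr($hc v)
  simpa [T] using this.symm

theorem Representation.exists_unit_intertwining {V : Type} [AddCommGroup V] [Module ℂ V]
    [FiniteDimensional ℂ V] (ρ σ : Representation ℂ G V) (hρ : IsIrrChar G ρ.character)
    (h : ρ.character = σ.character) :
    ∃ X : (Module.End ℂ V)ˣ, ∀ g, (X : Module.End ℂ V) * ρ g = σ g * X := by
  have := hρ.isIrreducible
  have := (h ▸ hρ : IsIrrChar G σ.character).isIrreducible
  let := Fintype.ofFinite G
  let : Invertible (Nat.card G : ℂ) := invertibleOfNonzero card_ne_zero'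
  have key := Representation.char_orthonormal σ ρ
  rw [← ip_eq, ← h, hρ.ip_self] at key
  have hn : Nonempty (ρ.Equiv σ) := by
    by_contra hc
    rw [if_neg hc] at key
    exact one_ne_zero key
  obtain ⟨e⟩ := hn
  let E : V ≃ₗ[ℂ] V := e.toLinearEquiv
  refine ⟨⟨E.toLinearMap, E.symm.toLinearMap, ?_, ?_⟩, ?_⟩
  · ext v; simp
  · ext v; simp
  · intro g
    ext v
    exact LinearMap.congr_fun (e.toIntertwiningMap.isIntertwining' g) v

/-- The group of pairs `(g, X)` where `X` intertwines `ρ` with its conjugate by `g` and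
`det X` has order dividing `k`. -/
def linearizer (N : Subgroup G) [N.Normal] {V : Type} [AddCommGroup V] [Module ℂ V]
    (ρ : Representation ℂ N V) (k : ℕ) : Subgroup (G × (Module.End ℂ V)ˣ) where
  carrier := {y | (∀ n : N, (y.2 : Module.End ℂ V) * ρ n = ρ (MulAut.conjNormal y.1 n) * y.2) ∧
    LinearMap.det (y.2 : Module.End ℂ V) ^ k = 1}
  one_mem' := by simp
  mul_mem' {a b} ha hb := by
    refine ⟨fun n => ?_, ?_⟩
    · simp only [Prod.fst_mul, Prod.snd_mul, Units.val_mul, map_mul, MulAut.mul_apply]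
      rw [mul_assoc, hb.1, ← mul_assoc, ha.1, mul_assoc]
    · simp only [Prod.snd_mul, Units.val_mul, map_mul, mul_pow]
      rw [ha.2, hb.2, one_mul]
  inv_mem' {a} ha := by
    refine ⟨fun n => ?_, ?_⟩
    · simp only [Prod.fst_inv, Prod.snd_inv]
      rw [Units.inv_mul_eq_iff_eq_mul, ← mul_assoc, ha.1, mul_assoc, Units.mul_inv, mul_one]
      simp
    · have h1 : LinearMap.det ((a⁻¹).2 : Module.End ℂ V) ^ k *
          LinearMap.det (a.2 : Module.End ℂ V) ^ k = 1 := by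
        rw [← mul_pow, ← map_mul]
        simp
      rwa [ha.2, mul_one] at h1

/-- An invariant irreducible character `θ` of a normal subgroup `N` extends to a finite central
extension of `G`. -/
theorem exists_linearization (N : Subgroup G) [N.Normal] {θ : N → ℂ} (hθ : IsIrrChar N θ)
    (hinv : ∀ g : G, conjFn N g θ = θ) :
    ∃ (Γ : Type) (_ : Group Γ) (_ : Finite Γ) (p : Γ →* G) (i : N →* Γ)
      (s : Subgroup.centralizer (N : Set G) →* Γ) (κ : Γ → ℂ),
      Function.Surjective p ∧ i.range.Normal ∧ p.comp i = N.subtype ∧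
      p.comp s = (Subgroup.centralizer (N : Set G)).subtype ∧
      IsCharacter Γ κ ∧ κ ∘ i = θ ∧
      (∀ c x, κ (s c * x) = κ x) ∧
      (∀ z ∈ p.ker, ∀ x, z * x = x * z) ∧
      (∀ z ∈ p.ker, z ^ (Nat.card N * Nat.card N) = 1) ∧
      (∀ (y : Γ) (c c' : Subgroup.centralizer (N : Set G)), p y * (c : G) * (p y)⁻¹ = c' → y * s c * y⁻¹ = s c') := by
  obtain ⟨d, hd, hd0⟩ := hθ.exists_degree_pos
  have hdvd := hθ.degree_dvd_card hd
  obtain ⟨V, _, _, _, ρ, rfl⟩ := hθ.1.exists_representation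
  have hirr := hθ.isIrreducible
  rw [ρ.char_one] at hd
  have hd' : Module.finrank ℂ V = d := by exact_mod_cast hd
  let k := Nat.card N
  have hk : 0 < k := Nat.card_pos
  let Γ := linearizer N ρ k
  let p : Γ →* G := (MonoidHom.fst G (Module.End ℂ V)ˣ).comp Γ.subtype
  have hscal : ∀ z ∈ p.ker, ∃ c : ℂ, ((z : G × (Module.End ℂ V)ˣ).2 : Module.End ℂ V) = c • 1 ∧
      c ^ (d * k) = 1 := by
    intro z hz
    have hz1 : (z : G × (Module.End ℂ V)ˣ).1 = 1 := hz
    obtain ⟨c, hc⟩ := ρ.exists_eq_smul_of_commute (z : G × (Module.End ℂ V)ˣ).2 (by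
      intro g
      have := z.2.1 g
      rw [hz1] at this
      simpa using this)
    refine ⟨c, hc, ?_⟩
    have := z.2.2
    rw [hc, LinearMap.det_smul, map_one, mul_one, hd'] at this
    rw [pow_mul]
    exact this
  have hfin : Finite Γ := by
    have hker : Finite p.ker := by
      have h0 : (d * k) ≠ 0 := (Nat.mul_pos hd0 hk).ne'
      have : Finite {c : ℂ // c ^ (d * k) = 1} := by
        have := (Polynomial.nthRoots (d * k) (1 : ℂ)).toFinset.finite_toSet
        refine Set.Finite.subset this fun c hc => ?_
        simp only [Finset.mem_coe, Multiset.mem_toFinset,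
          Polynomial.mem_nthRoots (Nat.pos_of_ne_zero h0)]
        exact hc
      choose c hc hc' using hscal
      refine Finite.of_injective
        (fun z : p.ker => (⟨c z.1 z.2, hc' z.1 z.2⟩ : {c : ℂ // c ^ (d * k) = 1})) ?_
      intro z w hzw
      have h1 : c z.1 z.2 = c w.1 w.2 := congrArg Subtype.val hzw
      apply Subtype.ext
      apply Subtype.ext
      refine Prod.ext ?_ (Units.ext ?_)
      · exact (z.2 : _ = _).trans (w.2 : _ = _).symm
      · rw [hc z.1 z.2, hc w.1 w.2, h1]
    have h2 : Set.Finite (Set.univ : Set Γ) := by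
      refine Set.Finite.of_finite_fibers p (Set.toFinite _) fun g _ => ?_
      by_cases hg : ∃ y, p y = g
      · obtain ⟨y, rfl⟩ := hg
        refine ((Set.toFinite (p.ker : Set Γ)).image (y * ·)).subset fun x hx => ?_
        exact ⟨y⁻¹ * x, by
          simp only [SetLike.mem_coe, MonoidHom.mem_ker, map_mul, map_inv]
          rw [hx.2, inv_mul_cancel], by simp⟩
      · refine Set.finite_empty.subset fun x hx => hg ⟨x, hx.2⟩
    exact Set.finite_univ_iff.1 h2
  let u : N →* (Module.End ℂ V)ˣ := MonoidHom.toHomUnits ρ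
  have hu : ∀ n, (u n : Module.End ℂ V) = ρ n := fun n => rfl
  let i : N →* Γ :=
    { toFun := fun n => ⟨((n : G), u n), by
        refine ⟨fun m => ?_, ?_⟩
        · change ρ n * ρ m = ρ _ * ρ n
          rw [← map_mul, ← map_mul]
          congr 1
          exact Subtype.ext (by simp)
        · change LinearMap.det (ρ n) ^ k = 1
          rw [← map_pow, ← map_pow, pow_card_eq_one', map_one, map_one]⟩
      map_one' := Subtype.ext (Prod.ext rfl (map_one u))
      map_mul' := fun a b => Subtype.ext (Prod.ext rfl (map_mul u a b)) }
  have hcent : ∀ c : Subgroup.centralizer (N : Set G), ∀ n : N,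
      MulAut.conjNormal (c : G) n = n := by
    intro c n
    apply Subtype.ext
    rw [MulAut.conjNormal_apply, mul_inv_eq_iff_eq_mul]
    exact (Subgroup.mem_centralizer_iff.1 c.2 n n.2).symm
  let s : Subgroup.centralizer (N : Set G) →* Γ :=
    { toFun := fun c => ⟨((c : G), 1), fun n => by simp [hcent], by simp⟩
      map_one' := rfl
      map_mul' := fun a b => Subtype.ext (Prod.ext rfl (one_mul 1).symm) }
  let R : Representation ℂ Γ V :=
    (Units.coeHom _).comp ((MonoidHom.snd G (Module.End ℂ V)ˣ).comp Γ.subtype)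
  have hsurj : Function.Surjective p := by
    intro g
    let e : N ≃* N := MulAut.conjNormal g
    obtain ⟨X, hX⟩ := ρ.exists_unit_intertwining (ρ.comp e.toMonoidHom) hθ (hinv g).symm
    have hX0 : LinearMap.det (X : Module.End ℂ V) ≠ 0 :=
      (X.isUnit.map LinearMap.det).ne_zero
    obtain ⟨c, hc⟩ := IsAlgClosed.exists_pow_nat_eq ((LinearMap.det (X : Module.End ℂ V))⁻¹) hd0
    have hc0 : c ≠ 0 := by
      rintro rfl
      rw [zero_pow hd0.ne'] at hc
      exact inv_ne_zero hX0 hc.symm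
    refine ⟨⟨(g, Units.mk0 c hc0 • X), fun n => ?_, ?_⟩, rfl⟩
    · change (c • (X : Module.End ℂ V)) * ρ n = ρ _ * (c • (X : Module.End ℂ V))
      rw [smul_mul_assoc, hX n, mul_smul_comm]
      rfl
    · change LinearMap.det (c • (X : Module.End ℂ V)) ^ k = 1
      rw [LinearMap.det_smul, hd', hc, inv_mul_cancel₀ hX0, one_pow]
  refine ⟨Γ, inferInstance, hfin, p, i, s, R.character, hsurj, ?_, rfl, rfl,
    isCharacter_of_representation R, rfl, ?_, ?_, ?_, ?_⟩
  · refine ⟨?_⟩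
    rintro _ ⟨n, rfl⟩ y
    refine ⟨MulAut.conjNormal (p y) n, Subtype.ext (Prod.ext ?_ (Units.ext ?_))⟩
    · simp [i, p]
    · change ρ _ = (y.1.2 : Module.End ℂ V) * ρ n * _
      rw [y.2.1 n, mul_assoc]
      change _ = ρ _ * ((y.1.2 : Module.End ℂ V) * ((y.1.2⁻¹ : (Module.End ℂ V)ˣ) : Module.End ℂ V))
      rw [Units.mul_inv, mul_one]
      rfl
  · intro c x
    simp only [Representation.character, map_mul]
    have : R (s c) = 1 := rfl
    rw [this, one_mul]
  · intro z hz x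
    obtain ⟨c, hc, -⟩ := hscal z hz
    refine Subtype.ext (Prod.ext ?_ (Units.ext ?_))
    · have hz1 : (z : G × (Module.End ℂ V)ˣ).1 = 1 := hz
      simp [hz1]
    · simp [hc]
  · intro z hz
    obtain ⟨c, hc, hc'⟩ := hscal z hz
    refine Subtype.ext (Prod.ext ?_ (Units.ext ?_))
    · have hz1 : (z : G × (Module.End ℂ V)ˣ).1 = 1 := hz
      simp [hz1]
    · obtain ⟨e, he⟩ := hdvd
      have : c ^ (Nat.card N * Nat.card N) = 1 := by
        conv_lhs => rw [mul_comm]; arg 2; arg 2; rw [he]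
        rw [show Nat.card N * (d * e) = d * k * e by ring, pow_mul, hc', one_pow]
      simp [hc, smul_pow, this]
  · intro y c c' h
    refine Subtype.ext (Prod.ext h (Units.ext ?_))
    simp [s]

end Linearization

section CoprimeRestriction

variable {G : Type} [Group G] [Finite G]

theorem IsIrrChar.exists_central_linear {χ : G → ℂ} (hχ : IsIrrChar G χ) {A : Subgroup G}
    (hA : A ≤ Subgroup.center G) :
    ∃ l : A →* ℂ, ∀ z : A, ∀ g : G, χ (z * g) = l z * χ g := by
  obtain ⟨V, _, _, _, ρ, rfl⟩ := hχ.1.exists_representation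
  have := hχ.isIrreducible
  have hs : ∀ z : A, ∃ c : ℂ, ρ z = c • 1 := fun z => ρ.exists_eq_smul_of_commute _ fun g => by
    rw [← map_mul, ← map_mul, Subgroup.mem_center_iff.1 (hA z.2) g]
  choose c hc using hs
  have hnt : ρ.character 1 ≠ 0 := hχ.apply_one_ne_zero
  have hval : ∀ z : A, ∀ g, ρ.character (z * g) = c z * ρ.character g := by
    intro z g
    simp only [Representation.character, map_mul, hc]
    simp
  have hone : c 1 = 1 := by
    have := hval 1 1
    rw [Subgroup.coe_one, one_mul] at this
    exact (mul_eq_right₀ hnt).1 this.symm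
  refine ⟨⟨⟨c, hone⟩, fun a b => ?_⟩, hval⟩
  have h1 := hval (a * b) 1
  rw [mul_one, Subgroup.coe_mul, hval, ← mul_one (b : G), hval, ← mul_assoc] at h1
  exact (mul_right_cancel₀ hnt h1).symm

theorem IsIrrChar.degree_eq_one_of_coprime_center {χ : G → ℂ} (hχ : IsIrrChar G χ) {e : ℕ}
    (he : χ 1 = e) (hcop : e.Coprime (Subgroup.center G).index) : e = 1 := by
  let Z := Subgroup.center G
  obtain ⟨l, hl⟩ := hχ.exists_central_linear (le_refl Z)
  let n := Z.index
  let L : Z →* ℂˣ := l.toHomUnits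
  let D : G →* ℂˣ := (charDet χ).toHomUnits
  have hres : χ ∘ Z.subtype = e • (l : Z → ℂ) := by
    ext z
    have := hl z 1
    rw [mul_one, he] at this
    simp only [Function.comp_apply, Subgroup.coe_subtype, this, Pi.smul_apply, nsmul_eq_mul]
    ring
  have hD : ∀ z : Z, D z = L z ^ e := by
    intro z
    apply Units.ext
    have h1 := charDet_comp hχ.1 Z.subtype
    rw [hres, charDet_nsmul (isCharacter_of_monoidHom l), charDet_linear] at h1
    exact (DFunLike.congr_fun h1 z).symm
  let tr : G →* ℂˣ := L.comp (MonoidHom.transferCenterPow G)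
  have htr : ∀ z : Z, tr z = L z ^ n := by
    intro z
    change L _ = _
    rw [← map_pow]
    congr 1
  obtain ⟨u, v, huv⟩ := Nat.isCoprime_iff_coprime.2 hcop
  let τ : G →* ℂˣ := D ^ (-u) * tr ^ (-v)
  have hτ : ∀ z : Z, τ z * L z = 1 := by
    intro z
    have : τ z = D z ^ (-u) * tr z ^ (-v) := rfl
    rw [this, hD, htr, ← zpow_natCast, ← zpow_natCast, ← zpow_mul, ← zpow_mul, ← zpow_add,
      ← zpow_add_one, show (e : ℤ) * -u + n * -v + 1 = 0 by linarith [huv], zpow_zero]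
  let t : G →* ℂ := (Units.coeHom ℂ).comp τ
  have hρ := hχ.mul_linear t
  obtain ⟨χ', hχ', h2⟩ := hρ.1.exists_descent (f := QuotientGroup.mk' Z)
    (QuotientGroup.mk'_surjective Z) (by
      intro z hz
      rw [QuotientGroup.ker_mk'] at hz
      have h3 := hl ⟨z, hz⟩ 1
      rw [mul_one] at h3
      have h4 : t z * l ⟨z, hz⟩ = 1 := congrArg Units.val (hτ ⟨z, hz⟩)
      change t z * χ z = t 1 * χ 1
      change χ z = _ at h3
      rw [h3, ← mul_assoc, h4, map_one])
  have hirr : IsIrrChar (G ⧸ Z) χ' := by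
    rw [← isIrrChar_comp_iff (QuotientGroup.mk'_surjective Z) hχ', ← h2]
    exact hρ
  have h5 : χ' 1 = e := by
    have := congrFun h2 1
    simp only [Pi.mul_apply, map_one, one_mul, Function.comp_apply, he] at this
    exact this.symm
  have h6 := hirr.degree_dvd_card h5
  exact Nat.eq_one_of_dvd_coprimes hcop dvd_rfl h6

/-- An irreducible character of degree coprime to the index of a normal subgroup restricts
irreducibly to it. -/
theorem IsIrrChar.restrict_of_coprime {M : Subgroup G} [M.Normal] {χ : G → ℂ}
    (hχ : IsIrrChar G χ) {d : ℕ} (hd : χ 1 = d) (hcop : d.Coprime M.index) :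
    IsIrrChar M (χ ∘ M.subtype) := by
  obtain ⟨θ, hθ, hne⟩ := hχ.1.exists_irr_comp hχ.2.1 M.subtype
  obtain ⟨a, ha, hdeg⟩ := hχ.exists_degree_eq hθ hne
  obtain ⟨t, ht, ht0⟩ := hθ.exists_degree_pos
  have hdeg' : d = (stab M θ).index * a * t := by
    rw [hd, ht] at hdeg
    exact_mod_cast hdeg
  have hstab : stab M θ = ⊤ := by
    rw [← Subgroup.index_eq_one]
    exact Nat.eq_one_of_dvd_coprimes hcop ⟨a * t, by rw [hdeg', mul_assoc]⟩
      (Subgroup.index_dvd_of_le hθ.1.isClassFn.le_stab)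
  have hinv : ∀ g, conjFn M g θ = θ := fun g => mem_stab.1 (hstab ▸ Subgroup.mem_top g)
  have hres := hχ.eq_smul_of_invariant hθ hne hinv
  obtain ⟨Γ, _, _, p, i, s, κ, hp, hi, hpi, -, hκ, hκi, -, hZ, -, -⟩ :=
    exists_linearization M hθ hinv
  let f := QuotientGroup.mk' i.range
  have hf : Function.Surjective f := QuotientGroup.mk'_surjective _
  have hker : f.ker = i.range := QuotientGroup.ker_mk' _
  have hχp : IsIrrChar Γ (χ ∘ p) := (isIrrChar_comp_iff hp hχ.1).2 hχ
  have hκk : IsIrrChar f.ker (κ ∘ f.ker.subtype) := by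
    have hmem : ∀ m, i m ∈ f.ker := by
      intro m
      rw [hker]
      exact ⟨m, rfl⟩
    let j : M →* f.ker := i.codRestrict f.ker hmem
    refine (hκ.comp _).isIrrChar_of_comp j ?_
    have : (κ ∘ f.ker.subtype) ∘ j = θ := hκi
    rw [this]
    exact hθ
  obtain ⟨ρ, hρ, -, hρ1⟩ := hχp.exists_eq_mul_inflated hf hκ hκk
    (e := ip (χ ∘ M.subtype) θ) (by
      intro k hk
      rw [hker] at hk
      obtain ⟨m, rfl⟩ := hk
      have h1 := congrFun hres m
      have h2 := congrFun hκi m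
      have h3 := DFunLike.congr_fun hpi m
      simp only [Function.comp_apply, Pi.smul_apply, smul_eq_mul, MonoidHom.comp_apply] at h1 h2 h3 ⊢
      rw [h2, h3, h1])
  obtain ⟨e, he, he0⟩ := hρ.exists_degree_pos
  have hmul : d = e * t := by
    have := congrFun hres 1
    rw [← hρ1, he] at this
    simp only [Function.comp_apply, map_one, hd, Pi.smul_apply, ht, smul_eq_mul] at this
    exact_mod_cast this
  have hidx : (Subgroup.center (Γ ⧸ i.range)).index ∣ M.index := by
    have h1 : Subgroup.map f p.ker ≤ Subgroup.center (Γ ⧸ i.range) := by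
      rintro _ ⟨z, hz, rfl⟩
      rw [Subgroup.mem_center_iff]
      intro y
      obtain ⟨x, rfl⟩ := hf y
      rw [← map_mul, ← map_mul, hZ z hz x]
    have h2 : M.comap p ≤ p.ker ⊔ f.ker := by
      intro x hx
      rw [hker]
      have h3 : p (i ⟨p x, hx⟩) = p x := DFunLike.congr_fun hpi ⟨p x, hx⟩
      rw [← mul_inv_cancel_right x (i ⟨p x, hx⟩)⁻¹, inv_inv]
      refine mul_mem (Subgroup.mem_sup_left ?_) (Subgroup.mem_sup_right ⟨_, rfl⟩)
      rw [MonoidHom.mem_ker, map_mul, map_inv, h3, mul_inv_cancel]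
    refine (Subgroup.index_dvd_of_le h1).trans ?_
    rw [Subgroup.index_map, MonoidHom.range_eq_top.2 hf, Subgroup.index_top, mul_one,
      ← Subgroup.index_comap_of_surjective M hp]
    exact Subgroup.index_dvd_of_le h2
  have he1 : e = 1 := hρ.degree_eq_one_of_coprime_center he
    (hcop.coprime_dvd_left ⟨t, hmul⟩ |>.coprime_dvd_right hidx)
  rw [hres, ← hρ1, he, he1, Nat.cast_one, one_smul]
  exact hθ

end CoprimeRestriction

section Separable

/-- `G` has a subnormal series of length `n` whose factors are `σ`-groups or `σ'`-groups. -/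
def SepN (σ : Set ℕ) : ℕ → (G : Type) → [Group G] → Prop
  | 0, G, _ => Subsingleton G
  | n + 1, G, _ => ∃ M : Subgroup G, M.Normal ∧ SepN σ n M ∧
      (IsPiNumber σ M.index ∨ IsPiNumber σᶜ M.index)

/-- `σ`-separability, by recursion on a subnormal series. -/
def IsSep (σ : Set ℕ) (G : Type) [Group G] : Prop := ∃ n, SepN σ n G

variable {σ : Set ℕ}

theorem SepN.of_injective (n : ℕ) : ∀ {G H : Type} [Group G] [Group H] (f : H →* G)
    (_ : Function.Injective f) (_ : SepN σ n G), SepN σ n H := by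
  induction n with
  | zero =>
    intro G H _ _ f hf h
    have : Subsingleton G := h
    exact hf.subsingleton
  | succ n ih =>
    intro G H _ _ f hf h
    obtain ⟨M, hM, hs, hi⟩ := h
    have hd : (M.comap f).index ∣ M.index := by
      rw [Subgroup.index_comap]
      exact Subgroup.relIndex_dvd_index_of_normal _ _
    refine ⟨M.comap f, inferInstance, ih (f.subgroupComap M) ?_ hs, hi.imp (·.dvd hd) (·.dvd hd)⟩
    intro a b hab
    exact Subtype.ext (hf (congrArg Subtype.val hab))

theorem SepN.of_surjective (n : ℕ) : ∀ {G H : Type} [Group G] [Group H] (f : G →* H)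
    (_ : Function.Surjective f) (_ : SepN σ n G), SepN σ n H := by
  induction n with
  | zero =>
    intro G H _ _ f hf h
    have : Subsingleton G := h
    exact hf.subsingleton
  | succ n ih =>
    intro G H _ _ f hf h
    obtain ⟨M, hM, hs, hi⟩ := h
    have hd : (M.map f).index ∣ M.index := M.index_map_dvd hf
    exact ⟨M.map f, hM.map f hf, ih (f.subgroupMap M) (f.subgroupMap_surjective M) hs,
      hi.imp (·.dvd hd) (·.dvd hd)⟩

theorem SepN.of_ker (n : ℕ) : ∀ {G H : Type} [Group G] [Group H] [Finite G] (f : G →* H)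
    (_ : Function.Surjective f) (_ : IsPiNumber σ (Nat.card f.ker)) (_ : SepN σ n H),
    SepN σ (n + 1) G := by
  induction n with
  | zero =>
    intro G H _ _ _ f hf hk h
    have : Subsingleton H := h
    refine ⟨⊥, inferInstance, ?_, Or.inl ?_⟩
    · change Subsingleton _
      infer_instance
    · have : f.ker = ⊤ := by
        ext x
        simp [MonoidHom.mem_ker, Subsingleton.elim (f x) 1]
      rw [Subgroup.index_bot]
      rwa [this, Subgroup.card_top] at hk
  | succ n ih =>
    intro G H _ _ _ f hf hk h
    obtain ⟨M, hM, hs, hi⟩ := h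
    refine ⟨M.comap f, inferInstance, ih (f.subgroupComap M) ?_ ?_ hs, ?_⟩
    · exact f.subgroupComap_surjective_of_surjective M hf
    · have h1 : Nat.card (f.subgroupComap M).ker ∣ Nat.card f.ker := by
        let g : (f.subgroupComap M).ker →* f.ker :=
          ((M.comap f).subtype.comp (f.subgroupComap M).ker.subtype).codRestrict f.ker
            fun x => congrArg Subtype.val x.2
        refine Subgroup.card_dvd_of_injective g fun a b hab => Subtype.ext (Subtype.ext ?_)
        have := congrArg Subtype.val hab
        exact this
      exact hk.dvd h1
    · rwa [Subgroup.index_comap_of_surjective _ hf]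

theorem IsSep.of_injective {G H : Type} [Group G] [Group H] (h : IsSep σ G) (f : H →* G)
    (hf : Function.Injective f) : IsSep σ H := h.imp fun n hn => hn.of_injective n f hf

theorem IsSep.subgroup {G : Type} [Group G] (h : IsSep σ G) (H : Subgroup G) : IsSep σ H :=
  h.of_injective H.subtype H.subtype_injective

theorem IsSep.of_surjective {G H : Type} [Group G] [Group H] (h : IsSep σ G) (f : G →* H)
    (hf : Function.Surjective f) : IsSep σ H := h.imp fun n hn => hn.of_surjective n f hf

theorem IsSep.quotient {G : Type} [Group G] (h : IsSep σ G) (N : Subgroup G) [N.Normal] :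
    IsSep σ (G ⧸ N) := h.of_surjective (QuotientGroup.mk' N) (QuotientGroup.mk'_surjective N)

theorem IsSep.of_ker {G H : Type} [Group G] [Group H] [Finite G] (h : IsSep σ H) (f : G →* H)
    (hf : Function.Surjective f) (hk : IsPiNumber σ (Nat.card f.ker)) : IsSep σ G :=
  let ⟨n, hn⟩ := h
  ⟨n + 1, hn.of_ker n f hf hk⟩

theorem IsPiSeparable.isSep {G : Type} [Group G] (h : IsPiSeparable σ G) : IsSep σ G := by
  obtain ⟨n, c, h0, hn, hc⟩ := h
  have key : ∀ k : Fin (n + 1), SepN σ k (c k) := by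
    intro k
    induction k using Fin.induction with
    | zero =>
      rw [h0]
      change Subsingleton _
      infer_instance
    | succ i ih =>
      obtain ⟨h1, h2, h3⟩ := hc i
      exact ⟨_, h2, SepN.of_injective i (Subgroup.subgroupOfEquivOfLe h1).toMonoidHom
        (Subgroup.subgroupOfEquivOfLe h1).injective ih, h3⟩
  have := key (Fin.last n)
  rw [hn] at this
  exact ⟨_, this.of_injective _ (Subgroup.topEquiv (G := G)).symm.toMonoidHom
    (Subgroup.topEquiv (G := G)).symm.injective⟩

theorem IsSep.exists_normal_lt {G : Type} [Group G] [Nontrivial G] (h : IsSep σ G) :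
    ∃ M : Subgroup G, M.Normal ∧ M < ⊤ ∧ (IsPiNumber σ M.index ∨ IsPiNumber σᶜ M.index) := by
  obtain ⟨n, hn⟩ := h
  induction n with
  | zero =>
    have : Subsingleton G := hn
    exact absurd ‹Nontrivial G› (not_nontrivial G)
  | succ n ih =>
    obtain ⟨M, hM, hs, hi⟩ := hn
    by_cases hM1 : M = ⊤
    · subst hM1
      exact ih (hs.of_injective _ (Subgroup.topEquiv (G := G)).symm.toMonoidHom
    (Subgroup.topEquiv (G := G)).symm.injective)
    · exact ⟨M, hM, lt_top_iff_ne_top.2 hM1, hi⟩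

end Separable

section PiElements

variable {σ : Set ℕ} {G : Type} [Group G] [Finite G]

omit [Finite G] in
theorem IsPiElt.map {H : Type} [Group H] {g : G} (h : IsPiElt σ g) (f : G →* H) :
    IsPiElt σ (f g) := IsPiNumber.dvd h (orderOf_map_dvd f g)

omit [Finite G] in
theorem isPiElt_map_iff {H : Type} [Group H] {g : G} {f : G →* H} (hf : Function.Injective f) :
    IsPiElt σ (f g) ↔ IsPiElt σ g := by
  rw [IsPiElt, IsPiElt, orderOf_injective f hf]

omit [Finite G] in
theorem isPiElt_one : IsPiElt σ (1 : G) := by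
  rw [IsPiElt, orderOf_one]
  exact isPiNumber_one σ

omit [Finite G] in
theorem IsPiElt.pow {g : G} (h : IsPiElt σ g) (n : ℕ) : IsPiElt σ (g ^ n) :=
  IsPiNumber.dvd h (orderOf_pow_dvd n)

omit [Finite G] in
theorem isPiElt_of_pow_eq_one {g : G} {n : ℕ} (hn : IsPiNumber σ n) (h : g ^ n = 1) :
    IsPiElt σ g := hn.dvd (orderOf_dvd_of_pow_eq_one h)

omit [Finite G] in
theorem isPiElt_of_card (h : IsPiNumber σ (Nat.card G)) (g : G) : IsPiElt σ g :=
  h.dvd (orderOf_dvd_natCard g)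

omit [Finite G] in
theorem isPiElt_of_mem [Finite G] {H : Subgroup G} (h : IsPiNumber σ (Nat.card H)) {g : G}
    (hg : g ∈ H) : IsPiElt σ g := by
  have := (isPiElt_of_card h ⟨g, hg⟩).map H.subtype
  exact this

theorem isPiNumber_card (h : ∀ g : G, IsPiElt σ g) : IsPiNumber σ (Nat.card G) := by
  intro q hq hd
  have : Fact q.Prime := ⟨hq⟩
  obtain ⟨g, hg⟩ := exists_prime_orderOf_dvd_card' q hd
  exact h g q hq (hg ▸ dvd_rfl)

omit [Finite G] in
theorem IsPiElt.eq_one {g : G} (h : IsPiElt σ g) (h' : IsPiElt σᶜ g) : g = 1 :=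
  orderOf_eq_one_iff.1 (IsPiNumber.eq_one h h')

theorem IsPiElt.eq_one_of_mem {O : Subgroup G} (hO : IsPiNumber σᶜ (Nat.card O)) {g : G}
    (h : IsPiElt σ g) (hg : g ∈ O) : g = 1 := h.eq_one (isPiElt_of_mem hO hg)

/-- Every element of a finite group is a product of its commuting `σ`- and `σ'`-parts. -/
theorem exists_pi_parts (σ : Set ℕ) (g : G) : ∃ a b : ℕ, g ^ (a + b) = g ∧
    IsPiElt σ (g ^ a) ∧ IsPiElt σᶜ (g ^ b) := by
  obtain ⟨m, n, hmn, hm, hn⟩ := exists_pi_factorization σ (orderOf_pos g).ne'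
  have hcop := hm.coprime hn
  obtain ⟨a, ha0, ha1⟩ := Nat.chineseRemainder hcop 1 0
  obtain ⟨b, hb0, hb1⟩ := Nat.chineseRemainder hcop 0 1
  refine ⟨a, b, ?_, ?_, ?_⟩
  · conv_rhs => rw [← pow_one g]
    rw [pow_eq_pow_iff_modEq, hmn]
    refine (Nat.modEq_and_modEq_iff_modEq_mul hcop).1 ⟨?_, ?_⟩
    · simpa using ha0.add hb0
    · simpa using ha1.add hb1
  · apply isPiElt_of_pow_eq_one hm
    rw [← pow_mul, ← orderOf_dvd_iff_pow_eq_one, hmn, mul_comm]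
    exact mul_dvd_mul_right ((Nat.modEq_zero_iff_dvd).1 ha1) _ |>.trans (by rw [mul_comm])
  · apply isPiElt_of_pow_eq_one hn
    rw [← pow_mul, ← orderOf_dvd_iff_pow_eq_one, hmn]
    exact mul_dvd_mul_right ((Nat.modEq_zero_iff_dvd).1 hb0) _

/-- The `σ`-element in a coset. -/
theorem exists_piElt_lift {H : Type} [Group H] (f : G →* H) {g : G} (h : IsPiElt σ (f g)) :
    ∃ g', IsPiElt σ g' ∧ f g' = f g ∧ ∃ n, g' = g ^ n := by
  obtain ⟨a, b, hab, ha, hb⟩ := exists_pi_parts σ g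
  refine ⟨g ^ a, ha, ?_, a, rfl⟩
  have h1 : f g ^ b = 1 := (h.pow b).eq_one (by rw [← map_pow]; exact hb.map f)
  conv_rhs => rw [← hab, map_pow, pow_add, h1, mul_one]
  rw [map_pow]

theorem exists_normal_relIndex (hs : IsSep σ G) {N : Subgroup G} [hN : N.Normal] (h : N ≠ ⊥) :
    ∃ K : Subgroup G, K.Normal ∧ K < N ∧
      (IsPiNumber σ (K.relIndex N) ∨ IsPiNumber σᶜ (K.relIndex N)) := by
  suffices H : ∀ τ : Set ℕ, ∀ M : Subgroup N, M.Normal → M < ⊤ → IsPiNumber τ M.index →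
      ∃ K : Subgroup G, K.Normal ∧ K < N ∧ IsPiNumber τ (K.relIndex N) by
    have : Nontrivial N := (Subgroup.nontrivial_iff_ne_bot N).2 h
    obtain ⟨M, hM, hlt, hi | hi⟩ := (hs.subgroup N).exists_normal_lt
    · obtain ⟨K, h1, h2, h3⟩ := H σ M hM hlt hi
      exact ⟨K, h1, h2, Or.inl h3⟩
    · obtain ⟨K, h1, h2, h3⟩ := H σᶜ M hM hlt hi
      exact ⟨K, h1, h2, Or.inr h3⟩
  intro τ M hM hlt hi
  let S : Set G := {x | x ∈ N ∧ IsPiElt τᶜ x}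
  let K := Subgroup.closure S
  have hKN : K ≤ N := (Subgroup.closure_le _).2 fun x hx => hx.1
  have hKM : K ≤ M.map N.subtype := by
    refine (Subgroup.closure_le _).2 fun x hx => ?_
    refine ⟨⟨x, hx.1⟩, ?_, rfl⟩
    rw [SetLike.mem_coe, ← QuotientGroup.eq_one_iff]
    refine IsPiElt.eq_one (σ := τ) (isPiElt_of_card (G := N ⧸ M) hi _) ?_
    have h1 : IsPiElt τᶜ (⟨x, hx.1⟩ : N) := (isPiElt_map_iff N.subtype_injective).1 hx.2
    exact h1.map (QuotientGroup.mk' M)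
  refine ⟨K, ?_, ?_, ?_⟩
  · refine ⟨fun x hx g => ?_⟩
    have h1 : K.map (MulAut.conj g).toMonoidHom ≤ K := by
      rw [MonoidHom.map_closure, Subgroup.closure_le]
      rintro _ ⟨y, hy, rfl⟩
      exact Subgroup.subset_closure ⟨hN.conj_mem y hy.1 g, hy.2.map _⟩
    exact h1 ⟨x, hx, rfl⟩
  · refine lt_of_le_of_ne hKN fun h1 => hlt.ne ?_
    rw [eq_top_iff]
    intro x _
    have hx : (x : G) ∈ K := by rw [h1]; exact x.2
    obtain ⟨y, hy, hyx⟩ := hKM hx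
    have : y = x := Subtype.ext hyx
    rwa [← this]
  · have hKn : (K.subgroupOf N).Normal := by
      refine ⟨fun x hx g => ?_⟩
      rw [Subgroup.mem_subgroupOf] at hx ⊢
      have h1 : K.map (MulAut.conj (g : G)).toMonoidHom ≤ K := by
        rw [MonoidHom.map_closure, Subgroup.closure_le]
        rintro _ ⟨y, hy, rfl⟩
        exact Subgroup.subset_closure ⟨hN.conj_mem y hy.1 g, hy.2.map _⟩
      exact h1 ⟨x, hx, rfl⟩
    change IsPiNumber τ (Nat.card (N ⧸ K.subgroupOf N))
    refine isPiNumber_card fun y => ?_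
    obtain ⟨x, rfl⟩ := QuotientGroup.mk'_surjective _ y
    obtain ⟨a, b, hab, ha, hb⟩ := exists_pi_parts τ x
    have h1 : QuotientGroup.mk' (K.subgroupOf N) (x ^ b) = 1 := by
      rw [← MonoidHom.mem_ker, QuotientGroup.ker_mk', Subgroup.mem_subgroupOf]
      exact Subgroup.subset_closure ⟨(x ^ b).2, hb.map N.subtype⟩
    rw [← hab, pow_add, map_mul, h1, mul_one]
    exact ha.map _

/-- The largest normal `σ`-subgroup. -/
theorem exists_piCore (σ : Set ℕ) (G : Type) [Group G] [Finite G] :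
    ∃ O : Subgroup G, O.Normal ∧ IsPiNumber σ (Nat.card O) ∧
      ∀ N : Subgroup G, N.Normal → IsPiNumber σ (Nat.card N) → N ≤ O := by
  let S : Set (Subgroup G) := {N | N.Normal ∧ IsPiNumber σ (Nat.card N)}
  have hne : S.Nonempty := ⟨⊥, inferInstance, by rw [Subgroup.card_bot]; exact isPiNumber_one σ⟩
  obtain ⟨O, hO⟩ := (Set.toFinite S).exists_maximal hne
  refine ⟨O, hO.1.1, hO.1.2, fun N hN hNσ => ?_⟩
  have := hO.1.1
  have h1 : O ⊔ N ∈ S := by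
    refine ⟨inferInstance, isPiNumber_card fun g => ?_⟩
    obtain ⟨g, hg⟩ := g
    obtain ⟨x, hx, y, hy, rfl⟩ := Subgroup.mem_sup_of_normal_right.1 hg
    rw [← isPiElt_map_iff (O ⊔ N).subtype_injective]
    change IsPiElt σ (x * y)
    obtain ⟨a, b, hab, ha, hb⟩ := exists_pi_parts σ (x * y)
    have h2 : ∀ (P : Subgroup G) [P.Normal], IsPiNumber σ (Nat.card P) → ∀ z : G,
        IsPiElt σ (QuotientGroup.mk' P z) → IsPiElt σ z := by
      intro P _ hP z hz
      refine isPiElt_of_pow_eq_one (hP.mul hz) ?_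
      rw [mul_comm, pow_mul]
      have h3 : z ^ orderOf (QuotientGroup.mk' P z) ∈ P := by
        rw [← QuotientGroup.eq_one_iff]
        change QuotientGroup.mk' P (z ^ _) = 1
        rw [map_pow, pow_orderOf_eq_one]
      have := pow_card_eq_one' (x := (⟨_, h3⟩ : P))
      exact congrArg Subtype.val this
    refine h2 N hNσ _ ?_
    have h4 : QuotientGroup.mk' N y = 1 := by
      rwa [← MonoidHom.mem_ker, QuotientGroup.ker_mk']
    rw [map_mul, h4, mul_one]
    exact (isPiElt_of_mem hO.1.2 hx).map _
  exact le_sup_right.trans (hO.2 h1 le_sup_left)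

theorem IsSep.exists_normal_ne_bot (hs : IsSep σ G) [Nontrivial G] :
    ∃ M : Subgroup G, M.Normal ∧ M ≠ ⊥ ∧
      (IsPiNumber σ (Nat.card M) ∨ IsPiNumber σᶜ (Nat.card M)) := by
  obtain ⟨N, ⟨hN, hN0⟩, hmin⟩ := (Set.toFinite {N : Subgroup G | N.Normal ∧ N ≠ ⊥}).exists_minimal
    ⟨⊤, inferInstance, top_ne_bot⟩
  obtain ⟨K, hK, hlt, hi⟩ := exists_normal_relIndex hs hN0
  have hK0 : K = ⊥ := by
    by_contra h
    exact hlt.not_ge (hmin ⟨hK, h⟩ hlt.le)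
  rw [hK0, Subgroup.relIndex_bot_left] at hi
  exact ⟨N, hN, hN0, hi⟩

end PiElements

section Conjugacy

variable {σ : Set ℕ}

theorem eq_pow_of_isPiNumber_singleton {q n : ℕ} (hn : n ≠ 0)
    (h : IsPiNumber {q} n) : ∃ k, n = q ^ k :=
  ⟨_, Nat.eq_prime_pow_of_unique_prime_dvd hn fun {d} hd hdn => h d hd hdn⟩

theorem exists_conj_of_prime_power {G : Type} [Group G] [Finite G] {O : Subgroup G} [hO : O.Normal]
    {q k : ℕ} (hq : q.Prime) (hqO : ¬ q ∣ Nat.card O) {g l : G} (hg : g ^ q ^ k = 1)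
    (hl : l ^ q ^ k = 1) (h : g⁻¹ * l ∈ O) : ∃ b ∈ O, b * g * b⁻¹ = l := by
  let _ := Fintype.ofFinite O
  have : Fact q.Prime := ⟨hq⟩
  have h1 : ∀ b ∈ O, l * b * g⁻¹ ∈ O := by
    intro b hb
    have h2 : g⁻¹ * l * b ∈ O := mul_mem h hb
    have h3 := hO.conj_mem _ h2 g
    simpa [mul_assoc] using h3
  have h1' : ∀ b ∈ O, l⁻¹ * b * g ∈ O := by
    intro b hb
    have h3 := hO.conj_mem _ (mul_mem hb (hO.conj_mem _ (inv_mem h) g)) l⁻¹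
    simpa [mul_assoc] using h3
  let f : Equiv.Perm O :=
    { toFun := fun b => ⟨l * b * g⁻¹, h1 b b.2⟩
      invFun := fun b => ⟨l⁻¹ * b * g, h1' b b.2⟩
      left_inv := fun b => by simp [mul_assoc]
      right_inv := fun b => by simp [mul_assoc] }
  have hf : ∀ n : ℕ, ∀ b : O, (((f ^ n) b : O) : G) = l ^ n * b * (g ^ n)⁻¹ := by
    intro n
    induction n with
    | zero => intro b; simp
    | succ n ih =>
      intro b
      rw [pow_succ', Equiv.Perm.mul_apply]
      change l * ((f ^ n) b : G) * g⁻¹ = _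
      rw [ih, pow_succ', pow_succ' g]
      simp [mul_assoc]
  obtain ⟨b, hb⟩ := Equiv.Perm.exists_fixed_point_of_prime (p := q) (n := k) (σ := f)
    (by rwa [← Nat.card_eq_fintype_card]) (by
      ext b
      rw [hf, hg, hl]
      simp)
  have hb' : l * (b : G) * g⁻¹ = b := congrArg Subtype.val hb
  refine ⟨b, b.2, ?_⟩
  nth_rewrite 1 [← hb']
  group

/-- Two `σ`-elements in the same coset of a normal `σ'`-subgroup are conjugate. -/
theorem exists_conj_of_piElt {G : Type} [Group G] [Finite G] {O : Subgroup G} [O.Normal]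
    (hO : IsPiNumber σᶜ (Nat.card O)) {g l : G} (hg : IsPiElt σ g) (hl : IsPiElt σ l)
    (h : g⁻¹ * l ∈ O) : ∃ b ∈ O, b * g * b⁻¹ = l := by
  induction hn : orderOf g using Nat.strong_induction_on generalizing G with
  | _ n ih =>
  subst hn
  have hmk : QuotientGroup.mk' O g = QuotientGroup.mk' O l := QuotientGroup.eq.2 h
  have hpow : ∀ m : ℕ, (g ^ m)⁻¹ * l ^ m ∈ O := by
    intro m
    rw [← QuotientGroup.eq]
    change QuotientGroup.mk' O (g ^ m) = QuotientGroup.mk' O (l ^ m)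
    rw [map_pow, map_pow, hmk]
  have hone : ∀ m : ℕ, g ^ m = 1 → l ^ m = 1 := by
    intro m hm
    refine (hl.pow m).eq_one_of_mem hO ?_
    have := hpow m
    rwa [hm, inv_one, one_mul] at this
  by_cases hg1 : g = 1
  · have := hone 1 (by rw [hg1, pow_one])
    exact ⟨1, one_mem _, by rw [hg1, ← this]; simp⟩
  obtain ⟨q, hq, hqd⟩ := Nat.exists_prime_and_dvd (fun h => hg1 (orderOf_eq_one_iff.1 h))
  obtain ⟨a, b, hab, ha, hb⟩ := exists_pi_parts {q} g
  have hablt : l ^ (a + b) = l := by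
    have h1 : orderOf l ∣ orderOf g := orderOf_dvd_of_pow_eq_one (hone _ (pow_orderOf_eq_one g))
    conv_rhs => rw [← pow_one l]
    rw [pow_eq_pow_iff_modEq]
    refine Nat.ModEq.of_dvd h1 ?_
    rw [← pow_eq_pow_iff_modEq, hab, pow_one]
  obtain ⟨k, hk⟩ := eq_pow_of_isPiNumber_singleton (orderOf_pos _).ne' ha
  have hgk : (g ^ a) ^ q ^ k = 1 := by rw [← hk, pow_orderOf_eq_one]
  have hlk : (l ^ a) ^ q ^ k = 1 := by
    rw [← pow_mul] at hgk ⊢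
    exact hone _ hgk
  have hqO : ¬ q ∣ Nat.card O := fun h' => hO q hq h' (hg q hq hqd)
  obtain ⟨c, hc, hcx⟩ := exists_conj_of_prime_power hq hqO hgk hlk (hpow a)
  set x := l ^ a with hx
  let C := Subgroup.centralizer ({x} : Set G)
  have hgC : c * g ^ b * c⁻¹ ∈ C := by
    rw [Subgroup.mem_centralizer_singleton_iff, ← hcx]
    have : g ^ b * g ^ a = g ^ a * g ^ b := by rw [← pow_add, ← pow_add, add_comm]
    calc c * g ^ b * c⁻¹ * (c * g ^ a * c⁻¹) = c * (g ^ b * g ^ a) * c⁻¹ := by group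
      _ = c * g ^ a * c⁻¹ * (c * g ^ b * c⁻¹) := by rw [this]; group
  have hlC : l ^ b ∈ C := by
    rw [Subgroup.mem_centralizer_singleton_iff, hx, ← pow_add, ← pow_add, add_comm]
  have hOC : IsPiNumber σᶜ (Nat.card (O.subgroupOf C)) :=
    hO.dvd (Subgroup.card_dvd_of_injective ((C.subtype.comp (O.subgroupOf C).subtype).codRestrict O
      fun y => y.2) fun y z hyz => by
        have := congrArg Subtype.val hyz
        exact Subtype.ext (Subtype.ext this))
  have hord : orderOf (c * g ^ b * c⁻¹) = orderOf (g ^ b) :=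
    orderOf_injective (MulAut.conj c).toMonoidHom (MulAut.conj c).injective (g ^ b)
  have hordC : orderOf (⟨_, hgC⟩ : C) = orderOf (g ^ b) := by
    rw [← hord]
    exact (orderOf_injective C.subtype C.subtype_injective _).symm
  obtain ⟨d, hd, hde⟩ := ih (orderOf (g ^ b)) (lt_of_le_of_ne
      (Nat.le_of_dvd (orderOf_pos g) (orderOf_pow_dvd b)) fun h' => hb q hq (h' ▸ hqd) rfl)
    (O := O.subgroupOf C) hOC (g := ⟨_, hgC⟩) (l := ⟨_, hlC⟩)
    ((isPiElt_map_iff C.subtype_injective).1 ((hg.pow b).map (MulAut.conj c).toMonoidHom))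
    ((isPiElt_map_iff C.subtype_injective).1 (hl.pow b)) (by
      rw [Subgroup.mem_subgroupOf]
      change (c * g ^ b * c⁻¹)⁻¹ * l ^ b ∈ O
      rw [← QuotientGroup.eq_one_iff]
      have h1 : QuotientGroup.mk' O c = 1 := (QuotientGroup.eq_one_iff c).2 hc
      change QuotientGroup.mk' O ((c * g ^ b * c⁻¹)⁻¹ * l ^ b) = 1
      simp only [map_mul, map_inv, h1, map_pow, hmk]
      simp) hordC
  have hde' : (d : G) * (c * g ^ b * c⁻¹) * (d : G)⁻¹ = l ^ b := congrArg Subtype.val hde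
  have hdx : (d : G) * x = x * d := Subgroup.mem_centralizer_singleton_iff.1 d.2
  refine ⟨d * c, mul_mem hd hc, ?_⟩
  calc (d : G) * c * g * ((d : G) * c)⁻¹
      = d * (c * g ^ a * c⁻¹) * (d : G)⁻¹ * (d * (c * g ^ b * c⁻¹) * (d : G)⁻¹) := by
        nth_rewrite 1 [← hab]
        rw [pow_add]
        group
    _ = x * l ^ b := by rw [hde', hcx, hdx]; group
    _ = l := by rw [hx, ← pow_add, hablt]

/-- If `L` supplements a normal `σ'`-subgroup then each `σ`-element is conjugate into `L`. -/
theorem exists_conj_mem_of_sup {G : Type} [Group G] [Finite G] {O L : Subgroup G} [O.Normal]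
    (hO : IsPiNumber σᶜ (Nat.card O)) (hL : L ⊔ O = ⊤) {g : G} (hg : IsPiElt σ g) :
    ∃ b ∈ O, ∃ l : L, IsPiElt σ l ∧ b * g * b⁻¹ = l := by
  obtain ⟨l, hl, y, hy, hly⟩ := Subgroup.mem_sup_of_normal_right.1
    (show g ∈ L ⊔ O by rw [hL]; trivial)
  have h1 : QuotientGroup.mk' O l = QuotientGroup.mk' O g := by
    rw [← hly, map_mul, show QuotientGroup.mk' O y = 1 from (QuotientGroup.eq_one_iff y).2 hy,
      mul_one]
  obtain ⟨l', hl', he, n, hn⟩ := exists_piElt_lift (QuotientGroup.mk' O) (g := l)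
    (by rw [h1]; exact hg.map _)
  obtain ⟨b, hb, hbe⟩ := exists_conj_of_piElt hO hg hl' (QuotientGroup.eq.1 (h1.symm.trans he.symm))
  have hlL : l' ∈ L := by rw [hn]; exact pow_mem hl n
  exact ⟨b, hb, ⟨l', hlL⟩, (isPiElt_map_iff L.subtype_injective).1 hl', hbe⟩

end Conjugacy

section Complements

open scoped Pointwise in
theorem Subgroup.IsComplement'.eq_stabilizer {G : Type} [Group G] [Finite G] {H K : Subgroup G}
    [H.Normal] [IsMulCommutative H] (hcop : (Nat.card H).Coprime H.index)
    (hK : K.IsComplement' H) :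
    ∃ α : H.QuotientDiff, K = MulAction.stabilizer G α := by
  let T : H.LeftTransversal := ⟨K, hK⟩
  let α : H.QuotientDiff := Quotient.mk'' T
  refine ⟨α, Subgroup.eq_of_le_of_card_ge ?_ ?_⟩
  · intro k hk
    change Quotient.mk'' (MulOpposite.op k⁻¹ • T) = (Quotient.mk'' T : H.QuotientDiff)
    congr 1
    refine Subtype.ext ?_
    change MulOpposite.op k⁻¹ • (K : Set G) = K
    ext x
    rw [Set.mem_smul_set_iff_inv_smul_mem]
    simp only [← MulOpposite.op_inv, inv_inv, MulOpposite.smul_eq_mul_unop, MulOpposite.unop_op,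
      SetLike.mem_coe]
    exact K.mul_mem_cancel_right hk
  · have h1 := hK.card_mul_card
    have h2 := (Subgroup.isComplement'_stabilizer_of_coprime (α := α) hcop).card_mul_card
    rw [← h1, mul_comm] at h2
    exact (Nat.eq_of_mul_eq_mul_right Nat.card_pos h2).le

theorem Subgroup.IsComplement'.exists_map_conj_eq {G : Type} [Group G] [Finite G]
    {H K L : Subgroup G} [H.Normal] [IsMulCommutative H] (hcop : (Nat.card H).Coprime H.index)
    (hK : K.IsComplement' H) (hL : L.IsComplement' H) :
    ∃ h : H, L = K.map (MulAut.conj (h : G)).toMonoidHom := by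
  obtain ⟨α, hα⟩ := hK.eq_stabilizer hcop
  obtain ⟨β, hβ⟩ := hL.eq_stabilizer hcop
  obtain ⟨h, rfl⟩ := Subgroup.exists_smul_eq hcop α β
  refine ⟨h, ?_⟩
  rw [hβ, hα]
  exact MulAction.stabilizer_smul_eq_stabilizer_map_conj (h : G) α

/-- Frattini argument for complements of an abelian normal subgroup. -/
theorem exists_complement_normalizer {G : Type} [Group G] [Finite G] {B E₁ : Subgroup G}
    [hB : B.Normal] [hE : E₁.Normal] [IsMulCommutative B] (hBE : B ≤ E₁)
    (hcop : (Nat.card B).Coprime (B.relIndex E₁)) :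
    ∃ E : Subgroup G, B ⊔ E = E₁ ∧ Nat.card E = B.relIndex E₁ ∧
      B ⊔ Subgroup.normalizer (E : Set G) = ⊤ := by
  let H := B.subgroupOf E₁
  have hc : Nat.card H = Nat.card B := Nat.card_congr (Subgroup.subgroupOfEquivOfLe hBE).toEquiv
  have : IsMulCommutative H := ⟨⟨fun a b => by
    have h1 := (‹IsMulCommutative B›).is_comm.comm ⟨a, a.2⟩ ⟨b, b.2⟩
    have h2 := congrArg Subtype.val h1
    exact Subtype.ext (Subtype.ext h2)⟩⟩
  have hcop' : (Nat.card H).Coprime H.index := by rwa [hc]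
  obtain ⟨K, hK⟩ := Subgroup.exists_left_complement'_of_coprime hcop'
  have hKc : Nat.card K * Nat.card H = Nat.card E₁ := hK.card_mul_card
  have hKi : Nat.card K = H.index := by
    have h1 := H.card_mul_index
    rw [← hKc, mul_comm] at h1
    exact (Nat.eq_of_mul_eq_mul_right Nat.card_pos h1).symm
  refine ⟨K.map E₁.subtype, ?_, ?_, ?_⟩
  · have h1 : H.map E₁.subtype = B := by
      rw [Subgroup.subgroupOf_map_subtype, inf_eq_left.2 hBE]
    rw [← h1, ← Subgroup.map_sup, sup_comm, hK.sup_eq_top, ← MonoidHom.range_eq_map,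
      Subgroup.range_subtype]
  · rw [Nat.card_congr (K.equivMapOfInjective _ E₁.subtype_injective).symm.toEquiv, hKi]
    rfl
  · rw [eq_top_iff]
    intro g _
    let c : MulAut E₁ := MulAut.conjNormal g
    have hL : (K.map c.toMonoidHom).IsComplement' H := by
      have h1 : Nat.card (K.map c.toMonoidHom) = Nat.card K :=
        (Nat.card_congr (K.equivMapOfInjective _ c.injective).toEquiv).symm
      refine Subgroup.isComplement'_of_coprime (by rw [h1, hKc]) ?_
      rw [h1, hKi]
      exact hcop'.symm
    obtain ⟨h, hh⟩ := hK.exists_map_conj_eq hcop' hL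
    have hmem : ((h : E₁) : G) ∈ B := h.2
    rw [show g = ((h : E₁) : G) * (((h : E₁) : G)⁻¹ * g) by group]
    refine mul_mem (Subgroup.mem_sup_left hmem) (Subgroup.mem_sup_right ?_)
    rw [Subgroup.mem_normalizer_iff]
    intro x
    constructor
    · rintro ⟨k, hk, rfl⟩
      have h1 : c k ∈ K.map c.toMonoidHom := ⟨k, hk, rfl⟩
      rw [hh] at h1
      obtain ⟨k', hk', he⟩ := h1
      have he' : ((h : E₁) : G) * k' * ((h : E₁) : G)⁻¹ = g * k * g⁻¹ := congrArg Subtype.val he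
      refine ⟨k', hk', ?_⟩
      change (k' : G) = _ * (k : G) * _
      rw [mul_inv_rev, inv_inv, ← mul_assoc, mul_assoc _ g, mul_assoc _ (g * (k : G)), ← he']
      group
    · rintro ⟨k', hk', he⟩
      have he : (k' : G) = ((h : E₁) : G)⁻¹ * g * x * (((h : E₁) : G)⁻¹ * g)⁻¹ := he
      have h1 : (h : E₁) * k' * (h : E₁)⁻¹ ∈ K.map (MulAut.conj (h : E₁)).toMonoidHom :=
        ⟨k', hk', rfl⟩
      rw [← hh] at h1
      obtain ⟨k, hk, hke⟩ := h1
      have hke' : g * k * g⁻¹ = ((h : E₁) : G) * k' * ((h : E₁) : G)⁻¹ := congrArg Subtype.val hke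
      refine ⟨k, hk, ?_⟩
      change (k : G) = x
      have : (k : G) = g⁻¹ * (g * k * g⁻¹) * g := by group
      rw [this, hke', he]
      group

/-- If a normal `σ'`-subgroup `O` has no proper supplement, then a normal extension of `O` by a
`σ`-group has a normal Hall `σ`-subgroup. -/
theorem exists_normal_of_no_supplement {σ : Set ℕ} {G : Type} [Group G] [Finite G]
    {O Y : Subgroup G} [hO : O.Normal] [hY : Y.Normal] (hOY : O ≤ Y)
    (hOσ : IsPiNumber σᶜ (Nat.card O)) (hYσ : IsPiNumber σ (O.relIndex Y))
    (hsup : ∀ L : Subgroup G, O ⊔ L = ⊤ → L = ⊤) :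
    ∃ E : Subgroup G, E.Normal ∧ IsPiNumber σ (Nat.card E) ∧ O ⊔ E = Y := by
  induction hn : Nat.card G using Nat.strong_induction_on generalizing G with
  | _ n ih =>
  subst hn
  by_cases hO1 : O = ⊥
  · subst hO1
    rw [Subgroup.relIndex_bot_left] at hYσ
    exact ⟨Y, hY, hYσ, by simp⟩
  have hnil : Group.IsNilpotent O := by
    have hle : O ≤ frattini G := by
      have : IsCoatomic (Subgroup G) := inferInstance
      refine le_iInf fun K => le_iInf fun hK => ?_
      by_contra h
      have h1 := hK.2 (O ⊔ K) (lt_of_le_of_ne le_sup_right fun h' => h (by rw [h']; exact le_sup_left))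
      exact hK.1 (hsup K h1)
    have := frattini_nilpotent (G := G)
    exact (Group.isNilpotent_congr (Subgroup.subgroupOfEquivOfLe hle)).1 inferInstance
  have hnt : Nontrivial O := (Subgroup.nontrivial_iff_ne_bot O).2 hO1
  have hz : Subgroup.center O ≠ ⊥ := Group.IsNilpotent.center_ne_bot O
  let B := (Subgroup.center O).map O.subtype
  have hB : B.Normal := inferInstance
  have hB1 : B ≠ ⊥ := by
    intro h
    exact hz ((Subgroup.map_eq_bot_iff_of_injective _ O.subtype_injective).1 h)
  have hBO : B ≤ O := Subgroup.map_subtype_le _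
  have hBc : IsMulCommutative B := inferInstance
  let f := QuotientGroup.mk' B
  have hf : Function.Surjective f := QuotientGroup.mk'_surjective B
  have hker : f.ker = B := QuotientGroup.ker_mk' B
  have hOn : (O.map f).Normal := hO.map f hf
  have hYn : (Y.map f).Normal := hY.map f hf
  have hcard : Nat.card (G ⧸ B) < Nat.card G := by
    have h1 := B.card_eq_card_quotient_mul_card_subgroup
    have h2 : 1 < Nat.card B := (Subgroup.one_lt_card_iff_ne_bot B).2 hB1
    have h3 : 0 < Nat.card (G ⧸ B) := Nat.card_pos
    nlinarith
  obtain ⟨E', hE', hEσ, hEY⟩ := ih _ hcard (O := O.map f) (Y := Y.map f) (Subgroup.map_mono hOY)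
    (hOσ.dvd (Subgroup.card_map_dvd O f))
    (hYσ.dvd (by
      rw [Subgroup.relIndex_map_map, hker, sup_eq_left.2 hBO, sup_eq_left.2 (hBO.trans hOY)]))
    (fun L hL => by
      have h1 : O ⊔ L.comap f = ⊤ := by
        have h2 : (O ⊔ L.comap f).map f = ⊤ := by
          rw [Subgroup.map_sup, Subgroup.map_comap_eq_self_of_surjective hf, hL]
        have h3 : B ≤ O ⊔ L.comap f := hBO.trans le_sup_left
        rw [← Subgroup.comap_map_eq_self (f := f) (hker.trans_le h3), h2, Subgroup.comap_top]
      have h2 := hsup _ h1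
      rw [← Subgroup.map_comap_eq_self_of_surjective hf L, h2, Subgroup.map_top_of_surjective f hf])
    rfl
  let E₁ := E'.comap f
  have hBE : B ≤ E₁ := by
    conv_lhs => rw [← hker]
    exact MonoidHom.ker_le_comap f E'
  have hrel : B.relIndex E₁ = Nat.card E' := by
    conv_lhs => rw [← hker, ← MonoidHom.comap_bot]
    rw [Subgroup.relIndex_comap, Subgroup.map_comap_eq_self_of_surjective hf,
      Subgroup.relIndex_bot_left]
  have hcop : (Nat.card B).Coprime (B.relIndex E₁) := by
    rw [hrel]
    exact (hEσ.coprime (hOσ.dvd (Subgroup.card_dvd_of_le hBO))).symm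
  obtain ⟨E, hE1, hE2, hE3⟩ := exists_complement_normalizer hBE hcop
  have hEY' : O ⊔ E₁ = Y := by
    have h1 : (O ⊔ E₁).map f = Y.map f := by
      rw [Subgroup.map_sup, Subgroup.map_comap_eq_self_of_surjective hf, hEY]
    have h2 := congrArg (Subgroup.comap f) h1
    rwa [Subgroup.comap_map_eq_self (by rw [hker]; exact hBO.trans le_sup_left),
      Subgroup.comap_map_eq_self (by rw [hker]; exact hBO.trans hOY)] at h2
  refine ⟨E, ?_, by rwa [hE2, hrel], ?_⟩
  · rw [← Subgroup.normalizer_eq_top_iff]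
    refine hsup _ ?_
    rw [eq_top_iff, ← hE3]
    exact sup_le_sup_right hBO _
  · rw [← hEY', ← hE1, ← sup_assoc, sup_eq_left.2 hBO]

end Complements

section Special

variable {σ : Set ℕ}

/-- A reformulation of `IsPiSpecial` in terms of inner products and determinants. -/
structure Special (σ : Set ℕ) (G : Type) [Group G] [Finite G] (χ : G → ℂ) : Prop where
  irr : IsIrrChar G χ
  degree : ∃ n : ℕ, χ 1 = n ∧ IsPiNumber σ n
  det : ∀ M : Subgroup G, M.IsSubnormal → ∀ θ : M → ℂ, IsIrrChar M θ →
    ip (χ ∘ M.subtype) θ ≠ 0 → IsPiNumber σ (orderOf (charDet θ))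

theorem IsPiSpecial.special {G : Type} [Group G] [Finite G] {χ : G → ℂ}
    (h : IsPiSpecial σ G χ) : Special σ G χ := by
  refine ⟨h.1, h.2.1, fun M hM θ hθ hne => ?_⟩
  obtain ⟨n, c, hmono, hnorm, h0, hl⟩ := Subgroup.IsSubnormal.isSubnormal_iff.1 hM
  have hM' : IsSubnormalSubgroup M := by
    refine ⟨n, fun i => c i, h0, by simpa using hl, fun i => ⟨hmono (by simp), ?_⟩⟩
    exact hnorm i
  refine (hasPiDetOrder_iff.1 (h.2.2 M hM' θ ?_)).2
  exact (isConstituent_iff (h.1.1.comp M.subtype)).2 ⟨hθ, hne⟩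

variable {G H : Type} [Group G] [Group H] [Finite G] [Finite H]

theorem orderOf_charDet_comp_equiv {χ : G → ℂ} (h : IsCharacter G χ) (e : H ≃* G) :
    orderOf (charDet (χ ∘ e)) = orderOf (charDet χ) := by
  have h1 : charDet (χ ∘ e) = (charDet χ).comp e.toMonoidHom := charDet_comp h e.toMonoidHom
  rw [h1]
  refine orderOf_eq_orderOf_iff.2 fun n => ?_
  constructor
  · intro h2
    ext g
    have := DFunLike.congr_fun h2 (e.symm g)
    simpa [MonoidHom.pow_apply] using this
  · intro h2
    ext g
    have := DFunLike.congr_fun h2 (e g)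
    simpa [MonoidHom.pow_apply] using this

theorem Special.constituent {χ : G → ℂ} (h : Special σ G χ) {f : H →* G}
    (hf : Function.Injective f) (hn : f.range.Normal) {θ : H → ℂ} (hθ : IsIrrChar H θ)
    (hne : ip (χ ∘ f) θ ≠ 0) : Special σ H θ := by
  refine ⟨hθ, ?_, fun M hM η hη hne' => ?_⟩
  · let e := MonoidHom.ofInjective hf
    obtain ⟨n, hn1, hnσ⟩ := h.degree
    obtain ⟨m, hm, _⟩ := hθ.exists_degree_pos
    refine ⟨m, hm, hnσ.dvd (h.irr.degree_dvd (N := f.range) (hθ.comp_mulEquiv e.symm) ?_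
      (by simpa using hm) hn1)⟩
    rw [← ip_comp_mulEquiv e]
    convert hne using 2
    · ext x
      rfl
    · ext x
      simp
  · have hM' : (M.map f).IsSubnormal := by
      have h1 : (M.map f.rangeRestrict).IsSubnormal := hM.map f.rangeRestrict_surjective
      have h2 := Subgroup.IsSubnormal.trans' h1 hn.isSubnormal
      rwa [Subgroup.map_map, MonoidHom.subtype_comp_rangeRestrict] at h2
    let e := M.equivMapOfInjective f hf
    have := h.det _ hM' (η ∘ e.symm) (hη.comp_mulEquiv e.symm) (by
      rw [← ip_comp_mulEquiv e]
      have := (h.irr.1.comp f).ip_comp_ne_zero_trans hθ hne M.subtype hη.1 hne'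
      convert this using 2
      · ext x
        rfl
      · ext x
        simp)
    rwa [orderOf_charDet_comp_equiv hη.1] at this

theorem Special.orderOf_det {χ : G → ℂ} (h : Special σ G χ) :
    IsPiNumber σ (orderOf (charDet χ)) := by
  have := h.det ⊤ .top (χ ∘ Subgroup.topEquiv) (h.irr.comp_mulEquiv _) (by
    have h1 := (h.irr.comp_mulEquiv (Subgroup.topEquiv (G := G))).ip_self
    intro h2
    exact one_ne_zero (h1.symm.trans h2))
  rwa [orderOf_charDet_comp_equiv h.irr.1] at this

theorem Special.of_comp_surjective {χ : G → ℂ} {f : H →* G} (hf : Function.Surjective f)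
    (hχ : IsCharacter G χ) (h : Special σ H (χ ∘ f)) : Special σ G χ := by
  refine ⟨(isIrrChar_comp_iff hf hχ).1 h.irr, ?_, fun M hM θ hθ hne => ?_⟩
  · simpa using h.degree
  · let g := f.subgroupComap M
    have hg : Function.Surjective g := f.subgroupComap_surjective_of_surjective M hf
    have := h.det (M.comap f) (hM.comap f) (θ ∘ g) ((isIrrChar_comp_iff hg hθ.1).2 hθ)
      (by rw [← ip_comp_of_surjective hg] at hne; exact hne)
    refine this.dvd (orderOf_dvd_of_pow_eq_one ?_)
    ext x
    obtain ⟨y, rfl⟩ := hg x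
    have h2 := DFunLike.congr_fun (pow_orderOf_eq_one (charDet (θ ∘ g))) y
    rw [MonoidHom.pow_apply] at h2 ⊢
    nth_rewrite 1 [charDet_comp hθ.1] at h2
    exact h2

variable {M : Subgroup G} [M.Normal]

theorem Special.restrict {χ : G → ℂ} (h : Special σ G χ) (hM : IsPiNumber σᶜ M.index) :
    Special σ M (χ ∘ M.subtype) := by
  obtain ⟨n, hn, hnσ⟩ := h.degree
  have h1 := h.irr.restrict_of_coprime (M := M) hn (hnσ.coprime hM)
  refine h.constituent M.subtype_injective (by rw [Subgroup.range_subtype]; infer_instance) h1 ?_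
  rw [h1.ip_self]
  exact one_ne_zero

theorem Special.eq_of_restrict {χ κ : G → ℂ} (h : Special σ G χ) (hκ : Special σ G κ)
    (hM : IsPiNumber σᶜ M.index) (he : χ ∘ M.subtype = κ ∘ M.subtype) : χ = κ := by
  obtain ⟨n, hn, hnσ⟩ := h.degree
  obtain ⟨m, hm, hmσ⟩ := hκ.degree
  have hk : (QuotientGroup.mk' M).ker = M := QuotientGroup.ker_mk' M
  refine h.irr.eq_of_restrict_ker (QuotientGroup.mk'_surjective M) hκ.irr ?_ ?_ hM hn hnσ
    h.orderOf_det hκ.orderOf_det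
  · refine hκ.irr.restrict_of_coprime hm ?_
    rw [hk]
    exact hmσ.coprime hM
  · intro k hk'
    rw [hk] at hk'
    exact congrFun he ⟨k, hk'⟩

theorem IsCharacter.ip_mul_eq_of_constituents {P Q : (G → ℂ) → Prop} {A B : G → ℂ}
    (hA : IsCharacter G A) (hB : IsCharacter G B)
    (hPA : ∀ θ, IsIrrChar G θ → ip A θ ≠ 0 → P θ) (hQB : ∀ θ, IsIrrChar G θ → ip B θ ≠ 0 → Q θ)
    {μ μ' : G → ℂ}
    (h : ∀ a b, P a → Q b → ip (μ * a) (μ' * b) = ip μ μ' * ip a b) :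
    ip (μ * A) (μ' * B) = ip μ μ' * ip A B := by
  revert hPA
  refine hA.induction_on (P := fun A => (∀ θ, IsIrrChar G θ → ip A θ ≠ 0 → P θ) →
    ip (μ * A) (μ' * B) = ip μ μ' * ip A B) (fun _ => by simp [ip_zero_left]) ?_
  intro a A ha hA ih hP
  have hPa : P a := hP a ha (by
    refine ha.1.ip_add_ne_zero hA ha.1 ?_
    rw [ha.ip_self]
    exact one_ne_zero)
  have hPA : ∀ θ, IsIrrChar G θ → ip A θ ≠ 0 → P θ := fun θ hθ hne => hP θ hθ (by
    rw [add_comm]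
    exact hA.ip_add_ne_zero ha.1 hθ.1 hne)
  have hB' : ip (μ * a) (μ' * B) = ip μ μ' * ip a B := by
    clear ih hPA hP
    revert hQB
    refine hB.induction_on (P := fun B => (∀ θ, IsIrrChar G θ → ip B θ ≠ 0 → Q θ) →
      ip (μ * a) (μ' * B) = ip μ μ' * ip a B) (fun _ => by simp [ip_zero_right]) ?_
    intro b B hb hB ih hQ
    have hQb : Q b := hQ b hb (by
      refine hb.1.ip_add_ne_zero hB hb.1 ?_
      rw [hb.ip_self]
      exact one_ne_zero)
    rw [mul_add, ip_add_right, ip_add_right, h a b hPa hQb, mul_add, ih fun θ hθ hne =>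
      hQ θ hθ (by rw [add_comm]; exact hB.ip_add_ne_zero hb.1 hθ.1 hne)]
  rw [mul_add, ip_add_left, ip_add_left, hB', ih hPA, mul_add]

theorem Special.constituents_subtype {ν : G → ℂ} (hν : Special σ G ν) (θ : M → ℂ)
    (hθ : IsIrrChar M θ) (hne : ip (ν ∘ M.subtype) θ ≠ 0) : Special σ M θ :=
  hν.constituent M.subtype_injective (by rw [Subgroup.range_subtype]; infer_instance) hθ hne

theorem ip_mul_one_add {μ ψ ν ν' : G → ℂ} (h : μ * dualFn μ = 1 + ψ) :
    ip (μ * ν) (μ * ν') = ip ν ν' + ip (ψ * (ν * dualFn ν')) 1 := by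
  rw [ip_eq_ip_one (μ * ν), ip_eq_ip_one ν]
  have h1 : μ * ν * dualFn (μ * ν') = ν * dualFn ν' + ψ * (ν * dualFn ν') := by
    have : dualFn (μ * ν') = dualFn μ * dualFn ν' := rfl
    rw [this, show μ * ν * (dualFn μ * dualFn ν') = μ * dualFn μ * (ν * dualFn ν') by ring, h]
    ring
  rw [h1, ip_add_left]

theorem IsIrrChar.exists_mul_dual {μ : G → ℂ} (h : IsIrrChar G μ) :
    ∃ ψ, IsCharacter G ψ ∧ μ * dualFn μ = 1 + ψ :=
  (h.1.mul h.1.dual).exists_eq_add isIrrChar_one (by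
    rw [← ip_eq_ip_one, h.ip_self]
    exact one_ne_zero)

/-- If multiplication by `μ` is isometric on the restrictions of `ν`, `ν'` then it is on
`ν`, `ν'`. -/
theorem ip_mul_of_restrict {μ ν ν' : G → ℂ} (hμ : IsIrrChar G μ) (hν : IsCharacter G ν)
    (hν' : IsCharacter G ν') (f : H →* G)
    (h : ip ((μ * ν) ∘ f) ((μ * ν') ∘ f) = ip (ν ∘ f) (ν' ∘ f)) :
    ip (μ * ν) (μ * ν') = ip ν ν' := by
  obtain ⟨ψ, hψ, he⟩ := hμ.exists_mul_dual
  rw [ip_mul_one_add he, (hψ.mul (hν.mul hν'.dual)).ip_one_eq_zero f, add_zero]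
  have he' : (μ ∘ f) * dualFn (μ ∘ f) = 1 + ψ ∘ f := by
    ext x
    have := congrFun he (f x)
    simpa [dualFn_apply] using this
  have h1 := ip_mul_one_add (ν := ν ∘ f) (ν' := ν' ∘ f) he'
  have h2 : (μ * ν) ∘ f = (μ ∘ f) * (ν ∘ f) := rfl
  have h3 : (μ * ν') ∘ f = (μ ∘ f) * (ν' ∘ f) := rfl
  rw [← h2, ← h3, h] at h1
  have h4 : (ψ ∘ f) * ((ν ∘ f) * dualFn (ν' ∘ f)) = (ψ * (ν * dualFn ν')) ∘ f := by
    ext x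
    simp [dualFn_apply]
  rw [h4] at h1
  exact (left_eq_add.1 h1)

theorem Special.ip_mul_mul_aux {μ μ' ν ν' : G → ℂ} (hμ : Special σ G μ) (hμ' : Special σ G μ')
    (hν : Special σᶜ G ν) (hν' : Special σᶜ G ν') (hM : IsPiNumber σᶜ M.index)
    (ih : ∀ a a' b b' : M → ℂ, Special σ M a → Special σ M a' → Special σᶜ M b →
      Special σᶜ M b' → ip (a * b) (a' * b') = ip a a' * ip b b') :
    ip (μ * ν) (μ' * ν') = ip μ μ' * ip ν ν' := by
  have hr := hμ.restrict hM
  have hr' := hμ'.restrict hM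
  have key : ip ((μ * ν) ∘ M.subtype) ((μ' * ν') ∘ M.subtype) =
      ip (μ ∘ M.subtype) (μ' ∘ M.subtype) * ip (ν ∘ M.subtype) (ν' ∘ M.subtype) :=
    (hν.irr.1.comp M.subtype).ip_mul_eq_of_constituents (hν'.irr.1.comp M.subtype)
      hν.constituents_subtype hν'.constituents_subtype fun a b ha hb => ih _ _ _ _ hr hr' ha hb
  by_cases he : μ = μ'
  · subst he
    rw [hμ.irr.ip_self, one_mul]
    refine ip_mul_of_restrict hμ.irr hν.irr.1 hν'.irr.1 M.subtype ?_
    rw [key, hr.irr.ip_self, one_mul]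
  · have hne : μ ∘ M.subtype ≠ μ' ∘ M.subtype := fun h => he (hμ.eq_of_restrict hμ' hM h)
    rw [hμ.irr.ip_of_ne hμ'.irr he, zero_mul, ip_eq_ip_one]
    refine ((hμ.irr.1.mul hν.irr.1).mul (hμ'.irr.1.mul hν'.irr.1).dual).ip_one_eq_zero M.subtype ?_
    rw [hr.irr.ip_of_ne hr'.irr hne, zero_mul, ip_eq_ip_one] at key
    exact key

end Special

/-- Products of `σ`-special and `σ'`-special characters behave like external products. -/
theorem Special.ip_mul_mul {σ : Set ℕ} {G : Type} [Group G] [Finite G] (hs : IsSep σ G)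
    {μ μ' ν ν' : G → ℂ} (hμ : Special σ G μ) (hμ' : Special σ G μ')
    (hν : Special σᶜ G ν) (hν' : Special σᶜ G ν') :
    ip (μ * ν) (μ' * ν') = ip μ μ' * ip ν ν' := by
  induction hn : Nat.card G using Nat.strong_induction_on generalizing G with
  | _ n ih =>
  subst hn
  rcases subsingleton_or_nontrivial G with hG | hG
  · have h1 : ∀ (τ : Set ℕ) (χ : G → ℂ), Special τ G χ → χ = 1 := by
      intro τ χ h
      obtain ⟨d, hd, _⟩ := h.irr.exists_degree_pos
      have h2 := h.irr.degree_dvd_card hd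
      rw [Nat.card_of_subsingleton (1 : G), Nat.dvd_one] at h2
      ext g
      rw [Subsingleton.elim g 1, hd, h2]
      simp
    rw [h1 _ _ hμ, h1 _ _ hμ', h1 _ _ hν, h1 _ _ hν', one_mul, (isIrrChar_one (G := G)).ip_self,
      one_mul]
  · obtain ⟨M, hMn, hlt, hi⟩ := hs.exists_normal_lt
    have hcard : Nat.card M < Nat.card G := by
      refine lt_of_le_of_ne (Subgroup.card_le_card_group M) fun h => hlt.ne ?_
      exact Subgroup.eq_top_of_card_eq M h
    have ih' : ∀ a a' b b' : M → ℂ, Special σ M a → Special σ M a' → Special σᶜ M b →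
        Special σᶜ M b' → ip (a * b) (a' * b') = ip a a' * ip b b' :=
      fun a a' b b' ha ha' hb hb' => ih _ hcard (hs.subgroup M) ha ha' hb hb' rfl
    rcases hi with hi | hi
    · rw [mul_comm μ, mul_comm μ', mul_comm (ip μ μ')]
      refine Special.ip_mul_mul_aux (σ := σᶜ) hν hν' (by rwa [compl_compl])
        (by rwa [compl_compl]) (by rwa [compl_compl]) fun a a' b b' ha ha' hb hb' => ?_
      rw [compl_compl] at hb hb'
      rw [mul_comm a, mul_comm a', mul_comm (ip a a')]
      exact ih' b b' a a' hb hb' ha ha'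
    · exact Special.ip_mul_mul_aux hμ hμ' hν hν' hi ih'

section PartialCharacters

variable {σ : Set ℕ} {G H : Type} [Group G] [Group H]

/-- `f` and `h` agree on the `σ`-elements of `G`. -/
def EqOnPi (σ : Set ℕ) (f h : G → ℂ) : Prop := ∀ g, IsPiElt σ g → f g = h g

theorem EqOnPi.rfl {f : G → ℂ} : EqOnPi σ f f := fun _ _ => Eq.refl _

theorem EqOnPi.trans {f h k : G → ℂ} (H : EqOnPi σ f h) (H' : EqOnPi σ h k) : EqOnPi σ f k :=
  fun g hg => (H g hg).trans (H' g hg)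

theorem EqOnPi.add {f h f' h' : G → ℂ} (H : EqOnPi σ f h) (H' : EqOnPi σ f' h') :
    EqOnPi σ (f + f') (h + h') := fun g hg => by
  rw [Pi.add_apply, Pi.add_apply, H g hg, H' g hg]

theorem EqOnPi.mul {f h f' h' : G → ℂ} (H : EqOnPi σ f h) (H' : EqOnPi σ f' h') :
    EqOnPi σ (f * f') (h * h') := fun g hg => by
  rw [Pi.mul_apply, Pi.mul_apply, H g hg, H' g hg]

theorem EqOnPi.apply_one {f h : G → ℂ} (H : EqOnPi σ f h) : f 1 = h 1 := H 1 isPiElt_one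

theorem EqOnPi.of_comp [Finite G] [Finite H] {f : H →* G} (hf : Function.Surjective f)
    {a b : G → ℂ} (h : EqOnPi σ (a ∘ f) (b ∘ f)) : EqOnPi σ a b := by
  intro g hg
  obtain ⟨y, rfl⟩ := hf g
  obtain ⟨y', hy', he, _⟩ := exists_piElt_lift f hg
  rw [← he]
  exact h y' hy'

theorem EqOnPi.comp {a b : G → ℂ} (h : EqOnPi σ a b) (f : H →* G) : EqOnPi σ (a ∘ f) (b ∘ f) := by
  intro x hx
  exact h (f x) (IsPiNumber.dvd hx (orderOf_map_dvd f x))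

theorem EqOnPi.push [Finite G] [Finite H] {f : H →* G} (hf : Function.Injective f)
    {a b : H → ℂ} (h : EqOnPi σ a b) : EqOnPi σ (push f a) (push f b) := by
  intro g hg
  let _ := Fintype.ofFinite G
  let _ := Fintype.ofFinite H
  rw [push_apply, push_apply]
  congr 1
  refine Finset.sum_congr (Eq.refl _) fun x _ => Finset.sum_congr (Eq.refl _) fun y _ => ?_
  split_ifs with hxy
  · refine h y ((isPiElt_map_iff hf).1 ?_)
    rw [hxy]
    exact hg.map (MulAut.conj x).toMonoidHom
  · exact Eq.refl _

variable [Finite G] [Finite H]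

theorem EqOnPi.of_supplement {O L : Subgroup G} [O.Normal] (hO : IsPiNumber σᶜ (Nat.card O))
    (hL : L ⊔ O = ⊤) {a b : G → ℂ} (ha : IsClassFn a) (hb : IsClassFn b)
    (h : EqOnPi σ (a ∘ L.subtype) (b ∘ L.subtype)) : EqOnPi σ a b := by
  intro g hg
  obtain ⟨y, _, l, hl, he⟩ := exists_conj_mem_of_sup hO hL hg
  rw [← ha y g, ← hb y g, he]
  exact h l hl

theorem IsCharacter.exists_extension_of_supplement {O L : Subgroup G} [O.Normal]
    (hL : L ⊔ O = ⊤) {γ : L → ℂ} (hγ : IsCharacter L γ) (ht : ∀ l : L, (l : G) ∈ O → γ l = γ 1) :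
    ∃ δ, IsCharacter G δ ∧ δ ∘ L.subtype = γ ∧ ∀ o ∈ O, δ o = δ 1 := by
  let f : L →* G ⧸ O := (QuotientGroup.mk' O).comp L.subtype
  have hf : Function.Surjective f := by
    intro q
    obtain ⟨g, rfl⟩ := QuotientGroup.mk'_surjective O q
    obtain ⟨l, hl, y, hy, hly⟩ := Subgroup.mem_sup_of_normal_right.1
      (show g ∈ L ⊔ O by rw [hL]; trivial)
    refine ⟨⟨l, hl⟩, ?_⟩
    rw [← hly, map_mul, show QuotientGroup.mk' O y = 1 from (QuotientGroup.eq_one_iff y).2 hy,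
      mul_one]
    exact Eq.refl _
  obtain ⟨γ', hγ', he⟩ := hγ.exists_descent hf fun k hk =>
    ht k ((QuotientGroup.eq_one_iff (k : G)).1 hk)
  refine ⟨γ' ∘ QuotientGroup.mk' O, hγ'.comp _, he.symm, fun o ho => ?_⟩
  simp only [Function.comp_apply]
  rw [show QuotientGroup.mk' O o = 1 from (QuotientGroup.eq_one_iff o).2 ho, map_one]

/-- `χ` is nonzero and its restriction to the `σ`-elements is not a sum of two partial
characters. -/
structure Indec (σ : Set ℕ) (χ : G → ℂ) : Prop where
  char : IsCharacter G χ
  ne_zero : χ ≠ 0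
  not_add : ∀ a b, IsCharacter G a → IsCharacter G b → a ≠ 0 → b ≠ 0 → ¬ EqOnPi σ χ (a + b)

omit [Finite G] in
theorem IsLiftOfPi.indec {χ φ : G → ℂ} (h : IsLiftOfPi σ G χ φ) (hφ : IsIPiChar σ G φ) :
    Indec σ χ := by
  refine ⟨h.1.1, h.1.2.1, fun a b ha hb ha0 hb0 he => hφ.2 ⟨piRestrict σ a, piRestrict σ b,
    ⟨a, ha, ha0, rfl⟩, ⟨b, hb, hb0, rfl⟩, ?_⟩⟩
  rw [← h.2]
  ext g
  by_cases hg : IsPiElt σ g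
  · simpa [piRestrict, hg] using he g hg
  · simp [piRestrict, hg]

theorem IsCharacter.push_ne_zero {f : H →* G} (hf : Function.Injective f) {a : H → ℂ}
    (ha : IsCharacter H a) (h0 : a ≠ 0) : _root_.push f a ≠ 0 := by
  intro h
  have h1 := congrFun h 1
  rw [push_one_of_injective hf] at h1
  refine h0 (ha.eq_zero_of_apply_one ?_)
  have h2 : (Nat.card G : ℂ) ≠ 0 := card_ne_zero'
  have h3 : (Nat.card H : ℂ) ≠ 0 := card_ne_zero'
  simpa [h2, h3] using h1

theorem Indec.of_push {f : H →* G} (hf : Function.Injective f) {ψ : H → ℂ}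
    (hψ : IsCharacter H ψ) (h : Indec σ (push f ψ)) : Indec σ ψ := by
  refine ⟨hψ, ?_, fun a b ha hb ha0 hb0 he => h.not_add (_root_.push f a) (_root_.push f b)
    (ha.push f) (hb.push f) (ha.push_ne_zero hf ha0) (hb.push_ne_zero hf hb0) ?_⟩
  · rintro rfl
    refine h.ne_zero ?_
    ext g
    let _ := Fintype.ofFinite G
    let _ := Fintype.ofFinite H
    simp [push_apply]
  · rw [← push_add]
    exact he.push hf

omit [Finite G] in
theorem Indec.of_mul {a b : G → ℂ} (ha : IsCharacter G a) (hb : IsCharacter G b)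
    (h : Indec σ (a * b)) : Indec σ b := by
  have ha0 : a ≠ 0 := by
    rintro rfl
    exact h.ne_zero (zero_mul _)
  have key : ∀ c, IsCharacter G c → c ≠ 0 → a * c ≠ 0 := by
    intro c hc hc0 h0
    have h1 : a 1 * c 1 = 0 := congrFun h0 1
    rcases mul_eq_zero.1 h1 with h2 | h2
    · exact ha0 (ha.eq_zero_of_apply_one h2)
    · exact hc0 (hc.eq_zero_of_apply_one h2)
  refine ⟨hb, ?_, fun c d hc hd hc0 hd0 he => h.not_add (a * c) (a * d) (ha.mul hc) (ha.mul hd)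
    (key c hc hc0) (key d hd hd0) ?_⟩
  · rintro rfl
    exact h.ne_zero (mul_zero _)
  · rw [← mul_add]
    exact EqOnPi.rfl.mul he

omit [Finite G] [Finite H] in
theorem Indec.of_comp {f : H →* G} (hf : Function.Surjective f) {χ : G → ℂ}
    (hχ : IsCharacter G χ) (h : Indec σ (χ ∘ f)) : Indec σ χ := by
  have key : ∀ a : G → ℂ, a ≠ 0 → a ∘ f ≠ 0 := by
    intro a ha h0
    refine ha (funext fun g => ?_)
    obtain ⟨y, rfl⟩ := hf g
    exact congrFun h0 y
  refine ⟨hχ, ?_, fun a b ha hb ha0 hb0 he => h.not_add (a ∘ f) (b ∘ f) (ha.comp f) (hb.comp f)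
    (key a ha0) (key b hb0) (he.comp f)⟩
  rintro rfl
  exact h.ne_zero (by ext; simp)

end PartialCharacters

section Cores

variable {σ : Set ℕ} {G : Type} [Group G] [Finite G]

omit [Finite G] in
theorem relIndex_comap_mk (O : Subgroup G) [O.Normal] (M : Subgroup (G ⧸ O)) :
    O.relIndex (M.comap (QuotientGroup.mk' O)) = Nat.card M := by
  have h := Subgroup.relIndex_ker (K := M.comap (QuotientGroup.mk' O)) (QuotientGroup.mk' O)
  rwa [QuotientGroup.ker_mk', Subgroup.map_comap_eq_self_of_surjective
    (QuotientGroup.mk'_surjective O)] at h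

omit [Finite G] in
theorem card_mul_relIndex {O Y : Subgroup G} (h : O ≤ Y) :
    Nat.card O * O.relIndex Y = Nat.card Y := by
  rw [← Subgroup.relIndex_bot_left, ← Subgroup.relIndex_bot_left]
  exact Subgroup.relIndex_mul_relIndex _ _ _ bot_le h

omit [Finite G] in
theorem le_comap_mk (O : Subgroup G) [O.Normal] (M : Subgroup (G ⧸ O)) :
    O ≤ M.comap (QuotientGroup.mk' O) := by
  conv_lhs => rw [← QuotientGroup.ker_mk' O]
  exact Subgroup.ker_le_comap _ _

/-- A normal `σ'`-by-central `σ`-subgroup contains a normal `σ'`-complement. -/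
theorem exists_normal_complement_of_central {E X : Subgroup G} [hX : X.Normal] (hE : E ≤ Subgroup.center G)
    (hEX : E ≤ X) (hEσ : IsPiNumber σ (Nat.card E)) (hi : IsPiNumber σᶜ (E.relIndex X)) :
    ∃ K : Subgroup G, K.Normal ∧ IsPiNumber σᶜ (Nat.card K) ∧ X ≤ K ⊔ E := by
  have hcard : Nat.card (E.subgroupOf X) = Nat.card E :=
    Nat.card_congr (Subgroup.subgroupOfEquivOfLe hEX).toEquiv
  have hEn : E.Normal := ⟨fun e he g => by
    rw [(Subgroup.mem_center_iff.1 (hE he) g), mul_inv_cancel_right]; exact he⟩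
  obtain ⟨H, hH⟩ := Subgroup.exists_right_complement'_of_coprime (N := E.subgroupOf X)
    (by rw [hcard]; exact hEσ.coprime hi)
  have hHσ : IsPiNumber σᶜ (Nat.card H) := by
    have h1 := hH.card_mul_card
    have h2 := (E.subgroupOf X).card_mul_index
    have h3 : Nat.card (E.subgroupOf X) ≠ 0 := Nat.card_pos.ne'
    rw [← h2] at h1
    rw [mul_left_cancel₀ h3 h1]
    exact hi
  have hdec : ∀ x ∈ X, ∃ e ∈ E, ∃ h ∈ H, x = e * (h : G) := by
    intro x hx
    obtain ⟨⟨e, h⟩, he⟩ := hH.2 ⟨x, hx⟩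
    exact ⟨e.1, e.2, h.1, h.2, (congrArg Subtype.val he).symm⟩
  have hmapcard : Nat.card (H.map X.subtype) = Nat.card H :=
    Nat.card_congr (H.equivMapOfInjective _ X.subtype_injective).toEquiv.symm
  refine ⟨H.map X.subtype, ⟨?_⟩, by rwa [hmapcard], ?_⟩
  · rintro _ ⟨h, hh, rfl⟩ g
    obtain ⟨e, he, h', hh', heq⟩ := hdec (g * X.subtype h * g⁻¹) (hX.conj_mem _ h.2 g)
    have hc : Commute (h' : G) e := Subgroup.mem_center_iff.1 (hE he) h'
    have h1 : e = (g * X.subtype h * g⁻¹) * (h' : G)⁻¹ := by rw [heq, mul_inv_cancel_right]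
    have hpi : ∀ k ∈ H, IsPiElt σᶜ (k : G) := fun k hk =>
      (isPiElt_of_card hHσ ⟨k, hk⟩).map (X.subtype.comp H.subtype)
    have h2 : IsPiElt σᶜ e := by
      rw [h1]
      have hc' : Commute (g * X.subtype h * g⁻¹) (h' : G)⁻¹ := by
        rw [heq]
        exact (hc.symm.mul_left (Commute.refl _)).inv_right
      refine IsPiNumber.dvd (IsPiNumber.mul ?_ ?_) hc'.orderOf_mul_dvd_mul_orderOf
      · exact (hpi h hh).map (MulAut.conj g).toMonoidHom
      · rw [orderOf_inv]
        exact hpi h' hh'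
    have h3 : e = 1 := IsPiElt.eq_one (isPiElt_of_mem hEσ he) h2
    rw [heq, h3, one_mul]
    exact ⟨h', hh', rfl⟩
  · intro x hx
    obtain ⟨e, he, h, hh, rfl⟩ := hdec x hx
    exact mul_mem ((le_sup_right : E ≤ _) he) ((le_sup_left : H.map X.subtype ≤ _) ⟨h, hh, rfl⟩)

/-- In a `σ`-separable group whose largest normal `σ'`-subgroup is nontrivial without a proper
supplement there is a noncentral normal `σ`-subgroup. -/
theorem exists_normal_not_le_center (hs : IsSep σ G) {O : Subgroup G} [hOn : O.Normal]
    (hOσ : IsPiNumber σᶜ (Nat.card O))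
    (hmax : ∀ N : Subgroup G, N.Normal → IsPiNumber σᶜ (Nat.card N) → N ≤ O)
    (hsup : ∀ L : Subgroup G, O ⊔ L = ⊤ → L = ⊤) (hO1 : O ≠ ⊥) :
    ∃ E : Subgroup G, E.Normal ∧ IsPiNumber σ (Nat.card E) ∧ ¬ E ≤ Subgroup.center G := by
  obtain ⟨Q, hQ, hQσ, hQmax⟩ := exists_piCore σ (G ⧸ O)
  let Y := Q.comap (QuotientGroup.mk' O)
  have hOY : O ≤ Y := le_comap_mk O Q
  obtain ⟨E, hE, hEσ, hEY⟩ := exists_normal_of_no_supplement (Y := Y) hOY hOσ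
    (by rw [relIndex_comap_mk]; exact hQσ) hsup
  refine ⟨E, hE, hEσ, fun hcen => hO1 ?_⟩
  by_cases hQt : Q = ⊤
  · have h1 : E = ⊤ := hsup E (by rw [hEY]; simp [Y, hQt])
    rw [← Subgroup.card_eq_one]
    exact (hEσ.dvd (Subgroup.card_dvd_of_le (by rw [h1]; exact le_top))).eq_one hOσ
  · have hnt : Nontrivial ((G ⧸ O) ⧸ Q) := QuotientGroup.nontrivial_iff.2 hQt
    obtain ⟨M, hM, hM1, hMσ⟩ := ((hs.quotient O).quotient Q).exists_normal_ne_bot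
    let X' := M.comap (QuotientGroup.mk' Q)
    have hX'r : Q.relIndex X' = Nat.card M := relIndex_comap_mk Q M
    have hQX' : Q ≤ X' := le_comap_mk Q M
    have hX'Q : ¬ X' ≤ Q := fun h => hM1 (by
      rw [← Subgroup.card_eq_one, ← hX'r]
      exact Subgroup.relIndex_eq_one.2 h)
    rcases hMσ with hMσ | hMσ
    · exact absurd (hQmax X' inferInstance (by
        rw [← card_mul_relIndex hQX', hX'r]
        exact hQσ.mul hMσ)) hX'Q
    · let X := X'.comap (QuotientGroup.mk' O)
      have hYX : Y ≤ X := Subgroup.comap_mono hQX'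
      have hYXr : Y.relIndex X = Nat.card M := by
        rw [Subgroup.relIndex_comap,
          Subgroup.map_comap_eq_self_of_surjective (QuotientGroup.mk'_surjective O), hX'r]
      have hEX : E ≤ X := le_trans (by rw [← hEY]; exact le_sup_right) hYX
      have hr : IsPiNumber σᶜ (E.relIndex X) := by
        rw [← Subgroup.relIndex_mul_relIndex E Y X (by rw [← hEY]; exact le_sup_right) hYX, hYXr]
        refine IsPiNumber.mul ?_ hMσ
        rw [← hEY, Subgroup.relIndex_sup_right]
        exact hOσ.dvd (Subgroup.relIndex_dvd_card _ _)
      obtain ⟨K, hK, hKσ, hXK⟩ := exists_normal_complement_of_central hcen hEX hEσ hr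
      have hXY : X ≤ Y := hXK.trans (by rw [← hEY]; exact sup_le_sup_right (hmax K hK hKσ) E)
      exact absurd ((Subgroup.comap_le_comap_of_surjective
        (QuotientGroup.mk'_surjective O)).1 hXY) hX'Q

end Cores

section FongSwan

variable {σ : Set ℕ} {G : Type} [Group G] [Finite G]

/-- Every character of `G` agrees on `σ`-elements with a character having all normal
`σ'`-subgroups in its kernel. -/
def HasTrivialLifts (σ : Set ℕ) (G : Type) [Group G] : Prop :=
  ∀ χ : G → ℂ, IsCharacter G χ → ∃ γ, IsCharacter G γ ∧ EqOnPi σ χ γ ∧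
    ∀ N : Subgroup G, N.Normal → IsPiNumber σᶜ (Nat.card N) → ∀ n ∈ N, γ n = γ 1

omit [Finite G] in
theorem conj_commute_of_disjoint {O E : Subgroup G} [hO : O.Normal] [hE : E.Normal]
    (h : Disjoint O E) : O ≤ Subgroup.centralizer (E : Set G) := by
  intro o ho
  rw [Subgroup.mem_centralizer_iff]
  intro e he
  exact ((Subgroup.commute_of_normal_of_disjoint O E hO hE h o e ho he).eq).symm

omit [Finite G] in
theorem disjoint_of_isPiNumber {O E : Subgroup G} (hO : IsPiNumber σᶜ (Nat.card O))
    (hE : IsPiNumber σ (Nat.card E)) : Disjoint O E :=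
  Subgroup.disjoint_of_coprime_natCard (hO.coprime' hE)

theorem index_center_subgroup_le (L : Subgroup G) :
    (Subgroup.center L).index ≤ (Subgroup.center G).index := by
  have h1 : (Subgroup.center G).subgroupOf L ≤ Subgroup.center L := by
    intro x hx
    rw [Subgroup.mem_center_iff]
    intro y
    ext
    exact Subgroup.mem_center_iff.1 (Subgroup.mem_subgroupOf.1 hx) y
  exact (Nat.le_of_dvd (Nat.pos_of_ne_zero Subgroup.index_ne_zero_of_finite)
    (Subgroup.index_dvd_of_le h1)).trans
    (Nat.le_of_dvd (Nat.pos_of_ne_zero Subgroup.index_ne_zero_of_finite)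
      (Subgroup.relIndex_dvd_index_of_normal _ _))

/-- The reduction of `HasTrivialLifts` for an irreducible character over an invariant character of
a noncentral normal `σ`-subgroup. -/
theorem exists_trivial_lift_of_invariant (hs : IsSep σ G) {O E : Subgroup G} [hOn : O.Normal]
    [hEn : E.Normal] (hOσ : IsPiNumber σᶜ (Nat.card O)) (hEσ : IsPiNumber σ (Nat.card E))
    (hE : ¬ E ≤ Subgroup.center G)
    (ih : ∀ (Λ : Type) [Group Λ] [Finite Λ], IsSep σ Λ →
      (Subgroup.center Λ).index < (Subgroup.center G).index → HasTrivialLifts σ Λ)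
    {χ : G → ℂ} (hχ : IsIrrChar G χ) {θ : E → ℂ} (hθ : IsIrrChar E θ)
    (hne : ip (χ ∘ E.subtype) θ ≠ 0) (hinv : ∀ g, conjFn E g θ = θ) :
    ∃ γ, IsCharacter G γ ∧ EqOnPi σ χ γ ∧ ∀ o ∈ O, γ o = γ 1 := by
  obtain ⟨Γ, _, _, p, i, s, κ, hp, hi, hpi, hps, hκ, hκi, hκs, hZ, hZe, hsc⟩ :=
    exists_linearization E hθ hinv
  have hpi' : ∀ e, p (i e) = e := fun e => DFunLike.congr_fun hpi e
  have hps' : ∀ c, p (s c) = c := fun c => DFunLike.congr_fun hps c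
  have hii : Function.Injective i := fun a b hab => by
    have := congrArg p hab
    rw [hpi', hpi'] at this
    exact Subtype.ext this
  let q := QuotientGroup.mk' i.range
  have hq : Function.Surjective q := QuotientGroup.mk'_surjective _
  have hqk : q.ker = i.range := QuotientGroup.ker_mk' _
  have hZσ : IsPiNumber σ (Nat.card p.ker) := isPiNumber_card fun z => by
    refine isPiElt_of_pow_eq_one (n := Nat.card E * Nat.card E) (hEσ.mul hEσ) ?_
    ext
    exact hZe z z.2
  have hsΓ : IsSep σ Γ := hs.of_ker p hp hZσ
  have hsΛ : IsSep σ (Γ ⧸ i.range) := hsΓ.quotient _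
  have hOE : O ≤ Subgroup.centralizer (E : Set G) :=
    conj_commute_of_disjoint (disjoint_of_isPiNumber hOσ hEσ)
  have hcen : (Subgroup.center (Γ ⧸ i.range)).index < (Subgroup.center G).index := by
    have h1 : (Subgroup.center G ⊔ E).comap p ≤ (Subgroup.center (Γ ⧸ i.range)).comap q := by
      intro x hx
      obtain ⟨z, hz, e, he, hze⟩ := Subgroup.mem_sup_of_normal_right.1 hx
      have hzc : z ∈ Subgroup.centralizer (E : Set G) :=
        Subgroup.center_le_centralizer (E : Set G) hz
      let w := x * (i ⟨e, he⟩)⁻¹ * (s ⟨z, hzc⟩)⁻¹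
      have hw : w ∈ p.ker := by
        rw [MonoidHom.mem_ker]
        simp only [w, map_mul, map_inv, hpi', hps', ← hze]
        group
      have hxw : x = w * s ⟨z, hzc⟩ * i ⟨e, he⟩ := by simp only [w]; group
      have hqx : q x = q (w * s ⟨z, hzc⟩) := by
        rw [hxw, map_mul q _ (i _), show q (i ⟨e, he⟩) = 1 from by
          rw [← MonoidHom.mem_ker, hqk]; exact ⟨_, rfl⟩, mul_one]
      rw [Subgroup.mem_comap, hqx, Subgroup.mem_center_iff]
      intro y
      obtain ⟨y, rfl⟩ := hq y
      rw [← map_mul, ← map_mul]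
      congr 1
      have hsz : y * s ⟨z, hzc⟩ = s ⟨z, hzc⟩ * y := by
        have := hsc y ⟨z, hzc⟩ ⟨z, hzc⟩ (by
          rw [Subgroup.mem_center_iff.1 hz (p y), mul_inv_cancel_right])
        exact mul_inv_eq_iff_eq_mul.1 this
      calc y * (w * s ⟨z, hzc⟩) = (y * w) * s ⟨z, hzc⟩ := (mul_assoc _ _ _).symm
        _ = w * (y * s ⟨z, hzc⟩) := by rw [← hZ w hw y, mul_assoc]
        _ = w * s ⟨z, hzc⟩ * y := by
          rw [hsz]
          exact (mul_assoc _ _ _).symm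
    have h2 := Subgroup.index_dvd_of_le h1
    rw [Subgroup.index_comap_of_surjective _ hp, Subgroup.index_comap_of_surjective _ hq] at h2
    refine lt_of_le_of_lt (Nat.le_of_dvd
      (Nat.pos_of_ne_zero Subgroup.index_ne_zero_of_finite) h2) ?_
    refine Subgroup.index_strictAnti ?_
    exact lt_of_le_of_ne le_sup_left fun h => hE (by rw [h]; exact le_sup_right)
  have hχE := hχ.eq_smul_of_invariant hθ hne hinv
  let e := ip (χ ∘ E.subtype) θ
  have hχp : IsIrrChar Γ (χ ∘ p) := (isIrrChar_comp_iff hp hχ.1).2 hχ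
  have hiκ : IsIrrChar q.ker (κ ∘ q.ker.subtype) := by
    let f : E →* q.ker := i.codRestrict q.ker fun x => by rw [hqk]; exact ⟨x, rfl⟩
    have hf : Function.Surjective f := by
      rintro ⟨y, hy⟩
      rw [hqk] at hy
      obtain ⟨x, rfl⟩ := hy
      exact ⟨x, rfl⟩
    refine (isIrrChar_comp_iff hf (hκ.comp _)).1 ?_
    have : (κ ∘ q.ker.subtype) ∘ f = θ := hκi
    rwa [this]
  obtain ⟨ρ, hρ, hχρ, -⟩ := IsIrrChar.exists_eq_mul_inflated hq hχp hκ hiκ (e := e) (by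
    intro k hk
    rw [hqk] at hk
    obtain ⟨x, rfl⟩ := hk
    have h1 : χ x = e * θ x := congrFun hχE x
    have h2 : κ (i x) = θ x := congrFun hκi x
    rw [Function.comp_apply, hpi', h1, h2])
  obtain ⟨γ₁, hγ₁, hργ, htriv⟩ := ih _ hsΛ hcen ρ hρ.1
  let γ' := κ * (γ₁ ∘ q)
  have hγ' : IsCharacter Γ γ' := hκ.mul (hγ₁.comp q)
  have heq : EqOnPi σ (χ ∘ p) γ' := by
    rw [hχρ]
    exact EqOnPi.rfl.mul (hργ.comp q)
  obtain ⟨γ, hγ, hγp⟩ := hγ'.exists_descent hp fun z hz => by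
    rw [← heq z (isPiElt_of_mem hZσ hz), ← heq 1 isPiElt_one, Function.comp_apply,
      Function.comp_apply, MonoidHom.mem_ker.1 hz, map_one]
  refine ⟨γ, hγ, EqOnPi.of_comp hp (by rw [← hγp]; exact heq), fun o ho => ?_⟩
  let S : Subgroup (Γ ⧸ i.range) := (O.subgroupOf (Subgroup.centralizer (E : Set G))).map (q.comp s)
  have hSn : S.Normal := by
    constructor
    rintro _ ⟨c, hc, rfl⟩ y
    obtain ⟨y, rfl⟩ := hq y
    let c' : Subgroup.centralizer (E : Set G) :=
      ⟨p y * c * (p y)⁻¹, hOE (hOn.conj_mem _ hc _)⟩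
    refine ⟨c', hOn.conj_mem _ hc _, ?_⟩
    rw [MonoidHom.comp_apply, ← hsc y c c' rfl]
    simp
  have hSσ : IsPiNumber σᶜ (Nat.card S) := by
    refine hOσ.dvd ((Subgroup.card_map_dvd _ _).trans ?_)
    rw [Nat.card_congr (Subgroup.subgroupOfEquivOfLe hOE).toEquiv]
  have h1 : ∀ y, γ (p y) = κ y * γ₁ (q y) := fun y => (congrFun hγp y).symm
  have h2 := h1 (s ⟨o, hOE ho⟩)
  have h3 := h1 1
  have h4 : κ (s ⟨o, hOE ho⟩) = κ 1 := by simpa using hκs ⟨o, hOE ho⟩ 1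
  rw [map_one, map_one] at h3
  have h5 : γ₁ (q (s ⟨o, hOE ho⟩)) = γ₁ 1 := htriv S hSn hSσ _ ⟨⟨o, hOE ho⟩, ho, rfl⟩
  rw [hps', h4, h5] at h2
  rw [h3]
  exact h2

/-- A version of the Fong–Swan theorem for `σ`-separable groups. -/
theorem IsSep.hasTrivialLifts (hs : IsSep σ G) : HasTrivialLifts σ G := by
  suffices H : ∀ (m : ℕ ×ₗ ℕ) (G : Type) [Group G] [Finite G], IsSep σ G →
      toLex ((Subgroup.center G).index, Nat.card G) = m → HasTrivialLifts σ G from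
    H _ G hs rfl
  intro m
  induction m using WellFoundedLT.induction with
  | _ m ih =>
  intro G _ _ hs hm
  subst hm
  have ih1 : ∀ (Λ : Type) [Group Λ] [Finite Λ], IsSep σ Λ →
      (Subgroup.center Λ).index < (Subgroup.center G).index → HasTrivialLifts σ Λ :=
    fun Λ _ _ hΛ hlt => ih _ (Prod.Lex.toLex_lt_toLex.2 (Or.inl hlt)) Λ hΛ rfl
  have ih2 : ∀ L : Subgroup G, L ≠ ⊤ → HasTrivialLifts σ L := by
    intro L hL
    have hc : Nat.card L < Nat.card G := by
      refine lt_of_le_of_ne (Nat.le_of_dvd Nat.card_pos (Subgroup.card_subgroup_dvd_card L)) ?_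
      exact fun h => hL (Subgroup.eq_top_of_card_eq L h)
    refine ih _ ?_ L (hs.subgroup L) rfl
    rw [Prod.Lex.toLex_lt_toLex]
    rcases (index_center_subgroup_le L).lt_or_eq with h | h
    · exact Or.inl h
    · exact Or.inr ⟨h, hc⟩
  obtain ⟨O, hO, hOσ, hmax⟩ := exists_piCore σᶜ G
  suffices H : ∀ χ, IsIrrChar G χ →
      ∃ γ, IsCharacter G γ ∧ EqOnPi σ χ γ ∧ ∀ o ∈ O, γ o = γ 1 by
    suffices H' : ∀ χ, IsCharacter G χ →
        ∃ γ, IsCharacter G γ ∧ EqOnPi σ χ γ ∧ ∀ o ∈ O, γ o = γ 1 by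
      intro χ hχ
      obtain ⟨γ, h1, h2, h3⟩ := H' χ hχ
      exact ⟨γ, h1, h2, fun N hN hNσ n hn => h3 n (hmax N hN hNσ hn)⟩
    intro χ hχ
    refine hχ.induction_on (P := fun χ => ∃ γ, IsCharacter G γ ∧ EqOnPi σ χ γ ∧
      ∀ o ∈ O, γ o = γ 1) ⟨0, IsCharacter.zero, EqOnPi.rfl, fun _ _ => rfl⟩ ?_
    rintro θ ψ hθ hψ ⟨γ, h1, h2, h3⟩
    obtain ⟨δ, h4, h5, h6⟩ := H θ hθ
    refine ⟨δ + γ, h4.add h1, h5.add h2, fun o ho => ?_⟩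
    rw [Pi.add_apply, Pi.add_apply, h3 o ho, h6 o ho]
  intro χ hχ
  by_cases hsup : ∃ L : Subgroup G, O ⊔ L = ⊤ ∧ L ≠ ⊤
  · obtain ⟨L, hLO, hL⟩ := hsup
    rw [sup_comm] at hLO
    obtain ⟨γ, h1, h2, h3⟩ := ih2 L hL _ (hχ.1.comp L.subtype)
    obtain ⟨δ, h4, h5, h6⟩ := h1.exists_extension_of_supplement hLO fun l hl =>
      h3 (O.subgroupOf L) inferInstance (hOσ.dvd
        (Subgroup.card_comap_dvd_of_injective O L.subtype L.subtype_injective)) l hl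
    exact ⟨δ, h4, EqOnPi.of_supplement hOσ hLO hχ.1.isClassFn h4.isClassFn (by rwa [h5]), h6⟩
  push Not at hsup
  by_cases hO1 : O = ⊥
  · refine ⟨χ, hχ.1, EqOnPi.rfl, fun o ho => ?_⟩
    rw [hO1, Subgroup.mem_bot] at ho
    rw [ho]
  obtain ⟨E, hE, hEσ, hEc⟩ := exists_normal_not_le_center hs hOσ hmax hsup hO1
  obtain ⟨θ, hθ, hne⟩ := hχ.1.exists_irr_comp hχ.2.1 E.subtype
  by_cases hinv : ∀ g, conjFn E g θ = θ
  · exact exists_trivial_lift_of_invariant hs hOσ hEσ hEc ih1 hχ hθ hne hinv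
  · push Not at hinv
    obtain ⟨g, hg⟩ := hinv
    have hT : stab E θ ≠ ⊤ := fun h => hg (mem_stab.1 (by rw [h]; trivial))
    obtain ⟨ζ, hζ, hζχ, -⟩ := hχ.exists_clifford hθ hne
    obtain ⟨γ, h1, h2, h3⟩ := ih2 _ hT ζ hζ.1
    have hOE : O ≤ Subgroup.centralizer (E : Set G) :=
      conj_commute_of_disjoint (disjoint_of_isPiNumber hOσ hEσ)
    have hOT : O ≤ stab E θ := by
      intro o ho
      rw [mem_stab]
      ext x
      rw [conjFn_apply]
      congr 1
      ext
      change o * (x : G) * o⁻¹ = x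
      rw [← Subgroup.mem_centralizer_iff.1 (hOE ho) x x.2, mul_inv_cancel_right]
    refine ⟨push (stab E θ).subtype γ, h1.push _, ?_, fun o ho => ?_⟩
    · rw [hζχ]
      exact h2.push (Subgroup.subtype_injective _)
    · let _ := Fintype.ofFinite G
      have h4 := push_subtype_apply_of_normal hOT γ
      rw [h4 ⟨o, ho⟩, ← O.coe_one, h4 1]
      congr 1
      refine Finset.sum_congr rfl fun x _ => ?_
      have h5 : ∀ o : O, γ ⟨o, hOT o.2⟩ = γ 1 := fun o =>
        h3 (O.subgroupOf (stab E θ)) inferInstance (by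
          rwa [Nat.card_congr (Subgroup.subgroupOfEquivOfLe hOT).toEquiv]) ⟨o, hOT o.2⟩ o.2
      rw [h5 ⟨x * o * x⁻¹, hO.conj_mem _ ho x⟩, h5 ⟨x * (1 : O) * x⁻¹, hO.conj_mem _ (one_mem O) x⟩]

end FongSwan

/-- Automorphisms of a subfield of `ℂ` extend to `ℂ`. -/
theorem exists_ringHom_extension {K : Type} [Field K] (i : K →+* ℂ) (s : K ≃+* K) :
    ∃ τ : ℂ →+* ℂ, ∀ x, τ (i x) = i (s x) := by
  let _ : Algebra K ℂ := i.toAlgebra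
  obtain ⟨ι, v, hv⟩ := exists_isTranscendenceBasis' K ℂ
  have : IsAlgClosure (Algebra.adjoin K (Set.range v)) ℂ :=
    IsAlgClosed.isAlgClosure_of_transcendence_basis v hv
  let e : Algebra.adjoin K (Set.range v) ≃+* Algebra.adjoin K (Set.range v) :=
    (hv.1.aevalEquiv.symm.toRingEquiv.trans (MvPolynomial.mapEquiv ι s)).trans
      hv.1.aevalEquiv.toRingEquiv
  refine ⟨(IsAlgClosure.equivOfEquiv ℂ ℂ e).toRingHom, fun x => ?_⟩
  have h1 := IsAlgClosure.equivOfEquiv_algebraMap (L := ℂ) (M := ℂ) e (algebraMap K _ x)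
  have h2 : e (algebraMap K _ x) = algebraMap K _ (s x) := by
    simp only [e, RingEquiv.trans_apply]
    have : hv.1.aevalEquiv.symm.toRingEquiv (algebraMap K _ x) = MvPolynomial.C x :=
      hv.1.aevalEquiv.symm.commutes x
    rw [this]
    have h3 : (MvPolynomial.mapEquiv ι s) (MvPolynomial.C x) = MvPolynomial.C (s x) :=
      MvPolynomial.map_C _ _
    rw [h3]
    exact hv.1.aevalEquiv.commutes (s x)
  rw [h2] at h1
  exact h1

theorem exists_galois {n q : ℕ} (hn : n ≠ 0) (hq : q ≠ 0) (h : n.Coprime q) :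
    ∃ τ : ℂ →+* ℂ, (∀ z : ℂ, z ^ n = 1 → τ z = z) ∧ ∀ z : ℂ, z ^ q = 1 → τ z * z = 1 := by
  have : NeZero (n * q) := ⟨mul_ne_zero hn hq⟩
  obtain ⟨a, ha1, ha2⟩ := Nat.chineseRemainder h 1 (q - 1)
  have ha3 : q ∣ a + 1 := by
    have h4 : a + 1 ≡ q - 1 + 1 [MOD q] := ha2.add_right 1
    rw [Nat.sub_add_cancel (Nat.pos_of_ne_zero hq)] at h4
    exact (Nat.modEq_zero_iff_dvd.1 (h4.trans (by simp [Nat.ModEq])))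
  have hcop : a.Coprime (n * q) := by
    refine Nat.Coprime.mul_right ?_ ?_
    · have := ha1.gcd_eq
      rwa [Nat.gcd_one_left] at this
    · obtain ⟨k, hk⟩ := ha3
      rw [Nat.coprime_iff_gcd_eq_one]
      refine Nat.dvd_one.1 ?_
      have h5 : a.gcd q ∣ a + 1 := hk ▸ (Nat.gcd_dvd_right a q).mul_right k
      exact (Nat.dvd_add_right (Nat.gcd_dvd_left a q)).1 h5
  obtain ⟨K, _, _, _⟩ : ∃ (K : Type) (_ : Field K) (_ : Algebra ℚ K),
      IsCyclotomicExtension {n * q} ℚ K :=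
    ⟨CyclotomicField (n * q) ℚ, inferInstance, inferInstance,
      CyclotomicField.isCyclotomicExtension (n * q) ℚ⟩
  have : Algebra.IsAlgebraic ℚ K := by
    have := IsCyclotomicExtension.integral {n * q} ℚ K
    infer_instance
  let i : K →+* ℂ := (IsAlgClosed.lift (R := ℚ) (S := K) (M := ℂ)).toRingHom
  have hz := IsCyclotomicExtension.zeta_spec (n * q) ℚ K
  obtain ⟨τ, hτ⟩ := exists_ringHom_extension i
    (IsCyclotomicExtension.fromZetaAut (hz.pow_of_coprime a hcop)
      (Polynomial.cyclotomic.irreducible_rat (NeZero.pos _))).toRingEquiv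
  have h0 := IsCyclotomicExtension.fromZetaAut_spec (hz.pow_of_coprime a hcop)
      (Polynomial.cyclotomic.irreducible_rat (NeZero.pos _))
  have hzi := hz.map_of_injective i.injective
  have h1 : τ (i (IsCyclotomicExtension.zeta (n * q) ℚ K)) =
      i (IsCyclotomicExtension.zeta (n * q) ℚ K) ^ a := by
    rw [hτ, ← map_pow]
    exact congrArg i h0
  have key : ∀ z : ℂ, z ^ (n * q) = 1 → τ z = z ^ a := by
    intro z hz'
    obtain ⟨k, -, rfl⟩ := hzi.eq_pow_of_pow_eq_one hz'
    rw [map_pow, h1, ← pow_mul, ← pow_mul, mul_comm a k]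
  refine ⟨τ, fun z hz' => ?_, fun z hz' => ?_⟩
  · rw [key z (by rw [pow_mul, hz', one_pow])]
    rw [← pow_one z, ← pow_mul, one_mul]
    exact pow_eq_pow_of_modEq ha1 hz'
  · rw [key z (by rw [mul_comm, pow_mul, hz', one_pow]), ← pow_succ]
    obtain ⟨k, hk⟩ := ha3
    rw [hk, pow_mul, hz', one_pow]

section Galois

variable {G : Type} [Group G]

theorem IsCharacter.exists_galois {χ : G → ℂ} (h : IsCharacter G χ) (τ : ℂ →+* ℂ) :
    ∃ (n : ℕ) (ρ : Representation ℂ G (Fin n → ℂ)) (ρ' : Representation ℂ G (Fin n → ℂ)),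
      χ = ρ.character ∧ τ ∘ χ = ρ'.character ∧
      ∀ g, LinearMap.det (ρ' g) = τ (LinearMap.det (ρ g)) := by
  obtain ⟨V, _, _, _, ρ, rfl⟩ := h.exists_representation
  let b := Module.finBasis ℂ V
  let M : G →* Matrix (Fin (Module.finrank ℂ V)) (Fin (Module.finrank ℂ V)) ℂ :=
    (LinearMap.toMatrixAlgEquiv b).toAlgHom.toRingHom.toMonoidHom.comp ρ
  let F : Matrix (Fin (Module.finrank ℂ V)) (Fin (Module.finrank ℂ V)) ℂ →* _ :=
    (Matrix.toLinAlgEquiv' (R := ℂ)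
      (n := Fin (Module.finrank ℂ V))).toAlgHom.toRingHom.toMonoidHom
  refine ⟨_, F.comp M, F.comp ((RingHom.mapMatrix τ).toMonoidHom.comp M), ?_, ?_, fun g => ?_⟩
  · ext g
    have h1 : LinearMap.trace ℂ _ (Matrix.toLin' (LinearMap.toMatrix b b (ρ g))) =
      LinearMap.trace ℂ _ (ρ g) := by
      rw [Matrix.trace_toLin'_eq, LinearMap.trace_eq_matrix_trace ℂ b]
    exact h1.symm
  · ext g
    have h1 : LinearMap.trace ℂ _ (Matrix.toLin' ((LinearMap.toMatrix b b (ρ g)).map τ)) =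
      τ (LinearMap.trace ℂ _ (ρ g)) := by
      rw [Matrix.trace_toLin'_eq, LinearMap.trace_eq_matrix_trace ℂ b]
      exact (AddMonoidHom.map_trace τ.toAddMonoidHom _).symm
    exact h1.symm
  · have h1 : LinearMap.det (Matrix.toLin' ((LinearMap.toMatrix b b (ρ g)).map τ)) =
      τ (LinearMap.det (Matrix.toLin' (LinearMap.toMatrix b b (ρ g)))) := by
      rw [LinearMap.det_toLin', LinearMap.det_toLin']
      exact (RingHom.map_det τ _).symm
    exact h1

variable [Finite G]

theorem IsIrrChar.galois {χ : G → ℂ} (h : IsIrrChar G χ) (τ : ℂ →+* ℂ) :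
    IsIrrChar G (τ ∘ χ) := by
  obtain ⟨n, ρ, ρ', -, h2, -⟩ := h.1.exists_galois τ
  refine IsCharacter.isIrrChar_of_ip_self (h2 ▸ isCharacter_of_representation _) ?_
  let _ := Fintype.ofFinite G
  have h3 := congrArg τ h.ip_self
  rw [ip_eq] at h3 ⊢
  simpa using h3

theorem IsCharacter.charDet_galois {χ : G → ℂ} (h : IsCharacter G χ) (τ : ℂ →+* ℂ) (g : G) :
    charDet (τ ∘ χ) g = τ (charDet χ g) := by
  obtain ⟨n, ρ, ρ', h1, h2, h3⟩ := h.exists_galois τ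
  rw [h2, h1, charDet_character, charDet_character]
  exact h3 g

theorem IsCharacter.orderOf_charDet_galois {χ : G → ℂ} (h : IsCharacter G χ) (τ : ℂ →+* ℂ) :
    orderOf (charDet (τ ∘ χ)) = orderOf (charDet χ) := by
  refine orderOf_eq_orderOf_iff.2 fun n => ?_
  simp only [DFunLike.ext_iff, MonoidHom.pow_apply, MonoidHom.one_apply, h.charDet_galois]
  exact forall_congr' fun g => by
    rw [← map_pow τ, map_eq_one_iff τ τ.injective]

/-- A `σ`-special character whose restriction to a normal subgroup of `σ'`-index has values
fixed by a field automorphism is itself fixed. -/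
theorem Special.galois_eq {σ : Set ℕ} {ν : G → ℂ} (hν : Special σ G ν) {M : Subgroup G} [M.Normal]
    (hM : IsPiNumber σᶜ M.index) (τ : ℂ →+* ℂ) (he : ∀ k ∈ M, τ (ν k) = ν k) : τ ∘ ν = ν := by
  obtain ⟨n, hn, hnσ⟩ := hν.degree
  have hk : (QuotientGroup.mk' M).ker = M := QuotientGroup.ker_mk' M
  refine (hν.irr.galois τ).eq_of_restrict_ker (QuotientGroup.mk'_surjective M) hν.irr ?_ ?_ hM
    (d := n) ?_ hnσ ?_ hν.orderOf_det
  · refine hν.irr.restrict_of_coprime hn ?_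
    rw [hk]
    exact hnσ.coprime hM
  · intro k hk'
    rw [hk] at hk'
    exact he k hk'
  · simp [hn]
  · rw [hν.irr.1.orderOf_charDet_galois]
    exact hν.orderOf_det

theorem IsCharacter.galois_apply_eq {χ : G → ℂ} (h : IsCharacter G χ) (τ : ℂ →+* ℂ) (g : G)
    (hτ : ∀ z : ℂ, z ^ orderOf g = 1 → τ z = z) : τ (χ g) = χ g :=
  h.comp_zpowers_sum (fun z => τ z = z) g (map_zero τ)
    (fun a b ha hb => by rw [map_add, ha, hb]) hτ

omit [Finite G] in
theorem MonoidHom.linear_galois {l : G →* ℂ} (τ : ℂ →+* ℂ) {q : ℕ}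
    (hG : ∀ g : G, g ^ q = 1) (hτ : ∀ z : ℂ, z ^ q = 1 → τ z * z = 1) (g : G) :
    τ (l g) = l g⁻¹ := by
  have h1 : l g ^ q = 1 := by rw [← map_pow, hG, map_one]
  have h2 : l g * l g⁻¹ = 1 := by rw [← map_mul, mul_inv_cancel, map_one]
  have h3 := hτ _ h1
  have h4 : l g ≠ 0 := left_ne_zero_of_mul_eq_one h2
  refine mul_right_cancel₀ h4 ?_
  rw [h3, mul_comm, h2]

/-- A self-dual character of odd degree of an abelian group of odd exponent has trivial
constituents. -/
theorem IsCharacter.ip_one_ne_zero_of_dual {A : G → ℂ} (hA : IsCharacter G A)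
    (hG : ∀ x y : G, x * y = y * x) {q : ℕ} (hq : Odd q) (he : ∀ g : G, g ^ q = 1)
    (hd : dualFn A = A) {n : ℕ} (hn : A 1 = n) (hno : Odd n) : ip A 1 ≠ 0 := by
  intro h0
  have hcomm : IsMulCommutative G := ⟨⟨hG⟩⟩
  have hm : ∀ κ : G → ℂ, ∃ m : ℕ, IsIrrChar G κ → ip A κ = m := by
    intro κ
    by_cases h : IsIrrChar G κ
    · obtain ⟨m, hm⟩ := hA.exists_ip h.1
      exact ⟨m, fun _ => hm⟩
    · exact ⟨0, fun h' => absurd h' h⟩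
  choose m hm using hm
  have h1 : n = ∑ κ ∈ irrChars G, m κ := by
    have h2 := congrFun hA.isClassFn.eq_sum_irr 1
    rw [hn, Finset.sum_apply] at h2
    have h3 : (n : ℂ) = ((∑ κ ∈ irrChars G, m κ : ℕ) : ℂ) := by
      rw [h2, Nat.cast_sum]
      refine Finset.sum_congr rfl fun κ hκ => ?_
      rw [mem_irrChars] at hκ
      obtain ⟨l, rfl⟩ := hκ.exists_linear_of_comm
      rw [Pi.smul_apply, map_one, hm _ hκ, smul_eq_mul, mul_one]
    exact_mod_cast h3
  have h4 : (n : ZMod 2) = 0 := by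
    rw [h1, Nat.cast_sum]
    have hmd : ∀ κ, IsIrrChar G κ → m (dualFn κ) = m κ := by
      intro κ hκ
      have := hm _ hκ.dual
      rw [← hd, ip_dual_dual, hm _ hκ] at this
      exact_mod_cast this.symm
    refine Finset.sum_involution (fun κ _ => dualFn κ) ?_ ?_ ?_ ?_
    · intro κ hκ
      rw [hmd κ (mem_irrChars.1 hκ)]
      exact CharTwo.add_self_eq_zero _
    · intro κ hκ hne heq
      have hκ' := mem_irrChars.1 hκ
      obtain ⟨l, rfl⟩ := hκ'.exists_linear_of_comm
      have hl : ∀ g, l g = 1 := by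
        intro g
        have e1 : l g⁻¹ = l g := congrFun heq g
        have e2 : l g ^ 2 = 1 := by
          rw [pow_two]
          nth_rw 1 [← e1]
          rw [← map_mul, inv_mul_cancel, map_one]
        have e3 : l g ^ q = 1 := by rw [← map_pow, he, map_one]
        obtain ⟨k, rfl⟩ := hq
        rwa [pow_succ, pow_mul, e2, one_pow, one_mul] at e3
      apply hne
      have e4 : (l : G → ℂ) = 1 := funext hl
      have e5 := hm _ hκ'
      rw [e4, h0] at e5
      rw [e4]
      have : m 1 = 0 := by exact_mod_cast e5.symm
      rw [this, Nat.cast_zero]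
    · intro κ hκ
      exact mem_irrChars.2 (mem_irrChars.1 hκ).dual
    · intro κ hκ
      exact dualFn_dualFn κ
  rw [ZMod.natCast_eq_zero_iff] at h4
  exact (Nat.not_even_iff_odd.2 hno) (even_iff_two_dvd.2 h4)

/-- The restriction of a `σ'`-special character to an elementary abelian `q`-group, `q ∈ σ` odd,
has trivial constituents. -/
theorem Special.ip_one_ne_zero_of_odd {σ : Set ℕ} {ν : G → ℂ} (hν : Special σᶜ G ν)
    {B : Subgroup G} [B.Normal] (hB : IsPiNumber σᶜ (Nat.card B)) (hi : IsPiNumber σ B.index)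
    {q : ℕ} (hqσ : IsPiNumber σ q) (hq : Odd q) {n : ℕ} (hn : ν 1 = n) (hno : Odd n)
    {X : Type} [Group X] [Finite X] (f : X →* G) (hX : ∀ x y : X, x * y = y * x)
    (he : ∀ x : X, x ^ q = 1) : ip (ν ∘ f) 1 ≠ 0 := by
  obtain ⟨τ, h1, h2⟩ := _root_.exists_galois (n := Nat.card B) (q := q) Nat.card_pos.ne'
    (by rintro rfl; simp at hq) (hqσ.coprime hB).symm
  have hτ : τ ∘ ν = ν := by
    refine hν.galois_eq (M := B) (by rwa [compl_compl]) τ fun k hk => ?_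
    refine hν.irr.1.galois_apply_eq τ k fun z hz => h1 z ?_
    obtain ⟨c, hc⟩ := Subgroup.orderOf_dvd_natCard B hk
    rw [hc, pow_mul, hz, one_pow]
  have hc : IsCharacter X (ν ∘ f) := hν.irr.1.comp f
  refine hc.ip_one_ne_zero_of_dual hX hq he ?_ (n := n) (by simpa using hn) hno
  have hcomm : IsMulCommutative X := ⟨⟨hX⟩⟩
  have h3 : τ ∘ (ν ∘ f) = dualFn (ν ∘ f) := by
    refine hc.induction_on (P := fun χ => τ ∘ χ = dualFn χ) ?_ ?_
    · ext x
      simp [dualFn]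
    · intro θ ψ hθ _ hψ
      obtain ⟨l, rfl⟩ := hθ.exists_linear_of_comm
      ext x
      have := congrFun hψ x
      simp only [Function.comp_apply, dualFn_apply, Pi.add_apply, map_add] at this ⊢
      rw [this, l.linear_galois τ he h2]
  rw [← h3, ← Function.comp_assoc, hτ]

end Galois

section Sign

variable {G : Type} [Group G] [Finite G]

theorem IsCharacter.sum_subgroup_eq_zero {ψ : G → ℂ} (hψ : IsCharacter G ψ) (B : Subgroup G)
    [Fintype B] (h : ip (ψ ∘ B.subtype) 1 = 0) (d : G) : ∑ b : B, ψ (b * d) = 0 := by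
  obtain ⟨V, _, _, _, ρ, rfl⟩ := hψ.exists_representation
  let ρB : Representation ℂ B V := ρ.comp B.subtype
  have h1 : ip ρB.character 1 = 0 := h
  rw [Representation.ip_character_one_eq_finrank, Nat.cast_eq_zero,
    Submodule.finrank_eq_zero] at h1
  have h2 : ∑ b : B, ρ b = 0 := by
    ext v
    have h3 : ∑ b : B, ρ b v ∈ ρB.invariants := by
      intro c
      rw [map_sum]
      refine (Fintype.sum_equiv (Equiv.mulLeft c) _ _ fun b => ?_)
      simp [ρB]
    rw [h1, Submodule.mem_bot] at h3
    simpa using h3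
  have h4 : LinearMap.trace ℂ V ((∑ b : B, ρ b) * ρ d) = ∑ b : B, ρ.character (b * d) := by
    rw [Finset.sum_mul, map_sum]
    exact Finset.sum_congr rfl fun b _ => by rw [← map_mul]; rfl
  rw [← h4, h2, zero_mul, map_zero]

theorem IsIrrChar.sum_coset {ν : G → ℂ} (hν : IsIrrChar G ν) {B : Subgroup G} [Fintype B]
    (hB : IsIrrChar B (ν ∘ B.subtype)) (d : G) :
    ∑ b : B, ν (b * d) * ν (b * d)⁻¹ = Nat.card B := by
  obtain ⟨ψ, hψ, he⟩ := hν.exists_mul_dual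
  have h1 : ip (ψ ∘ B.subtype) 1 = 0 := by
    have h2 := hB.ip_self
    rw [ip_eq_ip_one] at h2
    have h3 : (ν ∘ B.subtype) * dualFn (ν ∘ B.subtype) = 1 + ψ ∘ B.subtype := by
      ext b
      exact congrFun he b
    rw [h3, ip_add_left, isIrrChar_one.ip_self] at h2
    simpa using h2
  have h2 : ∀ b : B, ν (b * d) * ν (b * d)⁻¹ = 1 + ψ (b * d) := fun b => congrFun he (b * d)
  simp only [h2, Finset.sum_add_distrib, hψ.sum_subgroup_eq_zero B h1]
  simp

theorem isIrrChar_or_neg_of_ip_self {f : G → ℂ} (hf : IsClassFn f)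
    (hz : ∀ θ, IsIrrChar G θ → ∃ z : ℤ, ip f θ = z) (h1 : ip f f = 1) :
    ∃ θ, IsIrrChar G θ ∧ (f = θ ∨ f = -θ) := by
  have hz' : ∀ θ : G → ℂ, ∃ z : ℤ, IsIrrChar G θ → ip f θ = z := by
    intro θ
    by_cases h : IsIrrChar G θ
    · obtain ⟨z, h'⟩ := hz θ h
      exact ⟨z, fun _ => h'⟩
    · exact ⟨0, fun h' => absurd h' h⟩
  choose z hz using hz'
  have hs : f = ∑ θ ∈ irrChars G, (z θ : ℂ) • θ := by
    conv_lhs => rw [hf.eq_sum_irr]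
    exact Finset.sum_congr rfl fun θ h => by rw [hz θ (mem_irrChars.1 h)]
  have h2 : ∑ θ ∈ irrChars G, z θ * z θ = 1 := by
    have h3 : ip f f = ((∑ θ ∈ irrChars G, z θ * z θ : ℤ) : ℂ) := by
      conv_lhs => arg 2; rw [hs]
      rw [ip_sum_right, Int.cast_sum]
      exact Finset.sum_congr rfl fun θ h => by
        rw [ip_smul_right, hz θ (mem_irrChars.1 h), Int.cast_mul]
    rw [h1] at h3
    exact_mod_cast h3.symm
  obtain ⟨θ, hθ, hne⟩ : ∃ θ ∈ irrChars G, z θ * z θ ≠ 0 := by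
    by_contra! hc
    rw [Finset.sum_eq_zero hc] at h2
    exact zero_ne_one h2
  have hθ0 : z θ ≠ 0 := fun h => hne (by rw [h, zero_mul])
  rw [← Finset.add_sum_erase _ _ hθ] at h2
  have h4 : 0 ≤ ∑ κ ∈ (irrChars G).erase θ, z κ * z κ :=
    Finset.sum_nonneg fun κ _ => mul_self_nonneg _
  have h5 : 1 ≤ z θ * z θ := Int.add_one_le_iff.2 (lt_of_le_of_ne (mul_self_nonneg _) hne.symm)
  have h6 : z θ * z θ = 1 := by linarith
  have h7 : ∑ κ ∈ (irrChars G).erase θ, z κ * z κ = 0 := by linarith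
  rw [Finset.sum_eq_zero_iff_of_nonneg fun κ _ => mul_self_nonneg _] at h7
  rw [← Finset.add_sum_erase _ _ hθ, Finset.sum_eq_zero (s := (irrChars G).erase θ)
    (fun κ h => by rw [mul_self_eq_zero.1 (h7 κ h), Int.cast_zero, zero_smul]), add_zero] at hs
  refine ⟨θ, mem_irrChars.1 hθ, ?_⟩
  rcases mul_self_eq_one_iff.1 h6 with h | h
  · left; rw [hs, h]; simp
  · right; rw [hs, h]; simp

section Centralizer

variable {B : Subgroup G} [hBn : B.Normal]

omit [Finite G] hBn in
theorem mem_subgroupOf_centralizer {u : G}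
    (c : B.subgroupOf (Subgroup.centralizer {u})) : (c : G) ∈ B ∧ (c : G) * u = u * c :=
  ⟨c.2, Subgroup.mem_centralizer_singleton_iff.1 c.1.2⟩

omit [Finite G] hBn in
theorem exists_subgroupOf_centralizer {u g : G} (hg : g ∈ B) (h : g * u = u * g) :
    ∃ c : B.subgroupOf (Subgroup.centralizer {u}), (c : G) = g :=
  ⟨⟨⟨g, Subgroup.mem_centralizer_singleton_iff.2 h⟩, hg⟩, rfl⟩

omit [Finite G] hBn in
theorem exists_odd_card (hB : IsPiNumber {2}ᶜ (Nat.card B)) : Odd (Nat.card B) := by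
  rw [← Nat.not_even_iff_odd, even_iff_two_dvd]
  intro h
  exact hB 2 Nat.prime_two h rfl

omit [Finite G] in
theorem isPiElt_two {u : G} (hu : u * u = 1) : IsPiElt {2} u :=
  isPiElt_of_pow_eq_one (n := 2) (fun q hq hd => (Nat.prime_dvd_prime_iff_eq hq Nat.prime_two).1 hd)
    (by rw [pow_two, hu])

theorem exists_conj_involution (hB : IsPiNumber {2}ᶜ (Nat.card B)) {u v : G} (hu : u * u = 1)
    (hv : v * v = 1) (h : QuotientGroup.mk' B u = QuotientGroup.mk' B v) :
    ∃ b ∈ B, b * u * b⁻¹ = v :=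
  exists_conj_of_piElt hB (isPiElt_two hu) (isPiElt_two hv) (QuotientGroup.eq.1 h)

omit [Finite G] in
theorem pow_card_of_mem_coset (hB : IsPiNumber {2}ᶜ (Nat.card B)) {u g : G} (hu : u * u = 1)
    (h : QuotientGroup.mk' B g = QuotientGroup.mk' B u) :
    g ^ Nat.card B * g ^ Nat.card B = 1 ∧
      QuotientGroup.mk' B (g ^ Nat.card B) = QuotientGroup.mk' B u := by
  constructor
  · rw [← pow_add, ← two_mul, pow_mul, pow_two]
    have h1 : g * g ∈ B := by
      rw [← QuotientGroup.eq_one_iff]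
      change QuotientGroup.mk' B (g * g) = 1
      rw [map_mul, h, ← map_mul, hu, map_one]
    have := pow_card_eq_one' (x := (⟨g * g, h1⟩ : B))
    exact congrArg Subtype.val this
  · obtain ⟨k, hk⟩ := exists_odd_card hB
    rw [map_pow, h, hk, pow_succ, pow_mul, pow_two, ← map_mul, hu, map_one, one_pow, one_mul]

theorem exists_conj_coset (hB : IsPiNumber {2}ᶜ (Nat.card B)) {u : G} (hu : u * u = 1) (b : B) :
    ∃ (y : B) (c : B.subgroupOf (Subgroup.centralizer {u})),
      (y : G) * (c * u) * (y : G)⁻¹ = b * u := by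
  have hg : QuotientGroup.mk' B (b * u) = QuotientGroup.mk' B u := by
    rw [map_mul, show QuotientGroup.mk' B (b : G) = 1 from (QuotientGroup.eq_one_iff _).2 b.2,
      one_mul]
  obtain ⟨h1, h2⟩ := pow_card_of_mem_coset hB hu hg
  obtain ⟨y, hy, he⟩ := exists_conj_involution hB h1 hu h2
  have hu' : u⁻¹ = u := inv_eq_of_mul_eq_one_left hu
  have hcomm : (y * (b * u) * y⁻¹) * u = u * (y * (b * u) * y⁻¹) := by
    rw [← conj_pow] at he
    have := ((Commute.refl (y * (b * u) * y⁻¹)).pow_right (Nat.card B)).eq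
    rwa [he] at this
  obtain ⟨c, hc⟩ := exists_subgroupOf_centralizer (B := B) (u := u) (g := y * (b * u) * y⁻¹ * u)
    (by
      rw [← QuotientGroup.eq_one_iff]
      change QuotientGroup.mk' B _ = 1
      rw [map_mul, map_mul, map_mul, hg, map_inv,
        show QuotientGroup.mk' B y = 1 from (QuotientGroup.eq_one_iff _).2 hy, one_mul, inv_one,
        mul_one, ← map_mul, hu, map_one])
    ((congrArg (· * u) hcomm).trans (mul_assoc _ _ _))
  refine ⟨⟨y⁻¹, inv_mem hy⟩, c, ?_⟩
  rw [hc]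
  simp only [mul_assoc, hu]
  simp

/-- Summing a class function over a coset of an involution. -/
theorem sum_coset_centralizer (hB : IsPiNumber {2}ᶜ (Nat.card B)) {u : G} (hu : u * u = 1)
    [Fintype B] [Fintype (B.subgroupOf (Subgroup.centralizer {u}))] {F : G → ℂ}
    (hF : ∀ b ∈ B, ∀ g, F (b * g * b⁻¹) = F g) :
    (Nat.card (B.subgroupOf (Subgroup.centralizer {u})) : ℂ) * ∑ b : B, F (b * u) =
      Nat.card B * ∑ c : B.subgroupOf (Subgroup.centralizer {u}), F (c * u) := by
  choose y c hyc using exists_conj_coset hB hu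
  let C := B.subgroupOf (Subgroup.centralizer {u})
  have hm : ∀ z : C, (z : G) ∈ B := fun z => (mem_subgroupOf_centralizer z).1
  let Φ : B × C → B × C := fun p => (y p.1 * ⟨p.2, hm p.2⟩, p.2⁻¹ * c p.1 * p.2)
  have hΦ : ∀ p, ((Φ p).1 : G) * ((Φ p).2 * u) * ((Φ p).1 : G)⁻¹ = p.1 * u := by
    rintro ⟨b, z⟩
    have hz := (mem_subgroupOf_centralizer z).2
    rw [← hyc b]
    simp only [Φ, Subgroup.coe_mul, InvMemClass.coe_inv, mul_inv_rev]
    have : (z : G) * u * (z : G)⁻¹ = u := by rw [hz, mul_inv_cancel_right]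
    calc _ = (y b : G) * (c b * ((z : G) * u * (z : G)⁻¹)) * (y b : G)⁻¹ := by group
      _ = _ := by rw [this]
  have hinj : Function.Injective Φ := by
    rintro ⟨b, z⟩ ⟨b', z'⟩ he
    have h1 := hΦ (b, z)
    rw [he, hΦ (b', z')] at h1
    have hb : b' = b := Subtype.ext (mul_right_cancel h1)
    subst hb
    have h2 : (y b' : G) * (z : G) = y b' * z' := congrArg (fun p => ((Prod.fst p : B) : G)) he
    have hz : z = z' := Subtype.ext (Subtype.ext (mul_left_cancel h2))
    rw [hz]
  have h1 := Function.Bijective.sum_comp (Finite.injective_iff_bijective.1 hinj)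
    (fun p : B × C => F (p.2 * u))
  have h2 : ∀ p : B × C, F ((Φ p).2 * u) = F (p.1 * u) := fun p => by
    rw [← hΦ p, hF _ (Φ p).1.2]
  simp only [h2] at h1
  rw [Fintype.sum_prod_type, Fintype.sum_prod_type] at h1
  simp only [Finset.sum_const, Finset.card_univ, nsmul_eq_mul] at h1
  rw [← Finset.mul_sum] at h1
  rw [Nat.card_eq_fintype_card, Nat.card_eq_fintype_card]
  exact h1

omit hBn in
omit [Finite G] in
theorem coset_conj {u : G} (c x : B.subgroupOf (Subgroup.centralizer {u})) :
    ((x * c * x⁻¹ : B.subgroupOf (Subgroup.centralizer {u})) : G) * u = x * (c * u) * (x : G)⁻¹ := by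
  have h := (mem_subgroupOf_centralizer x⁻¹).2
  simp only [Subgroup.coe_mul, InvMemClass.coe_inv] at h ⊢
  simp only [mul_assoc, h]

omit hBn in
/-- The average of the translates of a character by `1` and a commuting involution is a character
of the centralizer. -/
theorem isCharacter_half (u : G) (hu : u * u = 1) {ν : G → ℂ} (hν : IsCharacter G ν) :
    IsCharacter (B.subgroupOf (Subgroup.centralizer {u}))
      (fun c => (ν c + ν (c * u)) / 2) := by
  let C := B.subgroupOf (Subgroup.centralizer {u})
  let i : C →* G := (Subgroup.centralizer {u}).subtype.comp C.subtype
  let s : ℤˣ →* G :=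
    { toFun := fun e => if e = 1 then 1 else u
      map_one' := by simp
      map_mul' := by
        intro a b
        rcases Int.units_eq_one_or a with rfl | rfl <;>
        rcases Int.units_eq_one_or b with rfl | rfl <;> simp [hu] }
  have hs : s (-1) = u := by
    change (if (-1 : ℤˣ) = 1 then (1 : G) else u) = u
    rw [if_neg (by decide)]
  have hcomm : ∀ (c : C) (e : ℤˣ), Commute (i c) (s e) := by
    intro c e
    rcases Int.units_eq_one_or e with rfl | rfl
    · rw [map_one]
      exact Commute.one_right _
    · rw [hs]
      exact (mem_subgroupOf_centralizer c).2
  let m : C × ℤˣ →* G := MonoidHom.noncommCoprod i s hcomm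
  have hm : ∀ c e, m (c, e) = i c * s e := fun c e => rfl
  have h1 : IsCharacter C (_root_.push (MonoidHom.fst C ℤˣ) (ν ∘ m)) :=
    (hν.comp m).push (MonoidHom.fst C ℤˣ)
  convert h1 using 1
  ext c
  let _ := Fintype.ofFinite C
  rw [push_apply]
  have h2 : ∀ x : C, (∑ h : C × ℤˣ, if MonoidHom.fst C ℤˣ h = x * c * x⁻¹ then (ν ∘ m) h else 0) =
      ν c + ν (c * u) := by
    intro x
    rw [Fintype.sum_prod_type, Finset.sum_comm]
    have h3 : ∀ e : ℤˣ, (∑ y : C, if MonoidHom.fst C ℤˣ (y, e) = x * c * x⁻¹ then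
        (ν ∘ m) (y, e) else 0) = ν (i (x * c * x⁻¹) * s e) := by
      intro e
      refine (Finset.sum_eq_single (x * c * x⁻¹) (fun y _ hy => if_neg hy)
        (fun h => absurd (Finset.mem_univ _) h)).trans ?_
      exact if_pos rfl
    simp only [h3]
    rw [show (Finset.univ : Finset ℤˣ) = {1, -1} from rfl, Finset.sum_pair (by decide), hs, map_one]
    congr 1
    · rw [mul_one, map_mul, map_mul, map_inv, hν.isClassFn]
      rfl
    · have := coset_conj c x
      change ν (((x * c * x⁻¹ : C) : G) * u) = _
      rw [this, hν.isClassFn]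
  refine Eq.trans ?_ (congrArg _ (Finset.sum_congr rfl fun x _ => ((h2 x).symm.trans (by congr!))))
  simp only [Finset.sum_const, Finset.card_univ, nsmul_eq_mul, Nat.card_prod]
  have h4 : (Fintype.card C : ℂ) ≠ 0 := by
    rw [← Nat.card_eq_fintype_card]
    exact card_ne_zero'
  have h5 : Nat.card ℤˣ = 2 := by rw [Nat.card_eq_fintype_card]; rfl
  rw [h5, Nat.card_eq_fintype_card]
  push_cast
  field_simp

/-- Multiplying a character with irreducible restriction to an odd normal subgroup by an
involution gives, up to sign, an irreducible character of the centralizer. -/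
theorem exists_irr_of_involution (hB : IsPiNumber {2}ᶜ (Nat.card B)) {u : G} (hu : u * u = 1)
    {ν : G → ℂ} (hν : IsIrrChar G ν) (hνB : IsIrrChar B (ν ∘ B.subtype)) :
    ∃ (κ : B.subgroupOf (Subgroup.centralizer {u}) → ℂ) (ε : ℤ), IsIrrChar _ κ ∧
      (ε = 1 ∨ ε = -1) ∧ ∀ c : B.subgroupOf (Subgroup.centralizer {u}), ν (c * u) = ε * κ c := by
  let C := B.subgroupOf (Subgroup.centralizer {u})
  let _ := Fintype.ofFinite C
  let _ := Fintype.ofFinite B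
  let f : C → ℂ := fun c => ν (c * u)
  have hu' : u⁻¹ = u := inv_eq_of_mul_eq_one_left hu
  have hf : IsClassFn f := by
    intro x g
    change ν (_ * u) = ν (_ * u)
    rw [coset_conj, hν.1.isClassFn]
  have hx := isCharacter_half (B := B) u hu hν.1
  let i : C →* G := (Subgroup.centralizer {u}).subtype.comp C.subtype
  have hfx : f = (2 : ℂ) • (fun c : C => (ν c + ν (c * u)) / 2) - ν ∘ i := by
    ext c
    simp only [f, Pi.sub_apply, Pi.smul_apply, smul_eq_mul]
    change _ = _ - ν c
    ring
  have h1 : ip f f = 1 := by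
    rw [ip_eq, inv_mul_eq_one₀ card_ne_zero']
    have h2 := sum_coset_centralizer hB hu (F := fun g => ν g * ν g⁻¹) (by
      intro b _ g
      simp only [conj_inv]
      rw [hν.1.isClassFn, hν.1.isClassFn])
    rw [hν.sum_coset hνB u, mul_comm] at h2
    rw [mul_left_cancel₀ card_ne_zero' h2]
    refine Finset.sum_congr rfl fun c _ => ?_
    have h3 := (mem_subgroupOf_centralizer c⁻¹).2
    have h4 : ((c : G) * u)⁻¹ = ((c⁻¹ : C) : G) * u := by
      rw [mul_inv_rev, hu', h3]
      rfl
    rw [h4]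
  obtain ⟨κ, hκ, h⟩ := isIrrChar_or_neg_of_ip_self hf (by
    intro θ hθ
    obtain ⟨a, ha⟩ := hx.exists_ip hθ.1
    obtain ⟨b, hb⟩ := (hν.1.comp i).exists_ip hθ.1
    refine ⟨2 * a - b, ?_⟩
    rw [hfx, ip_sub_left, ip_smul_left, ha, hb]
    push_cast
    rfl) h1
  rcases h with h | h
  · refine ⟨κ, 1, hκ, Or.inl rfl, fun c => ?_⟩
    rw [Int.cast_one, one_mul]
    exact congrFun h c
  · refine ⟨κ, -1, hκ, Or.inr rfl, fun c => ?_⟩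
    rw [Int.cast_neg, Int.cast_one, neg_one_mul]
    exact congrFun h c

end Centralizer

end Sign

section SignPositivity

variable {G : Type} [Group G] [Finite G]

theorem IsIrrChar.sum_mul_sum [Fintype G] {χ : G → ℂ} (hχ : IsIrrChar G χ) {a : G → ℂ}
    (ha : IsClassFn a) (b : G → ℂ) :
    ∑ g, ∑ x, a x * b (x⁻¹ * g) * χ g = (∑ x, a x * χ x) * (∑ y, b y * χ y) / χ 1 := by
  rw [Finset.sum_comm]
  have h1 : ∀ x, ∑ g, a x * b (x⁻¹ * g) * χ g = ∑ y, a x * b y * χ (x * y) := fun x =>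
    Fintype.sum_equiv (Equiv.mulLeft x⁻¹) _ _ fun g => by simp
  rw [Finset.sum_congr rfl fun x _ => h1 x, Finset.sum_comm]
  have h2 : ∀ y, ∑ x, a x * b y * χ (x * y) = (∑ x, a x * χ x) / χ 1 * (b y * χ y) := by
    intro y
    have h3 := hχ.convolution ha y
    rw [mul_left_comm, ← h3, Finset.mul_sum]
    exact Finset.sum_congr rfl fun x _ => by ring
  rw [Finset.sum_congr rfl fun y _ => h2 y, ← Finset.mul_sum]
  ring

theorem IsCharacter.star_apply_of_involution {χ : G → ℂ} (hχ : IsCharacter G χ) {g : G}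
    (hg : g * g = 1) : star (χ g) = χ g := by
  refine hχ.comp_zpowers_sum (fun z => star z = z) g (by simp)
    (fun a b ha hb => by rw [star_add, ha, hb]) fun z hz => ?_
  have h1 : z ^ 2 = 1 := by
    obtain ⟨k, hk⟩ := orderOf_dvd_of_pow_eq_one (x := g) (n := 2) (by rw [pow_two, hg])
    rw [hk, pow_mul, hz, one_pow]
  rcases eq_or_eq_neg_of_sq_eq_sq z 1 (h1.trans (one_pow 2).symm) with rfl | rfl <;> simp

variable {B : Subgroup G} [hBn : B.Normal]

/-- The indicator function of the set of involutions in the coset of `s`. -/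
def cosetInvolutions (B : Subgroup G) [B.Normal] (s : G) : G → ℂ :=
  fun x => if x * x = 1 ∧ QuotientGroup.mk' B x = QuotientGroup.mk' B s then 1 else 0

omit [Finite G] in
theorem isClassFn_cosetInvolutions
    (hq : ∀ x y : G, QuotientGroup.mk' B x * QuotientGroup.mk' B y =
      QuotientGroup.mk' B y * QuotientGroup.mk' B x) (s : G) :
    IsClassFn (cosetInvolutions B s) := by
  intro x g
  unfold cosetInvolutions
  have h1 : x * g * x⁻¹ * (x * g * x⁻¹) = 1 ↔ g * g = 1 := by
    rw [show x * g * x⁻¹ * (x * g * x⁻¹) = x * (g * g) * x⁻¹ by group, conj_eq_one_iff]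
  have h2 : QuotientGroup.mk' B (x * g * x⁻¹) = QuotientGroup.mk' B g := by
    rw [map_mul, map_mul, hq x g, mul_assoc, ← map_mul, mul_inv_cancel, map_one, mul_one]
  rw [h1, h2]

theorem sum_cosetInvolutions_mul [Fintype G] (hB : IsPiNumber {2}ᶜ (Nat.card B)) {s : G}
    (hs : s * s = 1) {f : G → ℂ} (hf : IsClassFn f) :
    ∑ x, cosetInvolutions B s x * f x = (∑ x, cosetInvolutions B s x) * f s := by
  rw [Finset.sum_mul]
  refine Finset.sum_congr rfl fun x _ => ?_
  unfold cosetInvolutions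
  split_ifs with h
  · obtain ⟨b, _, rfl⟩ := exists_conj_involution hB hs h.1 h.2.symm
    rw [hf]
  · rw [zero_mul, zero_mul]

omit [Finite G] in
open scoped ComplexOrder in
theorem sum_cosetInvolutions_pos [Fintype G] {s : G} (hs : s * s = 1) :
    0 < ∑ x, cosetInvolutions B s x := by
  refine Finset.sum_pos' (fun x _ => ?_) ⟨s, Finset.mem_univ _, ?_⟩
  · unfold cosetInvolutions
    split_ifs
    · exact zero_le_one
    · exact le_rfl
  · unfold cosetInvolutions
    rw [if_pos ⟨hs, rfl⟩]
    exact zero_lt_one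

theorem apply_ne_zero_of_involution (hB : IsPiNumber {2}ᶜ (Nat.card B)) {ν : G → ℂ}
    (hν : IsIrrChar G ν) (hνB : IsIrrChar B (ν ∘ B.subtype)) {u : G} (hu : u * u = 1) :
    ν u ≠ 0 := by
  obtain ⟨κ, ε, hκ, hε, h⟩ := exists_irr_of_involution hB hu hν hνB
  have h1 := h 1
  rw [show (((1 : B.subgroupOf (Subgroup.centralizer {u})) : Subgroup.centralizer {u}) : G) = 1
    from rfl, one_mul] at h1
  rw [h1]
  refine mul_ne_zero ?_ hκ.apply_one_ne_zero
  rcases hε with rfl | rfl <;> simp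

omit [Finite G] hBn in
theorem mem_centralizer_of_cosetInvolutions (hB : IsPiNumber {2}ᶜ (Nat.card B)) {u : G}
    (hu : u * u = 1) (c : B.subgroupOf (Subgroup.centralizer {u})) {x : G} (hx : x * x = 1)
    (hy : x⁻¹ * (c * u) * (x⁻¹ * (c * u)) = 1) : x * u = u * x := by
  obtain ⟨hcB, hcu⟩ := mem_subgroupOf_centralizer c
  have hu' : u⁻¹ = u := inv_eq_of_mul_eq_one_left hu
  have hx' : x⁻¹ = x := inv_eq_of_mul_eq_one_left hx
  have h1 : ((c : G) * u) ^ Nat.card B = u := by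
    have hc : (c : G) ^ Nat.card B = 1 :=
      congrArg Subtype.val (pow_card_eq_one' (x := (⟨c, hcB⟩ : B)))
    obtain ⟨k, hk⟩ := exists_odd_card hB
    rw [Commute.mul_pow hcu, hc, one_mul, hk, pow_succ, pow_mul, pow_two, hu, one_pow, one_mul]
  have h2 : x * (c * u) * x⁻¹ = (c * u)⁻¹ := by
    rw [eq_inv_iff_mul_eq_one]
    rw [hx'] at hy ⊢
    rw [← hy]
    simp only [mul_assoc]
  have h3 : x * u * x⁻¹ = u := by
    conv_lhs => rw [← h1]
    rw [← conj_pow, h2, inv_pow, h1, hu']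
  exact mul_inv_eq_iff_eq_mul.1 h3

open scoped ComplexOrder in
theorem mul_pos_of_commuting_involutions (hB : IsPiNumber {2}ᶜ (Nat.card B))
    (hq : ∀ x y : G, QuotientGroup.mk' B x * QuotientGroup.mk' B y =
      QuotientGroup.mk' B y * QuotientGroup.mk' B x) {ν : G → ℂ}
    (hν : IsIrrChar G ν) (hνB : IsIrrChar B (ν ∘ B.subtype)) {s t : G} (hs : s * s = 1)
    (ht : t * t = 1) (hst : s * t = t * s) : 0 < ν s * ν t * ν (s * t) := by
  let _ := Fintype.ofFinite G
  let _ := Fintype.ofFinite B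
  obtain ⟨u, hu⟩ : ∃ u, u = s * t := ⟨_, rfl⟩
  rw [← hu]
  have huu : u * u = 1 := by
    rw [hu]
    calc s * t * (s * t) = s * (t * s) * t := by group
      _ = (s * s) * (t * t) := by rw [← hst]; group
      _ = 1 := by rw [hs, ht, one_mul]
  let W := Subgroup.centralizer {u}
  let C := B.subgroupOf W
  have hCn : C.Normal := inferInstance
  let _ := Fintype.ofFinite W
  let _ := Fintype.ofFinite C
  let a := cosetInvolutions B s
  let b := cosetInvolutions B t
  have ha : IsClassFn a := isClassFn_cosetInvolutions hq s
  have hb : IsClassFn b := isClassFn_cosetInvolutions hq t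
  obtain ⟨κ, ε, hκ, hε, hκε⟩ := exists_irr_of_involution hB huu hν hνB
  have hε2 : (ε : ℂ) * ε = 1 := by rcases hε with rfl | rfl <;> simp
  -- an irreducible character of the centralizer above `κ`
  obtain ⟨ζ, hζ, hζκ⟩ : ∃ ζ, IsIrrChar W ζ ∧ ip (ζ ∘ C.subtype) κ ≠ 0 := by
    obtain ⟨ζ, hζ, h⟩ := (hκ.1.push C.subtype).exists_irr_ip_ne_zero
      (IsCharacter.push_ne_zero C.subtype_injective hκ.1 hκ.2.1)
    refine ⟨ζ, hζ, ?_⟩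
    rwa [ip_push _ _ hζ.1.isClassFn, ip_comm] at h
  have hinv : ∀ w : W, conjFn C w κ = κ := by
    intro w
    ext c
    rw [conjFn_apply]
    have h1 := hκε c
    have h2 : ν ((w * c * w⁻¹ : W) * u) = ε * κ ⟨w * c * w⁻¹, hCn.conj_mem _ c.2 w⟩ :=
      hκε ⟨w * c * w⁻¹, hCn.conj_mem _ c.2 w⟩
    have h3 : ((w * c * w⁻¹ : W) : G) * u = w * (c * u) * (w : G)⁻¹ := by
      have h := Subgroup.mem_centralizer_singleton_iff.1 (w⁻¹).2
      simp only [Subgroup.coe_mul, InvMemClass.coe_inv] at h ⊢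
      simp only [mul_assoc, h]
    rw [h3, hν.1.isClassFn, h1] at h2
    exact (mul_left_cancel₀ (left_ne_zero_of_mul_eq_one hε2) h2).symm
  have hζC := hζ.eq_smul_of_invariant hκ hζκ hinv
  obtain ⟨k, hk⟩ := (hζ.1.comp C.subtype).exists_ip hκ.1
  rw [hk] at hζC hζκ
  have hsupp : ∀ g x, a x * b (x⁻¹ * g) ≠ 0 →
      (x * x = 1 ∧ QuotientGroup.mk' B x = QuotientGroup.mk' B s) ∧
      (x⁻¹ * g * (x⁻¹ * g) = 1 ∧ QuotientGroup.mk' B (x⁻¹ * g) = QuotientGroup.mk' B t) := by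
    intro g x h
    constructor
    · by_contra h'
      exact left_ne_zero_of_mul h (if_neg h')
    · by_contra h'
      exact right_ne_zero_of_mul h (if_neg h')
  have hleft : ∑ g, ∑ x, a x * b (x⁻¹ * g) * ν g =
      ∑ d : B, ∑ x, a x * b (x⁻¹ * (d * u)) * ν (d * u) := by
    refine (Fintype.sum_of_injective (fun d : B => (d : G) * u)
      (fun d d' h => Subtype.ext (mul_right_cancel h)) _ _ (fun g hg => ?_) fun d => rfl).symm
    refine Finset.sum_eq_zero fun x _ => ?_
    by_contra h
    obtain ⟨h1, h2⟩ := hsupp g x (left_ne_zero_of_mul h)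
    refine hg ⟨⟨g * u⁻¹, ?_⟩, inv_mul_cancel_right g u⟩
    rw [← QuotientGroup.eq_one_iff]
    change QuotientGroup.mk' B (g * u⁻¹) = 1
    rw [← mul_inv_cancel_left x g, mul_assoc, map_mul, map_mul, h2.2, h1.2, ← map_mul, ← map_mul,
      ← mul_assoc, ← hu, mul_inv_cancel, map_one]
  have hmid := sum_coset_centralizer hB huu (F := fun g => ∑ x, a x * b (x⁻¹ * g) * ν g) (by
    intro d _ g
    refine Fintype.sum_equiv (MulAut.conj d⁻¹).toEquiv _ _ fun x => ?_
    have h1 : (MulAut.conj d⁻¹).toEquiv x = d⁻¹ * x * d⁻¹⁻¹ := rfl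
    rw [h1, ha, hν.1.isClassFn]
    congr 2
    conv_rhs => rw [← hb d]
    congr 1
    group)
  let a' : W → ℂ := a ∘ W.subtype
  have hW : ∀ x : W, (x : G) * u = u * x := fun x => Subgroup.mem_centralizer_singleton_iff.1 x.2
  have hab : ∀ x : W, b (x * u) = a' x := by
    intro x
    have h1 : (x : G) * u * (x * u) = x * x := by
      calc (x : G) * u * (x * u) = x * (u * x) * u := by group
        _ = x * x * (u * u) := by rw [← hW]; group
        _ = x * x := by rw [huu, mul_one]
    have h2 : QuotientGroup.mk' B ((x : G) * u) = QuotientGroup.mk' B t ↔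
        QuotientGroup.mk' B (x : G) = QuotientGroup.mk' B s := by
      rw [hu, map_mul, map_mul, ← mul_assoc, mul_eq_right]
      have h3 : QuotientGroup.mk' B s * QuotientGroup.mk' B s = 1 := by
        rw [← map_mul, hs, map_one]
      rw [mul_eq_one_iff_eq_inv, inv_eq_of_mul_eq_one_left h3]
    exact if_congr (and_congr (by rw [h1]; rfl) h2) rfl rfl
  have hin : ∀ c : C, ∑ x, a x * b (x⁻¹ * (c * u)) = ∑ x : W, a' x * a' (x⁻¹ * c) := by
    intro c
    refine (Fintype.sum_of_injective W.subtype W.subtype_injective _ _ (fun x hx => ?_)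
      fun x => ?_).symm
    · by_contra h
      obtain ⟨h1, h2⟩ := hsupp _ x h
      refine hx ⟨⟨x, ?_⟩, rfl⟩
      exact Subgroup.mem_centralizer_singleton_iff.2
        (mem_centralizer_of_cosetInvolutions hB huu c h1.1 h2.1)
    · have := hab (x⁻¹ * c)
      rw [← this]
      simp only [Subgroup.coe_mul, InvMemClass.coe_inv, mul_assoc]
      rfl
  have hright : (k : ℂ) * ∑ c : C, ∑ x, a x * b (x⁻¹ * (c * u)) * ν (c * u) =
      ε * ∑ w : W, ∑ x : W, a' x * a' (x⁻¹ * w) * ζ w := by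
    rw [Finset.mul_sum, Finset.mul_sum]
    refine Fintype.sum_of_injective C.subtype C.subtype_injective _ _ (fun w hw => ?_) fun c => ?_
    · rw [Finset.sum_eq_zero, mul_zero]
      intro x _
      by_contra h
      have h0 := left_ne_zero_of_mul h
      have h1 : QuotientGroup.mk' B (x : G) = QuotientGroup.mk' B s := by
        by_contra h'
        exact left_ne_zero_of_mul h0 (if_neg fun h => h' h.2)
      have h2 : QuotientGroup.mk' B ((x⁻¹ * w : W) : G) = QuotientGroup.mk' B s := by
        by_contra h'
        exact right_ne_zero_of_mul h0 (if_neg fun h => h' h.2)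
      refine hw ⟨⟨w, ?_⟩, rfl⟩
      change (w : G) ∈ B
      rw [← QuotientGroup.eq_one_iff]
      change QuotientGroup.mk' B (w : G) = 1
      rw [← mul_inv_cancel_left x w, Subgroup.coe_mul, map_mul, h1, h2, ← map_mul, hs, map_one]
    · rw [← Finset.sum_mul, ← Finset.sum_mul, hin, hκε]
      have : ζ c = k * κ c := congrFun hζC c
      change _ = ε * (_ * ζ c)
      rw [this]
      simp only [Subgroup.subtype_apply]
      ring
  have hζsum := hζ.sum_mul_sum (a := a') (ha.comp W.subtype) a'
  have hνsum := hν.sum_mul_sum ha b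
  rw [hζsum] at hright
  rw [hνsum, sum_cosetInvolutions_mul hB hs hν.1.isClassFn,
    sum_cosetInvolutions_mul hB ht hν.1.isClassFn] at hleft
  rw [← hleft] at hmid
  have hνu : ν u = ε * κ 1 := by
    rw [← hκε 1]
    exact congrArg ν (one_mul u).symm
  have hQ : star (∑ w : W, a' w * ζ w) = ∑ w : W, a' w * ζ w := by
    rw [star_sum]
    refine Finset.sum_congr rfl fun w _ => ?_
    by_cases h : (w : G) * w = 1
    · rw [star_mul', hζ.1.star_apply_of_involution (Subtype.ext h)]
      congr 1
      simp only [a', a, cosetInvolutions, Function.comp_apply]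
      split_ifs <;> simp
    · rw [show a' w = 0 from if_neg fun h' => h h'.1, zero_mul, star_zero]
  have hQ0 := mul_star_self_nonneg (∑ w : W, a' w * ζ w)
  rw [hQ] at hQ0
  have hpos : ∀ {H : Type} [Group H] [Finite H] {θ : H → ℂ}, IsIrrChar H θ → 0 < θ 1 := by
    intro H _ _ θ hθ
    obtain ⟨n, he, hn⟩ := hθ.exists_degree_pos
    rw [he]
    exact_mod_cast hn
  have hA : 0 < ∑ x, a x := sum_cosetInvolutions_pos hs
  have hA' : 0 < ∑ x, b x := sum_cosetInvolutions_pos ht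
  have hk0 : (0 : ℂ) < k := by
    exact_mod_cast Nat.pos_of_ne_zero fun h => hζκ (by rw [h, Nat.cast_zero])
  have hC0 : (0 : ℂ) < Nat.card C := by exact_mod_cast Nat.card_pos
  have hν1 := hpos hν
  have hζ1 := hpos hζ
  obtain ⟨A, hAe⟩ : ∃ A, A = ∑ x, a x := ⟨_, rfl⟩
  obtain ⟨A', hAe'⟩ : ∃ A, A = ∑ x, b x := ⟨_, rfl⟩
  obtain ⟨Q, hQe⟩ : ∃ Q, Q = ∑ w : W, a' w * ζ w := ⟨_, rfl⟩
  obtain ⟨R, hRe⟩ : ∃ R, R = ∑ c : C, ∑ x, a x * b (x⁻¹ * (c * u)) * ν (c * u) := ⟨_, rfl⟩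
  have hmid' : (Nat.card C : ℂ) * (A * ν s * (A' * ν t) / ν 1) = Nat.card B * R := by
    rw [hAe, hAe', hRe]
    exact hmid
  have hright' : (k : ℂ) * R = ε * (Q * Q / ζ 1) := by
    rw [hRe, hQe]
    exact hright
  rw [← hQe] at hQ0
  rw [← hAe] at hA
  rw [← hAe'] at hA'
  have key : ν s * ν t * ν u * (Nat.card C * A * A' * k / ν 1) =
      Nat.card B * κ 1 / ζ 1 * (Q * Q) := by
    calc _ = k * ν u * (Nat.card C * (A * ν s * (A' * ν t) / ν 1)) := by ring
      _ = Nat.card B * ν u * (k * R) := by rw [hmid']; ring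
      _ = (ε * ε) * (Nat.card B * κ 1 / ζ 1 * (Q * Q)) := by rw [hright', hνu]; ring
      _ = _ := by rw [hε2, one_mul]
  have hc : 0 < Nat.card C * A * A' * k / ν 1 :=
    div_pos (mul_pos (mul_pos (mul_pos hC0 hA) hA') hk0) hν1
  have hge : 0 ≤ Nat.card B * κ 1 / ζ 1 * (Q * Q) :=
    mul_nonneg (div_nonneg (mul_nonneg (Nat.cast_nonneg _) (hpos hκ).le) hζ1.le) hQ0
  rw [← key] at hge
  have hge' := div_nonneg hge hc.le
  rw [mul_div_cancel_right₀ _ hc.ne'] at hge'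
  refine lt_of_le_of_ne hge' (Ne.symm ?_)
  exact mul_ne_zero (mul_ne_zero (apply_ne_zero_of_involution hB hν hνB hs)
    (apply_ne_zero_of_involution hB hν hνB ht)) (apply_ne_zero_of_involution hB hν hνB huu)

end SignPositivity

section Supplements

variable {σ : Set ℕ} {G H : Type} [Group G] [Finite G] [Group H] [Finite H]

omit [Finite G] in
theorem Indec.isIrrChar {χ : G → ℂ} (h : Indec σ χ) : IsIrrChar G χ := by
  refine ⟨h.char, h.ne_zero, ?_⟩
  rintro ⟨a, b, ha, ha0, hb, hb0, he⟩
  exact h.not_add a b ha hb ha0 hb0 fun g _ => congrFun he g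

theorem Indec.restrict_supplement {ζ : G → ℂ} (h : Indec σ ζ) (hs : IsSep σ G)
    {B L : Subgroup G} [B.Normal] (hB : IsPiNumber σᶜ (Nat.card B)) (hL : L ⊔ B = ⊤) :
    Indec σ (ζ ∘ L.subtype) := by
  have key : ∀ a : L → ℂ, IsCharacter L a → a ≠ 0 →
      ∃ δ, IsCharacter G δ ∧ δ ≠ 0 ∧ EqOnPi σ a (δ ∘ L.subtype) := by
    intro a ha ha0
    obtain ⟨γ, hγ, he, ht⟩ := (hs.subgroup L).hasTrivialLifts a ha
    obtain ⟨δ, hδ, hδγ, -⟩ := IsCharacter.exists_extension_of_supplement hL hγ fun l hl =>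
      ht (B.subgroupOf L) inferInstance (hB.dvd
        (Subgroup.card_comap_dvd_of_injective B L.subtype L.subtype_injective)) l hl
    refine ⟨δ, hδ, ?_, by rwa [hδγ]⟩
    rintro rfl
    refine ha0 (ha.eq_zero_of_apply_one ?_)
    rw [he.apply_one, ← hδγ]
    rfl
  refine ⟨h.char.comp _, fun h0 => h.ne_zero (h.char.eq_zero_of_apply_one (congrFun h0 1)), ?_⟩
  intro a b ha hb ha0 hb0 he
  obtain ⟨δ, hδ, hδ0, hδe⟩ := key a ha ha0
  obtain ⟨δ', hδ', hδ0', hδe'⟩ := key b hb hb0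
  refine h.not_add δ δ' hδ hδ' hδ0 hδ0' ?_
  exact EqOnPi.of_supplement hB hL h.char.isClassFn (hδ.add hδ').isClassFn
    (he.trans (hδe.add hδe'))

theorem Indec.isIrrChar_comp_of_supplement {ζ : G → ℂ} (h : Indec σ ζ) (hs : IsSep σ G)
    {B : Subgroup G} [B.Normal] (hB : IsPiNumber σᶜ (Nat.card B)) {f : H →* G}
    (hf : Function.Injective f) (hL : f.range ⊔ B = ⊤) : IsIrrChar H (ζ ∘ f) :=
  (h.restrict_supplement hs hB hL).isIrrChar.comp_mulEquiv (MonoidHom.ofInjective hf)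

/-- Above a normal subgroup `D`, the constituents of the restriction to a subgroup normalized by a
supplement of a normal `σ'`-subgroup are permuted transitively. -/
theorem Indec.exists_mulEquiv_of_constituents {β : G → ℂ} (h : Indec σ β) (hs : IsSep σ G)
    {B L X D : Subgroup G} [B.Normal] [D.Normal] (hB : IsPiNumber σᶜ (Nat.card B))
    (hL : L ⊔ B = ⊤) (hXL : X ≤ L) (hXn : ∀ l ∈ L, ∀ x ∈ X, l * x * l⁻¹ ∈ X) (hBD : B ≤ D)
    (hXD : X ≤ D) {ν : D → ℂ} (hν : IsIrrChar D ν) (hβν : ip (β ∘ D.subtype) ν ≠ 0)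
    {κ κ' : X → ℂ} (hκ : IsIrrChar X κ) (hκ' : IsIrrChar X κ')
    (hνκ : ip (ν ∘ Subgroup.inclusion hXD) κ ≠ 0)
    (hνκ' : ip (ν ∘ Subgroup.inclusion hXD) κ' ≠ 0) :
    ∃ φ : X ≃* X, κ' = κ ∘ φ ∧
      (ν ∘ Subgroup.inclusion hXD) ∘ φ = ν ∘ Subgroup.inclusion hXD := by
  obtain ⟨ζ, hζ, hpush, a, ha, hζν⟩ := h.isIrrChar.exists_clifford hν hβν
  have hDT : D ≤ stab D ν := hν.1.isClassFn.le_stab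
  have hζi : Indec σ ζ := Indec.of_push (Subgroup.subtype_injective _) hζ.1 (hpush ▸ h)
  let K : Subgroup G := L ⊓ stab D ν
  have hXK : X ≤ K := le_inf hXL (hXD.trans hDT)
  have hKT : K ≤ stab D ν := inf_le_right
  have hBT : IsPiNumber σᶜ (Nat.card (B.subgroupOf (stab D ν))) := by
    rwa [Nat.card_congr (Subgroup.subgroupOfEquivOfLe (hBD.trans hDT)).toEquiv]
  have hζK : IsIrrChar K (ζ ∘ Subgroup.inclusion hKT) := by
    refine hζi.isIrrChar_comp_of_supplement (hs.subgroup _) hBT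
      (Subgroup.inclusion_injective hKT) ?_
    rw [eq_top_iff]
    rintro ⟨t, ht⟩ -
    have h1 : t ∈ L ⊔ B := hL ▸ Subgroup.mem_top t
    obtain ⟨l, hl, b, hb, rfl⟩ := Subgroup.mem_sup_of_normal_right.1 h1
    have hbT := hDT (hBD hb)
    have hlT : l ∈ stab D ν := (Subgroup.mul_mem_cancel_right _ hbT).1 ht
    have h2 : (⟨l, hlT⟩ : stab D ν) ∈ (Subgroup.inclusion hKT).range := ⟨⟨l, hl, hlT⟩, rfl⟩
    have h3 : (⟨b, hbT⟩ : stab D ν) ∈ B.subgroupOf (stab D ν) := hb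
    exact Subgroup.mul_mem_sup h2 h3
  let XK := X.subgroupOf K
  have hXKn : XK.Normal := ⟨fun x hx k => hXn k k.2.1 x hx⟩
  let e : XK ≃* X := Subgroup.subgroupOfEquivOfLe hXK
  have hres : (ζ ∘ Subgroup.inclusion hKT) ∘ XK.subtype =
      (a : ℂ) • ((ν ∘ Subgroup.inclusion hXD) ∘ e) := by
    ext x
    exact hζν ⟨x, hXD x.2⟩
  have hip : ∀ θ : X → ℂ, ip ((ζ ∘ Subgroup.inclusion hKT) ∘ XK.subtype) (θ ∘ e) =
      a * ip (ν ∘ Subgroup.inclusion hXD) θ := by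
    intro θ
    rw [hres, ip_smul_left, ip_comp_mulEquiv]
  have ha0 : (a : ℂ) ≠ 0 := Nat.cast_ne_zero.2 ha.ne'
  obtain ⟨g, hg⟩ := hζK.constituents_conj (hκ.comp_mulEquiv e) (hκ'.comp_mulEquiv e)
    (by rw [hip]; exact mul_ne_zero ha0 hνκ) (by rw [hip]; exact mul_ne_zero ha0 hνκ')
  have hcl := hζK.1.isClassFn.conjFn_comp (N := XK) g
  rw [hres] at hcl
  refine ⟨(e.symm.trans (MulAut.conjNormal g)).trans e, ?_, ?_⟩
  · ext x
    have := congrFun hg (e.symm x)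
    simpa [conjFn] using this
  · ext x
    have := congrFun hcl (e.symm x)
    simpa [conjFn, ha0] using this

end Supplements

section MinimalSupplement

variable {σ : Set ℕ} {G : Type} [Group G] [Finite G]

omit [Finite G] in
theorem relIndex_eq_card_map_mk (B K : Subgroup G) [B.Normal] :
    B.relIndex K = Nat.card (K.map (QuotientGroup.mk' B)) := by
  rw [← Subgroup.relIndex_ker, QuotientGroup.ker_mk']

/-- A minimal supplement of the maximal normal `σ'`-subgroup contains a nontrivial normal
`σ`-subgroup. -/
theorem exists_supplement_with_normal (hs : IsSep σ G) {B : Subgroup G} [hBn : B.Normal]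
    (hB : IsPiNumber σᶜ (Nat.card B))
    (hmax : ∀ N : Subgroup G, N.Normal → IsPiNumber σᶜ (Nat.card N) → N ≤ B) (hne : B ≠ ⊤) :
    ∃ L E : Subgroup G, L ⊔ B = ⊤ ∧ E ≤ L ∧ E ≠ ⊥ ∧ IsPiNumber σ (Nat.card E) ∧
      ∀ l ∈ L, ∀ e ∈ E, l * e * l⁻¹ ∈ E := by
  obtain ⟨L, hL, hmin⟩ := (Set.toFinite {L : Subgroup G | L ⊔ B = ⊤}).exists_minimal
    ⟨⊤, top_sup_eq _⟩
  have : Nontrivial (G ⧸ B) := by rwa [QuotientGroup.nontrivial_iff]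
  obtain ⟨M, hM, hM0, hMσ⟩ := (hs.quotient B).exists_normal_ne_bot
  let Y := M.comap (QuotientGroup.mk' B)
  have hBY : B ≤ Y := le_comap_mk B M
  have hYM : Y.map (QuotientGroup.mk' B) = M :=
    Subgroup.map_comap_eq_self_of_surjective (QuotientGroup.mk'_surjective B) M
  have hYB : ¬ Y ≤ B := by
    intro h
    rw [← QuotientGroup.ker_mk' B, ← Subgroup.map_eq_bot_iff, hYM] at h
    exact hM0 h
  have hMσ' : IsPiNumber σ (Nat.card M) := by
    refine hMσ.resolve_right fun h => hYB (hmax Y inferInstance ?_)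
    rw [← card_mul_relIndex hBY, relIndex_comap_mk]
    exact hB.mul h
  let O := B.subgroupOf L
  have hO : IsPiNumber σᶜ (Nat.card O) :=
    hB.dvd (Subgroup.card_comap_dvd_of_injective B L.subtype L.subtype_injective)
  have hOY : O ≤ Y.subgroupOf L := fun x hx => hBY hx
  have hrel : IsPiNumber σ (O.relIndex (Y.subgroupOf L)) := by
    refine hMσ'.dvd ?_
    rw [show O = B.comap L.subtype from rfl, Subgroup.relIndex_comap, relIndex_eq_card_map_mk]
    refine Subgroup.card_dvd_of_le ?_
    rw [← hYM]
    refine Subgroup.map_mono ?_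
    rintro _ ⟨y, hy, rfl⟩
    exact hy
  obtain ⟨E, hEn, hEσ, hEY⟩ := exists_normal_of_no_supplement hOY hO hrel (by
    intro L₁ h
    have h1 : L ≤ L₁.map L.subtype ⊔ B := by
      intro x hx
      have h2 : (⟨x, hx⟩ : L) ∈ O ⊔ L₁ := h ▸ Subgroup.mem_top _
      obtain ⟨o, ho, l, hl, he⟩ := Subgroup.mem_sup_of_normal_left.1 h2
      rw [sup_comm]
      have he' : (o : G) * l = x := congrArg Subtype.val he
      rw [← he']
      exact Subgroup.mul_mem_sup ho ⟨l, hl, rfl⟩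
    have h3 : L₁.map L.subtype ⊔ B = ⊤ := by
      rw [eq_top_iff, ← hL]
      exact sup_le h1 le_sup_right
    have h4 := hmin h3 (by
      rintro _ ⟨l, _, rfl⟩
      exact l.2)
    rw [eq_top_iff]
    intro l _
    obtain ⟨l', hl', he⟩ := h4 l.2
    rwa [← Subtype.ext (a1 := l') (a2 := l) he])
  refine ⟨L, E.map L.subtype, hL, ?_, ?_, ?_, ?_⟩
  · rintro _ ⟨l, _, rfl⟩
    exact l.2
  · intro h
    rw [Subgroup.map_eq_bot_iff_of_injective _ L.subtype_injective] at h
    rw [h, sup_bot_eq] at hEY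
    refine hYB fun y hy => ?_
    have h1 : y ∈ L ⊔ B := by rw [hL]; trivial
    obtain ⟨l, hl, b, hb, rfl⟩ := Subgroup.mem_sup_of_normal_right.1 h1
    have hlY : (⟨l, hl⟩ : L) ∈ Y.subgroupOf L :=
      (Subgroup.mul_mem_cancel_right Y (hBY hb)).1 hy
    rw [← hEY] at hlY
    exact mul_mem hlY hb
  · rwa [Subgroup.card_map_of_injective L.subtype_injective]
  · rintro l hl _ ⟨e, he, rfl⟩
    exact ⟨_, hEn.conj_mem e he ⟨l, hl⟩, rfl⟩

omit [Finite G] in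
theorem exists_normal_of_supplement {B L X : Subgroup G} [hBn : B.Normal] (hL : L ⊔ B = ⊤)
    (hXn : ∀ l ∈ L, ∀ x ∈ X, l * x * l⁻¹ ∈ X) (hX : IsPiNumber σ (Nat.card X)) :
    ∃ D : Subgroup G, D.Normal ∧ B ≤ D ∧ X ≤ D ∧ IsPiNumber σ (B.relIndex D) ∧
      ∀ d ∈ D, ∃ x ∈ X, x⁻¹ * d ∈ B := by
  have hn : (X.map (QuotientGroup.mk' B)).Normal := by
    refine ⟨?_⟩
    rintro _ ⟨x, hx, rfl⟩ q
    obtain ⟨g, rfl⟩ := QuotientGroup.mk'_surjective B q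
    have h1 : g ∈ L ⊔ B := by rw [hL]; trivial
    obtain ⟨l, hl, b, hb, rfl⟩ := Subgroup.mem_sup_of_normal_right.1 h1
    have h2 : QuotientGroup.mk' B b = 1 := (QuotientGroup.eq_one_iff _).2 hb
    exact ⟨_, hXn l hl x hx, by rw [map_mul (QuotientGroup.mk' B) l b, h2, mul_one]; simp⟩
  refine ⟨(X.map (QuotientGroup.mk' B)).comap (QuotientGroup.mk' B), inferInstance,
    le_comap_mk B _, Subgroup.le_comap_map _ _, ?_, ?_⟩
  · rw [relIndex_comap_mk]
    exact hX.dvd (Subgroup.card_map_dvd X _)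
  · rintro d ⟨x, hx, he⟩
    exact ⟨x, hx, QuotientGroup.eq.1 he⟩

end MinimalSupplement

section TrivialConstituents

variable {σ : Set ℕ} {G H : Type} [Group G] [Finite G] [Group H] [Finite H]

theorem IsCharacter.apply_eq_of_constituents {χ : G → ℂ} (hχ : IsCharacter G χ) {x : G}
    (h : ∀ θ, IsIrrChar G θ → ip χ θ ≠ 0 → θ x = θ 1) : χ x = χ 1 := by
  rw [hχ.isClassFn.eq_sum_irr, Finset.sum_apply, Finset.sum_apply]
  refine Finset.sum_congr rfl fun θ hθ => ?_
  by_cases h0 : ip χ θ = 0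
  · simp [h0]
  · simp [h θ (mem_irrChars.1 hθ) h0]

theorem IsCharacter.degree_dvd_of_constituents {χ : G → ℂ} (hχ : IsCharacter G χ) {n k : ℕ}
    (hn : χ 1 = n) (h : ∀ θ, IsIrrChar G θ → ip χ θ ≠ 0 → θ 1 = k) : k ∣ n := by
  refine hχ.induction_on (P := fun χ => (∀ θ, IsIrrChar G θ → ip χ θ ≠ 0 → θ 1 = k) →
    ∀ n : ℕ, χ 1 = n → k ∣ n) ?_ ?_ h n hn
  · intro _ n hn
    have : n = 0 := by
      have h1 : (0 : ℂ) = n := hn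
      exact_mod_cast h1.symm
    rw [this]
    exact dvd_zero k
  · intro θ ψ hθ hψ ih hk n hn
    have h1 : θ 1 = k := hk θ hθ (hθ.1.ip_add_ne_zero hψ hθ.1 (by
      rw [hθ.ip_self]
      exact one_ne_zero))
    obtain ⟨m, hm⟩ := hψ.exists_degree
    have h2 : k ∣ m := ih (fun η hη hne => hk η hη (by
      rw [add_comm]
      exact hψ.ip_add_ne_zero hθ.1 hη.1 hne)) m hm
    have h3 : (θ + ψ) 1 = θ 1 + ψ 1 := rfl
    rw [hn, h1, hm] at h3
    have h4 : n = k + m := by exact_mod_cast h3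
    rw [h4]
    exact (dvd_refl k).add h2

omit [Finite G] in
open scoped ComplexOrder in
/-- A real function with the sign behaviour of `mul_pos_of_commuting_involutions` has a linear
sign character. -/
theorem exists_sign_character {f : G → ℂ} (hr : ∀ x, star (f x) = f x) (hf : 0 < f 1)
    (hp : ∀ s t, 0 < f s * f t * f (s * t)) :
    ∃ l : G →* ℂ, (∀ x, l x = 1 ∨ l x = -1) ∧ (∀ x, 0 < f x * l x) ∧
      ∀ x y, f x = f y → l x = l y := by
  have hre : ∀ x, f x = ((f x).re : ℂ) := fun x => (Complex.conj_eq_iff_re.1 (hr x)).symm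
  have hp' : ∀ s t, 0 < (f s).re * (f t).re * (f (s * t)).re := by
    intro s t
    have h := hp s t
    rw [hre s, hre t, hre (s * t)] at h
    exact_mod_cast h
  have h1 : 0 < (f 1).re := by
    rw [hre 1] at hf
    exact_mod_cast hf
  have h0 : ∀ x, (f x).re ≠ 0 := by
    intro x hx
    have := hp' x 1
    simp [hx] at this
  refine ⟨⟨⟨fun x => if 0 < (f x).re then 1 else -1, if_pos h1⟩, fun s t => ?_⟩, fun x => ?_,
    fun x => ?_, fun x y hxy => ?_⟩
  · have h := hp' s t
    have hs := h0 s
    have ht := h0 t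
    rcases lt_or_gt_of_ne hs with hs | hs <;> rcases lt_or_gt_of_ne ht with ht | ht
    · have : 0 < (f (s * t)).re := pos_of_mul_pos_right h (mul_pos_of_neg_of_neg hs ht).le
      simp [this, hs.not_gt, ht.not_gt]
    · have : ¬ 0 < (f (s * t)).re := fun h' => absurd h
        (mul_neg_of_neg_of_pos (mul_neg_of_neg_of_pos hs ht) h').not_gt
      simp [this, hs.not_gt, ht]
    · have : ¬ 0 < (f (s * t)).re := fun h' => absurd h
        (mul_neg_of_neg_of_pos (mul_neg_of_pos_of_neg hs ht) h').not_gt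
      simp [this, hs, ht.not_gt]
    · have : 0 < (f (s * t)).re := pos_of_mul_pos_right h (mul_pos hs ht).le
      simp [this, hs, ht]
  · show (if _ then _ else _) = _ ∨ (if _ then _ else _) = _
    split_ifs <;> simp
  · show 0 < f x * (if _ then _ else _)
    rw [hre x, Complex.ofReal_re]
    split_ifs with h
    · rw [mul_one]
      exact_mod_cast h
    · rw [mul_neg_one]
      have := lt_of_le_of_ne (not_lt.1 h) (h0 x)
      rw [← Complex.ofReal_neg]
      exact_mod_cast neg_pos.2 this
  · show (if _ then _ else _) = (if _ then _ else _)
    rw [hxy]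

open scoped ComplexOrder in
theorem Special.constituents_of_exponent_two {ν : G → ℂ} (h2 : 2 ∈ σ) (hν : Special σᶜ G ν)
    {B : Subgroup G} [B.Normal] (hB : IsPiNumber σᶜ (Nat.card B)) (hi : IsPiNumber σ B.index)
    (hq : ∀ x y : G, QuotientGroup.mk' B x * QuotientGroup.mk' B y =
      QuotientGroup.mk' B y * QuotientGroup.mk' B x) (f : H →* G)
    (hH : ∀ x y : H, x * y = y * x) (he : ∀ x : H, x * x = 1)
    (htr : ∀ κ κ', IsIrrChar H κ → IsIrrChar H κ' → ip (ν ∘ f) κ ≠ 0 → ip (ν ∘ f) κ' ≠ 0 →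
      ∃ φ : H ≃* H, κ' = κ ∘ φ ∧ (ν ∘ f) ∘ φ = ν ∘ f) {κ : H → ℂ} (hκ : IsIrrChar H κ)
    (hne : ip (ν ∘ f) κ ≠ 0) (x : H) : κ x = κ 1 := by
  obtain ⟨n, hn, hnσ⟩ := hν.degree
  have hn2 : Odd n := by
    rw [← Nat.not_even_iff_odd, even_iff_two_dvd]
    exact fun h => hnσ 2 Nat.prime_two h h2
  have hfe : ∀ x, f x * f x = 1 := fun x => by rw [← map_mul, he, map_one]
  have hpos : 0 < ν 1 := by
    rw [hn]
    exact_mod_cast hn2.pos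
  have hB2 : IsPiNumber {2}ᶜ (Nat.card B) := fun q hq hd h => hB q hq hd (by
    rw [Set.mem_singleton_iff.1 h]
    exact h2)
  obtain ⟨l, hl, hlp, hle⟩ := exists_sign_character (f := ν ∘ f)
    (fun x => hν.irr.1.star_apply_of_involution (hfe x)) (by simpa using hpos) fun s t => by
      have := mul_pos_of_commuting_involutions hB2 hq hν.irr
        (hν.irr.restrict_of_coprime hn (hnσ.coprime' hi)) (hfe s) (hfe t)
        (by rw [← map_mul, hH, map_mul])
      simpa using this
  have hlne : ip (ν ∘ f) l ≠ 0 := by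
    let _ := Fintype.ofFinite H
    rw [ip_eq]
    refine mul_ne_zero (inv_ne_zero card_ne_zero') (ne_of_gt ?_)
    refine Finset.sum_pos (fun x _ => ?_) Finset.univ_nonempty
    rw [inv_eq_of_mul_eq_one_left (he x)]
    exact hlp x
  have huniq : ∀ κ, IsIrrChar H κ → ip (ν ∘ f) κ ≠ 0 → κ = l := by
    intro κ hκ hne
    obtain ⟨φ, rfl, hφ⟩ := htr l κ (isIrrChar_linear l) hκ hlne hne
    exact funext fun x => hle _ _ (congrFun hφ x)
  have hmul : ν ∘ f = n • (l : H → ℂ) := by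
    have h := (hν.irr.1.comp f).eq_smul_of_constituents (isIrrChar_linear l) huniq
    have h1 := congrFun h 1
    simp only [Function.comp_apply, map_one, hn, Pi.smul_apply, smul_eq_mul, mul_one] at h1
    rw [h, ← h1]
    ext x
    simp
  rw [huniq κ hκ hne, map_one]
  have hdet : (charDet ν).comp f = l ^ n := by
    rw [← charDet_comp hν.irr.1, hmul, charDet_nsmul (isCharacter_of_monoidHom l), charDet_linear]
  obtain ⟨m, hm⟩ : ∃ m, m = orderOf (charDet ν) := ⟨_, rfl⟩
  have hmo : Odd m := by
    rw [← Nat.not_even_iff_odd, even_iff_two_dvd]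
    exact fun h => hν.orderOf_det 2 Nat.prime_two (hm ▸ h) h2
  have h3 : l x ^ (n * m) = 1 := by
    have h4 := DFunLike.congr_fun hdet x
    rw [pow_mul, ← MonoidHom.pow_apply, ← h4, MonoidHom.comp_apply, ← MonoidHom.pow_apply, hm,
      pow_orderOf_eq_one, MonoidHom.one_apply]
  rcases hl x with h4 | h4
  · exact h4
  · rw [h4, (hn2.mul hmo).neg_one_pow] at h3
    rw [h4, h3]

end TrivialConstituents

section DegreeOne

variable {σ : Set ℕ} {G : Type} [Group G] [Finite G]

/-- Restricting through a normal subgroup, a character is trivial at an element if all relevant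
constituents are. -/
theorem IsCharacter.apply_eq_of_constituents_subgroup {β : G → ℂ} (hβ : IsCharacter G β)
    {D X : Subgroup G} (hXD : X ≤ D) (x : X)
    (h : ∀ ν, IsIrrChar D ν → ip (β ∘ D.subtype) ν ≠ 0 → ∀ κ, IsIrrChar X κ →
      ip (ν ∘ Subgroup.inclusion hXD) κ ≠ 0 → κ x = κ 1) : β x = β 1 := by
  refine (hβ.comp D.subtype).apply_eq_of_constituents (x := Subgroup.inclusion hXD x)
    fun ν hν hne => ?_
  have := (hν.1.comp (Subgroup.inclusion hXD)).apply_eq_of_constituents (x := x)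
    fun κ hκ hne' => h ν hν hne κ hκ hne'
  simpa using this

theorem IsCharacter.exists_faithful_quotient {β : G → ℂ} (hβ : IsCharacter G β) :
    ∃ (K : Subgroup G) (_ : K.Normal) (β' : G ⧸ K → ℂ), IsCharacter (G ⧸ K) β' ∧
      β = β' ∘ QuotientGroup.mk' K ∧
      ∀ M : Subgroup (G ⧸ K), (∀ k ∈ M, β' k = β' 1) → M = ⊥ := by
  let K : Subgroup G :=
    { carrier := {k | ∀ g, β (k * g) = β g}
      one_mem' := fun g => by rw [one_mul]
      mul_mem' := fun {a b} ha hb g => by rw [mul_assoc, ha, hb]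
      inv_mem' := fun {a} ha g => by rw [← ha, mul_inv_cancel_left] }
  have hK : K.Normal := by
    refine ⟨fun k hk x g => ?_⟩
    have h1 : x * k * x⁻¹ * g = x * (k * (x⁻¹ * g * x)) * x⁻¹ := by group
    rw [h1, hβ.conj_apply, hk, ← hβ.conj_apply x⁻¹ g, inv_inv]
  obtain ⟨β', hβ', he⟩ := hβ.exists_descent (QuotientGroup.mk'_surjective K) fun k hk => by
    rw [QuotientGroup.ker_mk'] at hk
    have := hk 1
    rwa [mul_one] at this
  refine ⟨K, hK, β', hβ', he, fun M hM => ?_⟩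
  rw [eq_bot_iff]
  intro q hq
  obtain ⟨x, rfl⟩ := QuotientGroup.mk'_surjective K q
  refine (QuotientGroup.eq_one_iff x).2 fun g => ?_
  have := hβ'.apply_mul_of_trivial M.subtype (fun k => hM k k.2) ⟨_, hq⟩ (QuotientGroup.mk' K g)
  rw [he, Function.comp_apply, Function.comp_apply, map_mul]
  exact this

omit [Finite G] in
theorem Indec.degree_eq_one_of_card {β : G → ℂ} (h : Indec σ β)
    (hG : IsPiNumber σᶜ (Nat.card G)) : β 1 = 1 := by
  obtain ⟨n, hn, hpos⟩ := h.isIrrChar.exists_degree_pos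
  obtain ⟨m, rfl⟩ : ∃ m, n = m + 1 := ⟨n - 1, by omega⟩
  by_contra hne
  have hm : m ≠ 0 := by
    rintro rfl
    exact hne (by simpa using hn)
  have h1 : IsCharacter G (1 : G → ℂ) := IsCharacter.one
  refine h.not_add 1 (m • 1) h1 (h1.nsmul m) one_ne_zero ?_ ?_
  · exact smul_ne_zero hm one_ne_zero
  · intro g hg
    have : g = 1 := IsPiElt.eq_one hg (isPiElt_of_card hG g)
    rw [this, hn]
    simp
    ring

/-- The elements of order dividing `q` in a commutative subgroup. -/
def powEqOneSubgroup (E : Subgroup G) (hE : ∀ x ∈ E, ∀ y ∈ E, x * y = y * x) (q : ℕ) :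
    Subgroup G where
  carrier := {e | e ∈ E ∧ e ^ q = 1}
  one_mem' := ⟨E.one_mem, one_pow q⟩
  mul_mem' := fun {a b} ha hb => ⟨E.mul_mem ha.1 hb.1, by
    rw [(show Commute a b from hE a ha.1 b hb.1).mul_pow, ha.2, hb.2, mul_one]⟩
  inv_mem' := fun {a} ha => ⟨E.inv_mem ha.1, by rw [inv_pow, ha.2, inv_one]⟩

theorem Indec.degree_eq_one_of_faithful {β : G → ℂ} (h : Indec σ β) (h2 : 2 ∈ σ)
    (hs : IsSep σ G) (hβ : Special σᶜ G β)
    (hf : ∀ K : Subgroup G, (∀ k ∈ K, β k = β 1) → K = ⊥) : β 1 = 1 := by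
  obtain ⟨B, hBn, hB, hmax⟩ := exists_piCore σᶜ G
  by_cases hne : B = ⊤
  · refine h.degree_eq_one_of_card ?_
    rw [hne] at hB
    rwa [← Subgroup.card_top]
  exfalso
  obtain ⟨L, E, hL, hEL, hE0, hE, hEn⟩ := exists_supplement_with_normal hs hB hmax hne
  have hspecial : ∀ {D : Subgroup G} [D.Normal] {ν : D → ℂ}, IsIrrChar D ν →
      ip (β ∘ D.subtype) ν ≠ 0 → Special σᶜ D ν := fun hν hne =>
    hβ.constituents_subtype _ hν hne
  have hcomm : ∀ x ∈ E, ∀ y ∈ E, x * y = y * x := by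
    intro x hx y hy
    obtain ⟨D, hDn, hBD, hED, hDi, -⟩ := exists_normal_of_supplement hL hEn hE
    have key : ∀ k ∈ Subgroup.zpowers (x * y * x⁻¹ * y⁻¹), β k = β 1 := by
      rintro _ ⟨m, rfl⟩
      have hm : ((((⟨x, hx⟩ : E) * ⟨y, hy⟩ * ⟨x, hx⟩⁻¹ * ⟨y, hy⟩⁻¹) ^ m : E) : G) =
          (x * y * x⁻¹ * y⁻¹) ^ m := rfl
      show β ((x * y * x⁻¹ * y⁻¹) ^ m) = β 1
      rw [← hm]
      refine h.char.apply_eq_of_constituents_subgroup hED _ fun ν hν hνne κ hκ hκne => ?_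
      obtain ⟨n, hn, hnσ⟩ := (hspecial hν hνne).degree
      obtain ⟨k, hk, -⟩ := hκ.exists_degree_pos
      have hdvd : k ∣ n := (hν.1.comp (Subgroup.inclusion hED)).degree_dvd_of_constituents
        (by simpa using hn) fun κ' hκ' hκne' => by
          obtain ⟨φ, rfl, -⟩ := h.exists_mulEquiv_of_constituents hs hB hL hEL hEn hBD hED hν hνne
            hκ hκ' hκne hκne'
          simpa using hk
      have hk1 : k = 1 := (hE.dvd (hκ.degree_dvd_card hk)).eq_one (hnσ.dvd hdvd)
      obtain ⟨l, rfl⟩ := hκ.1.exists_linear (by rw [hk, hk1, Nat.cast_one])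
      rw [map_zpow, map_mul, map_mul, map_mul, map_one]
      have h1 := l.mul_apply_inv ⟨x, hx⟩
      have h3 := l.mul_apply_inv ⟨y, hy⟩
      rw [show l ⟨x, hx⟩ * l ⟨y, hy⟩ * l ⟨x, hx⟩⁻¹ * l ⟨y, hy⟩⁻¹ =
        (l ⟨x, hx⟩ * l ⟨x, hx⟩⁻¹) * (l ⟨y, hy⟩ * l ⟨y, hy⟩⁻¹) by ring, h1, h3, one_mul, one_zpow]
    have h0 := hf _ key
    rw [Subgroup.zpowers_eq_bot, mul_inv_eq_one, mul_inv_eq_iff_eq_mul] at h0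
    exact h0
  obtain ⟨q, hq, hqE⟩ := Nat.exists_prime_and_dvd (fun h1 => hE0 (Subgroup.card_eq_one.1 h1) :
    Nat.card E ≠ 1)
  have : Fact q.Prime := ⟨hq⟩
  let X := powEqOneSubgroup E hcomm q
  have hXE : X ≤ E := fun x hx => hx.1
  have hXL : X ≤ L := hXE.trans hEL
  have hXn : ∀ l ∈ L, ∀ x ∈ X, l * x * l⁻¹ ∈ X := fun l hl x hx =>
    ⟨hEn l hl x hx.1, by rw [conj_pow, hx.2, mul_one, mul_inv_cancel]⟩
  have hX : IsPiNumber σ (Nat.card X) := hE.dvd (Subgroup.card_dvd_of_le hXE)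
  have hXc : ∀ x y : X, x * y = y * x := fun x y =>
    Subtype.ext (hcomm x (hXE x.2) y (hXE y.2))
  have hXp : ∀ x : X, x ^ q = 1 := fun x => Subtype.ext x.2.2
  have hqσ : IsPiNumber σ q := fun r hr hrq => hE r hr (hrq.trans hqE)
  obtain ⟨D, hDn, hBD, hXD, hDi, hD⟩ := exists_normal_of_supplement hL hXn hX
  have hX0 : X = ⊥ := by
    refine hf X fun x hx => ?_
    refine h.char.apply_eq_of_constituents_subgroup hXD ⟨x, hx⟩ fun ν hν hνne κ hκ hκne => ?_
    have hνs := hspecial hν hνne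
    have htr : ∀ κ κ' : X → ℂ, IsIrrChar X κ → IsIrrChar X κ' →
        ip (ν ∘ Subgroup.inclusion hXD) κ ≠ 0 → ip (ν ∘ Subgroup.inclusion hXD) κ' ≠ 0 →
        ∃ φ : X ≃* X, κ' = κ ∘ φ ∧
          (ν ∘ Subgroup.inclusion hXD) ∘ φ = ν ∘ Subgroup.inclusion hXD :=
      fun κ κ' hκ hκ' hne hne' => h.exists_mulEquiv_of_constituents hs hB hL hXL hXn hBD hXD hν
        hνne hκ hκ' hne hne'
    have hB' : IsPiNumber σᶜ (Nat.card (B.subgroupOf D)) :=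
      hB.dvd (Subgroup.card_comap_dvd_of_injective B D.subtype D.subtype_injective)
    rcases hq.eq_two_or_odd' with rfl | hodd
    · refine hνs.constituents_of_exponent_two h2 hB' hDi ?_ (Subgroup.inclusion hXD) hXc
        (fun x => by rw [← pow_two, hXp]) htr hκ hκne _
      have hDX : ∀ d : D, ∃ y : X, QuotientGroup.mk' (B.subgroupOf D) d =
          QuotientGroup.mk' (B.subgroupOf D) (Subgroup.inclusion hXD y) := by
        intro d
        obtain ⟨y, hy, hyd⟩ := hD d d.2
        exact ⟨⟨y, hy⟩, (QuotientGroup.eq (s := B.subgroupOf D)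
          (a := Subgroup.inclusion hXD ⟨y, hy⟩) (b := d)).2 hyd |>.symm⟩
      intro a b
      obtain ⟨y, hy⟩ := hDX a
      obtain ⟨z, hz⟩ := hDX b
      rw [hy, hz, ← map_mul, ← map_mul, ← map_mul, ← map_mul, hXc]
    · obtain ⟨n, hn, hnσ⟩ := hνs.degree
      have hno : Odd n := by
        rw [← Nat.not_even_iff_odd, even_iff_two_dvd]
        exact fun h => hnσ 2 Nat.prime_two h h2
      have h1 := hνs.ip_one_ne_zero_of_odd hB' hDi hqσ hodd hn hno (Subgroup.inclusion hXD) hXc hXp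
      obtain ⟨φ, rfl, -⟩ := htr 1 κ isIrrChar_one hκ h1 hκne
      rfl
  obtain ⟨g, hg⟩ := exists_prime_orderOf_dvd_card' q hqE
  have hgX : (g : G) ∈ X := ⟨g.2, by
    have := pow_orderOf_eq_one g
    rw [hg] at this
    simpa using congrArg Subtype.val this⟩
  rw [hX0, Subgroup.mem_bot] at hgX
  have hg1 : g = 1 := Subtype.ext hgX
  rw [hg1, orderOf_one] at hg
  exact hq.one_lt.ne hg

/-- If `2 ∈ σ`, a `σ'`-special character which is irreducible on `σ`-elements is linear. -/
theorem Indec.degree_eq_one {β : G → ℂ} (h : Indec σ β) (h2 : 2 ∈ σ)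
    (hs : IsSep σ G) (hβ : Special σᶜ G β) : β 1 = 1 := by
  obtain ⟨K, hK, β', hβ', rfl, hf⟩ := h.char.exists_faithful_quotient
  have := (h.of_comp (QuotientGroup.mk'_surjective K) hβ').degree_eq_one_of_faithful h2
    (hs.quotient K) (hβ.of_comp_surjective (QuotientGroup.mk'_surjective K) hβ') hf
  simpa using this

end DegreeOne

section Extension

variable {σ : Set ℕ} {G S J : Type} [Group G] [Finite G] [Group S] [Finite S] [Group J] [Finite J]

theorem IsCharacter.exists_common_constituent {a b : G → ℂ} (ha : IsCharacter G a)
    (h : ip a b ≠ 0) : ∃ ξ, IsIrrChar G ξ ∧ ip a ξ ≠ 0 ∧ ip ξ b ≠ 0 := by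
  rw [ha.isClassFn.eq_sum_irr, ip_sum_left] at h
  obtain ⟨ξ, hξ, hne⟩ := Finset.exists_ne_zero_of_sum_ne_zero h
  rw [ip_smul_left] at hne
  exact ⟨ξ, mem_irrChars.1 hξ, left_ne_zero_of_mul hne, right_ne_zero_of_mul hne⟩

/-- If restriction from `N` to `J` creates no new invariants, neither does restriction from
`G = N S` to `S`. -/
theorem IsCharacter.ip_one_comp_of_sup {χ : G → ℂ} (hχ : IsCharacter G χ) {N : Subgroup G}
    {i : S →* G} {p : J →* N} {q : J →* S} (hpq : N.subtype.comp p = i.comp q)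
    (hsup : N ⊔ i.range = ⊤)
    (h : ip (χ ∘ N.subtype) 1 = ip ((χ ∘ N.subtype) ∘ p) 1) : ip (χ ∘ i) 1 = ip χ 1 := by
  obtain ⟨V, _, _, _, ρ, rfl⟩ := hχ.exists_representation
  have h1 := Representation.ip_character_one_eq_finrank (ρ.comp N.subtype)
  have h2 := Representation.ip_character_one_eq_finrank ((ρ.comp N.subtype).comp p)
  have h3 : ip (ρ.character ∘ N.subtype) 1 = _ := h1
  have h4 : ip ((ρ.character ∘ N.subtype) ∘ p) 1 = _ := h2
  rw [h3, h4] at h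
  have h5 : Representation.invariants (ρ.comp N.subtype) =
      Representation.invariants ((ρ.comp N.subtype).comp p) :=
    Submodule.eq_of_le_of_finrank_eq (Representation.invariants_le_comp _ p) (by exact_mod_cast h)
  have h6 : Representation.invariants (ρ.comp i) = ρ.invariants := by
    refine le_antisymm (fun v hv => ?_) (ρ.invariants_le_comp i)
    have hvN : v ∈ Representation.invariants (ρ.comp N.subtype) := by
      rw [h5]
      intro j
      have := hv (q j)
      have he : N.subtype (p j) = i (q j) := DFunLike.congr_fun hpq j
      show ρ (N.subtype (p j)) v = v
      rw [he]
      exact this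
    let M : Subgroup G :=
      { carrier := {g | ρ g v = v}
        one_mem' := by simp
        mul_mem' := fun {a b} ha hb => by
          have ha' : ρ a v = v := ha
          have hb' : ρ b v = v := hb
          show ρ (a * b) v = v
          rw [map_mul, Module.End.mul_apply, hb', ha']
        inv_mem' := fun {a} ha => by
          have ha' : ρ a v = v := ha
          show ρ a⁻¹ v = v
          conv_lhs => rw [← ha']
          rw [← Module.End.mul_apply, ← map_mul, inv_mul_cancel, map_one, Module.End.one_apply] }
    have hM : N ⊔ i.range ≤ M := by
      refine sup_le (fun n hn => hvN ⟨n, hn⟩) ?_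
      rintro _ ⟨s, rfl⟩
      exact hv s
    intro g
    exact hM (by rw [hsup]; trivial)
  have h7 := Representation.ip_character_one_eq_finrank (ρ.comp i)
  rw [h6, ← ρ.ip_character_one_eq_finrank] at h7
  exact h7

theorem push_subtype_of_invariant {N : Subgroup G} [hN : N.Normal] {μ : N → ℂ}
    (hinv : ∀ g, conjFn N g μ = μ) (n : N) :
    push N.subtype μ n = (Nat.card N : ℂ)⁻¹ * Nat.card G * μ n := by
  let _ := Fintype.ofFinite G
  rw [push_subtype_apply_of_normal le_rfl, mul_assoc]
  congr 1
  have : ∀ x : G, μ ⟨x * n * x⁻¹, hN.conj_mem (n : G) n.2 x⟩ = μ n := fun x =>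
    (conjFn_apply x μ n).symm.trans (congrFun (hinv x) n)
  rw [Finset.sum_congr rfl fun x _ => this x, Finset.sum_const, Finset.card_univ,
    Fintype.card_eq_nat_card, nsmul_eq_mul]

theorem push_subtype_eq_zero {N : Subgroup G} [hN : N.Normal] {μ : N → ℂ} {g : G} (hg : g ∉ N) :
    push N.subtype μ g = 0 := by
  let _ := Fintype.ofFinite G
  let _ := Fintype.ofFinite N
  rw [push_apply]
  refine mul_eq_zero_of_right _ (Finset.sum_eq_zero fun x _ => Finset.sum_eq_zero fun n _ => ?_)
  refine if_neg fun h => hg ?_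
  have h1 := hN.conj_mem (n : G) n.2 x⁻¹
  have h2 : (n : G) = x * g * x⁻¹ := h
  rw [h2] at h1
  simpa [mul_assoc] using h1

theorem ip_push_comp_ne_zero {N : Subgroup G} [hN : N.Normal] {i : S →* G} {p : J →* N}
    {q : J →* S} (hq : Function.Injective q) (hpq : N.subtype.comp p = i.comp q)
    (hpb : ∀ s, i s ∈ N → ∃ j, q j = s) {μ : N → ℂ} (hinv : ∀ g, conjFn N g μ = μ)
    {ζ : S → ℂ} (h : ip (ζ ∘ q) (μ ∘ p) ≠ 0) : ip ζ (push N.subtype μ ∘ i) ≠ 0 := by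
  let _ := Fintype.ofFinite S
  let _ := Fintype.ofFinite J
  rw [ip_eq] at h ⊢
  refine mul_ne_zero (inv_ne_zero card_ne_zero') ?_
  have h1 : ∑ s : S, ζ s * (push N.subtype μ ∘ i) s⁻¹ =
      (Nat.card N : ℂ)⁻¹ * Nat.card G * ∑ j : J, (ζ ∘ q) j * (μ ∘ p) j⁻¹ := by
    rw [Finset.mul_sum]
    symm
    refine Finset.sum_of_injOn q hq.injOn (fun _ _ => Finset.mem_univ _) ?_ ?_
    · intro s _ hs
      have : i s⁻¹ ∉ N := fun hs' => hs (by
        rw [map_inv, N.inv_mem_iff] at hs'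
        obtain ⟨j, rfl⟩ := hpb s hs'
        exact ⟨j, by simp, rfl⟩)
      rw [Function.comp_apply, push_subtype_eq_zero this, mul_zero]
    · intro j _
      have he : i (q j)⁻¹ = (p j⁻¹ : N) := by
        rw [← map_inv]
        exact (DFunLike.congr_fun hpq j⁻¹).symm
      rw [Function.comp_apply, Function.comp_apply, Function.comp_apply, he,
        push_subtype_of_invariant hinv]
      ring
  rw [h1]
  exact mul_ne_zero (mul_ne_zero (inv_ne_zero card_ne_zero') card_ne_zero')
    (right_ne_zero_of_mul h)

/-- Let `G = N S` and `J = N ∩ S`.  An irreducible character of `S` above the restriction to `J`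
of an invariant character `μ` of `N` with `μ_J` irreducible extends to `G`. -/
theorem IsIrrChar.exists_extension {N : Subgroup G} [hN : N.Normal] {i : S →* G} {p : J →* N}
    {q : J →* S} (hq : Function.Injective q) (hpq : N.subtype.comp p = i.comp q)
    (hpb : ∀ s, i s ∈ N → ∃ j, q j = s) (hsup : N ⊔ i.range = ⊤) {μ : N → ℂ}
    (hμ : IsIrrChar N μ) (hμp : IsIrrChar J (μ ∘ p)) (hinv : ∀ g, conjFn N g μ = μ)
    {ζ : S → ℂ} (hζ : IsIrrChar S ζ) (h : ip (ζ ∘ q) (μ ∘ p) ≠ 0) :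
    ∃ ξ, IsIrrChar G ξ ∧ ξ ∘ i = ζ := by
  have h0 := ip_push_comp_ne_zero hq hpq hpb hinv h
  rw [← ip_push i ζ (isClassFn_push _ _)] at h0
  obtain ⟨ξ, hξ, h1, h2⟩ := (hζ.1.push i).exists_common_constituent h0
  rw [ip_push i ζ hξ.1.isClassFn, ip_comm] at h1
  rw [ip_comm, ip_push _ _ hξ.1.isClassFn, ip_comm] at h2
  obtain ⟨e, he⟩ := (hξ.1.comp N.subtype).exists_ip hμ.1
  have hhom := hξ.eq_smul_of_invariant hμ h2 hinv
  rw [he] at hhom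
  have key := (hξ.1.mul hξ.1.dual).ip_one_comp_of_sup hpq hsup (by
    have e1 : (ξ * dualFn ξ) ∘ N.subtype = (ξ ∘ N.subtype) * dualFn (ξ ∘ N.subtype) := rfl
    have e2 : ((ξ ∘ N.subtype) * dualFn (ξ ∘ N.subtype)) ∘ p =
        ((ξ ∘ N.subtype) ∘ p) * dualFn ((ξ ∘ N.subtype) ∘ p) := by
      ext x
      simp [dualFn_apply]
    rw [e1, e2, ← ip_eq_ip_one, ← ip_eq_ip_one, hhom]
    have e3 : ((e : ℂ) • μ) ∘ p = (e : ℂ) • (μ ∘ p) := rfl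
    rw [e3, ip_smul_left, ip_smul_left, ip_smul_right, ip_smul_right, hμ.ip_self, hμp.ip_self])
  have e4 : (ξ * dualFn ξ) ∘ i = (ξ ∘ i) * dualFn (ξ ∘ i) := by
    ext x
    simp [dualFn_apply]
  rw [e4, ← ip_eq_ip_one, ← ip_eq_ip_one, hξ.ip_self] at key
  exact ⟨ξ, hξ, ((hξ.1.comp i).isIrrChar_of_ip_self key).eq_of_ip_ne_zero hζ h1⟩

theorem Indec.surjective_of_extension {i : S →* G} (hi : Function.Injective i) {ζ : S → ℂ}
    (h : Indec σ (push i ζ)) {ξ : G → ℂ} (hξ : IsIrrChar G ξ) (he : EqOnPi σ ζ (ξ ∘ i)) :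
    Function.Surjective i := by
  have h1 : IsCharacter G (push i 1) := IsCharacter.one.push i
  obtain ⟨ω, hω, hωe⟩ := h1.exists_eq_add isIrrChar_one (by
    rw [ip_push i _ IsCharacter.one.isClassFn]
    have := (isIrrChar_one (G := S)).ip_self
    exact fun h => one_ne_zero (this.symm.trans h))
  have h2 : EqOnPi σ (push i ζ) (ξ + ξ * ω) := by
    have h3 := he.push hi
    have h4 : push i (ξ ∘ i) = ξ + ξ * ω := by
      rw [← mul_one (ξ ∘ i), push_comp_mul i 1 hξ.1.isClassFn, hωe, mul_add, mul_one]
    rwa [h4] at h3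
  have hω0 : ω = 0 := by
    by_contra hne
    refine h.not_add ξ (ξ * ω) hξ.1 (hξ.1.mul hω) hξ.2.1 (fun h0 => ?_) h2
    have h5 : ξ 1 * ω 1 = 0 := congrFun h0 1
    rcases mul_eq_zero.1 h5 with h5 | h5
    · exact hξ.apply_one_ne_zero h5
    · exact hne (hω.eq_zero_of_apply_one h5)
  have h6 := push_one_of_injective hi (1 : S → ℂ)
  rw [hωe, hω0] at h6
  simp only [add_zero, Pi.one_apply, mul_one] at h6
  have h7 : (Nat.card S : ℂ) = Nat.card G := by
    have := card_ne_zero' (G := S)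
    field_simp at h6
    exact h6
  exact ((Nat.bijective_iff_injective_and_card i).2 ⟨hi, by exact_mod_cast h7⟩).2

end Extension

section LocalFactorization

variable {σ : Set ℕ} {G S J : Type} [Group G] [Finite G] [Group S] [Finite S] [Group J] [Finite J]

/-- If `ζ` agrees on `σ`-elements with a character above the restriction of an invariant
character `μ` of `N` with `μ_J` irreducible, then the induced character can only be
`σ`-indecomposable if `N` is contained in `S`. -/
theorem Indec.le_range_of_extension {N : Subgroup G} [hN : N.Normal] {i : S →* G} {p : J →* N}
    {q : J →* S} (hi : Function.Injective i) (hq : Function.Injective q)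
    (hpq : N.subtype.comp p = i.comp q) (hpb : ∀ s, i s ∈ N → ∃ j, q j = s) {μ : N → ℂ}
    (hμ : IsIrrChar N μ) (hμp : IsIrrChar J (μ ∘ p)) (hinv : ∀ s, conjFn N (i s) μ = μ)
    {ζ ζ₁ : S → ℂ} (hζ : IsCharacter S ζ) (h : Indec σ (push i ζ)) (hζ₁ : IsIrrChar S ζ₁)
    (hne : ip (ζ₁ ∘ q) (μ ∘ p) ≠ 0) (he : EqOnPi σ ζ ζ₁) : N ≤ i.range := by
  set M : Subgroup G := N ⊔ i.range with hM
  have hNM : N ≤ M := le_sup_left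
  have hiM : ∀ s, i s ∈ M := fun s => (le_sup_right : i.range ≤ M) ⟨s, rfl⟩
  let e : N.subgroupOf M ≃* N := Subgroup.subgroupOfEquivOfLe hNM
  let i' : S →* M := i.codRestrict M hiM
  let p' : J →* N.subgroupOf M := e.symm.toMonoidHom.comp p
  have hi' : Function.Injective i' := fun a b hab => hi (congrArg Subtype.val hab)
  have hcomp : M.subtype.comp i' = i := rfl
  have hstab : M ≤ stab N μ := by
    refine sup_le hμ.1.isClassFn.le_stab ?_
    rintro _ ⟨s, rfl⟩
    exact mem_stab.2 (hinv s)
  have hμe : (μ ∘ e) ∘ p' = μ ∘ p := by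
    ext j
    simp [p']
  have hpq' : ((N.subgroupOf M).subtype).comp p' = i'.comp q := by
    ext j
    exact DFunLike.congr_fun hpq j
  have hsup : N.subgroupOf M ⊔ i'.range = ⊤ := by
    have h1 : i'.range = i.range.subgroupOf M := by
      ext x
      constructor
      · rintro ⟨s, rfl⟩
        exact ⟨s, rfl⟩
      · rintro ⟨s, hs⟩
        exact ⟨s, Subtype.ext hs⟩
    rw [h1, ← Subgroup.subgroupOf_sup hNM le_sup_right, Subgroup.subgroupOf_self]
  have hinv' : ∀ g, conjFn (N.subgroupOf M) g (μ ∘ e) = μ ∘ e := by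
    intro g
    ext n
    rw [conjFn_apply]
    have h2 := congrFun (mem_stab.1 (hstab g.2)) (e n)
    rw [conjFn_apply] at h2
    exact h2
  have hdec : Indec σ (push i' ζ) := by
    refine Indec.of_push M.subtype_injective (hζ.push i') ?_
    rwa [push_push, hcomp]
  obtain ⟨ξ, hξ, hξζ⟩ := IsIrrChar.exists_extension (i := i') hq hpq'
    (fun s hs => hpb s hs) hsup (hμ.comp_mulEquiv e) (by rwa [hμe]) hinv' hζ₁ (by rwa [hμe])
  have hsurj := hdec.surjective_of_extension hi' hξ (by rwa [hξζ])
  intro n hn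
  obtain ⟨s, hs⟩ := hsurj ⟨n, hNM hn⟩
  exact ⟨s, congrArg Subtype.val hs⟩

theorem Special.comp_of_index {χ : G → ℂ} (h : Special σ G χ) {f : S →* G}
    (hf : Function.Injective f) (hn : f.range.Normal) (hi : IsPiNumber σᶜ f.range.index) :
    Special σ S (χ ∘ f) := by
  have h1 := (h.restrict hi).irr.comp_mulEquiv (MonoidHom.ofInjective hf)
  refine h.constituent hf hn h1 ?_
  have h2 := h1.ip_self
  exact fun h0 => one_ne_zero (h2.symm.trans h0)

omit [Finite S] in
theorem Special.eq_of_comp {χ κ : G → ℂ} (h : Special σ G χ) (hκ : Special σ G κ) {f : S →* G}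
    (hn : f.range.Normal) (hi : IsPiNumber σᶜ f.range.index) (he : χ ∘ f = κ ∘ f) : χ = κ := by
  refine h.eq_of_restrict hκ hi ?_
  ext ⟨_, s, rfl⟩
  exact congrFun he s

theorem IsIrrChar.comp_of_coprime {χ : G → ℂ} (hχ : IsIrrChar G χ) {d : ℕ} (hd : χ 1 = d)
    {f : S →* G} (hf : Function.Injective f) (hn : f.range.Normal)
    (hc : d.Coprime f.range.index) : IsIrrChar S (χ ∘ f) :=
  (hχ.restrict_of_coprime hd hc).comp_mulEquiv (MonoidHom.ofInjective hf)

/-- The inner product formula for products of `σ`-special and `σᶜ`-special characters, when the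
second factors are replaced by characters with `σᶜ`-special constituents. -/
theorem Special.ip_mul_mul_of_constituents (hs : IsSep σ G) {μ μ' A B : G → ℂ}
    (hμ : Special σ G μ) (hμ' : Special σ G μ') (hA : IsCharacter G A) (hB : IsCharacter G B)
    (hA' : ∀ θ, IsIrrChar G θ → ip A θ ≠ 0 → Special σᶜ G θ)
    (hB' : ∀ θ, IsIrrChar G θ → ip B θ ≠ 0 → Special σᶜ G θ) :
    ip (μ * A) (μ' * B) = ip μ μ' * ip A B :=
  IsCharacter.ip_mul_eq_of_constituents hA hB hA' hB' fun _ _ ha hb =>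
    Special.ip_mul_mul hs hμ hμ' ha hb

/-- An irreducible character of `σ`-degree lying under a product of a `σ`-special and a
`σᶜ`-special character, along a homomorphism that is an isomorphism up to `σᶜ`-indices, is the
restriction of the `σ`-special character times a linear character of `σᶜ`-order. -/
theorem exists_linear_factor {N K : Type} [Group N] [Finite N] [Group K] [Finite K]
    {p : J →* N} {k : K →* J} (hk : Function.Injective k) (hkn : k.range.Normal)
    (hki : IsPiNumber σᶜ k.range.index) (hpk : Function.Injective (p.comp k))
    (hpkn : (p.comp k).range.Normal) (hpki : IsPiNumber σᶜ (p.comp k).range.index)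
    (hs : IsSep σ K) {μ ν : N → ℂ} (hμ : Special σ N μ) (hν : Special σᶜ N ν) {ρ : J → ℂ}
    (hρ : IsIrrChar J ρ) {r : ℕ} (hr : ρ 1 = r) (hrσ : IsPiNumber σ r)
    (hne : ip ((μ * ν) ∘ p) ρ ≠ 0) :
    ∃ δ : J →* ℂ, ρ = (μ ∘ p) * δ ∧ Special σᶜ K (δ.comp k) ∧
      Special σ K (μ ∘ p.comp k) ∧ IsIrrChar J (μ ∘ p) ∧
      ∃ D, 0 < D ∧ IsPiNumber σᶜ D ∧ δ ^ D = 1 := by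
  have hμK : Special σ K (μ ∘ p.comp k) := hμ.comp_of_index hpk hpkn hpki
  have hμJ : IsIrrChar J (μ ∘ p) := (hμ.irr.1.comp p).isIrrChar_of_comp k hμK.irr
  have hνJ : IsCharacter J (ν ∘ p) := hν.irr.1.comp p
  have h1 : ip (ν ∘ p) (dualFn (μ ∘ p) * ρ) ≠ 0 := by
    rw [← ip_mul_left]
    exact hne
  obtain ⟨δ, hδ, hδν, hδρ⟩ := hνJ.exists_common_constituent h1
  rw [← ip_mul_left] at hδρ
  have hδK : ∀ θ, IsIrrChar K θ → ip (δ ∘ k) θ ≠ 0 → Special σᶜ K θ := fun θ hθ hne' =>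
    hν.constituent hpk hpkn hθ (hνJ.ip_comp_ne_zero_trans hδ hδν k hθ.1 hne')
  have hip : ip (((μ ∘ p) * δ) ∘ k) (((μ ∘ p) * δ) ∘ k) = ip (δ ∘ k) (δ ∘ k) := by
    have h2 := Special.ip_mul_mul_of_constituents hs hμK hμK (hδ.1.comp k) (hδ.1.comp k) hδK hδK
    rw [hμK.irr.ip_self, one_mul] at h2
    exact h2
  have hirr : IsIrrChar J ((μ ∘ p) * δ) := by
    refine (hμJ.1.mul hδ.1).isIrrChar_of_ip_self ?_
    rw [ip_mul_of_restrict hμJ hδ.1 hδ.1 k hip, hδ.ip_self]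
  have hρe : (μ ∘ p) * δ = ρ := hirr.eq_of_ip_ne_zero hρ hδρ
  have hδKirr : IsIrrChar K (δ ∘ k) := by
    refine (hδ.1.comp k).isIrrChar_of_ip_self ?_
    rw [← hip, hρe]
    exact (hρ.comp_of_coprime hr hk hkn (hrσ.coprime hki)).ip_self
  have hδs : Special σᶜ K (δ ∘ k) := hδK _ hδKirr fun h0 =>
    one_ne_zero (hδKirr.ip_self.symm.trans h0)
  have hδ1 : δ 1 = 1 := by
    obtain ⟨d, hd, hdσ⟩ := hδs.degree
    obtain ⟨m, hm, -⟩ := hμJ.exists_degree_pos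
    have hd' : δ 1 = d := by
      rw [← hd, Function.comp_apply, map_one]
    have h3 : r = m * d := by
      have h4 := congrFun hρe 1
      rw [Pi.mul_apply, hm, hd', hr] at h4
      exact_mod_cast h4.symm
    rw [hd', (hrσ.dvd ⟨m, by rw [h3, mul_comm]⟩ : IsPiNumber σ d).eq_one hdσ, Nat.cast_one]
  obtain ⟨l, rfl⟩ := hδ.1.exists_linear hδ1
  refine ⟨l, hρe.symm, hδs, hμK, hμJ, orderOf (l.comp k) * k.range.index, ?_, ?_, ?_⟩
  · refine Nat.mul_pos (orderOf_pos_iff.2 ?_) (Nat.pos_of_ne_zero k.range.index_ne_zero_of_finite)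
    exact isOfFinOrder_iff_pow_eq_one.2 ⟨_, Nat.card_pos, MonoidHom.pow_card_eq_one _⟩
  · refine IsPiNumber.mul ?_ hki
    have h5 := hδs.orderOf_det
    have h6 : (l : J → ℂ) ∘ k = (l.comp k : K →* ℂ) := rfl
    rwa [h6, charDet_linear] at h5
  · ext x
    obtain ⟨y, hy⟩ := k.range.pow_index_mem x
    have h7 := DFunLike.congr_fun (pow_orderOf_eq_one (l.comp k)) y
    rw [MonoidHom.pow_apply, MonoidHom.comp_apply, hy, map_pow, MonoidHom.one_apply] at h7
    rw [MonoidHom.pow_apply, MonoidHom.one_apply, mul_comm, pow_mul, h7]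

/-- A character above a multiple of `μ δ` with `δ` linear of `σᶜ`-order can be twisted by a
linear character of `σᶜ`-order to remove `δ`. -/
theorem IsIrrChar.exists_twist {q : J →* S} {ζ : S → ℂ} (hζ : IsIrrChar S ζ) {μ : J → ℂ}
    (hμ : IsCharacter J μ) {a m : ℕ} {δ : J →* ℂ} (hζq : ζ ∘ q = (a : ℂ) • (μ * δ))
    (hm : μ 1 = m) (ham : IsPiNumber σ (a * m)) {k D : ℕ} (hk : IsPiNumber σ k)
    (hμk : charDet μ ^ k = 1) (hD0 : 0 < D) (hD : IsPiNumber σᶜ D) (hδ : δ ^ D = 1) :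
    ∃ L : S →* ℂ, EqOnPi σ ζ (⇑L * ζ) ∧ IsIrrChar S (⇑L * ζ) ∧ (⇑L * ζ) ∘ q = (a : ℂ) • μ := by
  obtain ⟨u, v, huv, hu, hv⟩ := exists_pi_factorization σ (Nat.card_pos (α := S)).ne'
  have hx : IsPiNumber σ (a * m * u * k) := (ham.mul hu).mul hk
  obtain ⟨w, hw0, hw1⟩ := Nat.chineseRemainder (hx.coprime hD) 0 (D - 1)
  obtain ⟨t, rfl⟩ := (Nat.modEq_zero_iff_dvd.1 hw0)
  have hDt : D ∣ a * m * u * k * t + 1 := by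
    have h1 := hw1.add_right 1
    rw [Nat.sub_add_cancel hD0] at h1
    exact (Nat.modEq_zero_iff_dvd.1 (h1.trans (Nat.modEq_zero_iff_dvd.2 dvd_rfl)))
  have hdet : (charDet ζ).comp q = (δ ^ m * charDet μ) ^ a := by
    rw [← charDet_comp hζ.1, hζq, mul_comm μ, ← charDet_mul_linear hμ δ hm,
      ← charDet_nsmul ((isCharacter_of_monoidHom δ).mul hμ)]
    congr 1
    ext x
    simp
  have hLq : ((charDet ζ) ^ (u * k * t)).comp q = δ ^ (a * m * u * k * t) := by
    have h2 : ((charDet ζ) ^ (u * k * t)).comp q = ((charDet ζ).comp q) ^ (u * k * t) := by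
      ext x
      simp
    have h3 : charDet μ ^ (a * (u * k * t)) = 1 := by
      rw [show a * (u * k * t) = k * (a * u * t) by ring, pow_mul, hμk, one_pow]
    rw [h2, hdet, ← pow_mul, mul_pow, h3, mul_one, ← pow_mul]
    congr 1
    ring
  have hLv : ((charDet ζ) ^ (u * k * t)) ^ v = 1 := by
    rw [← pow_mul, show u * k * t * v = Nat.card S * (k * t) by rw [huv]; ring, pow_mul,
      MonoidHom.pow_card_eq_one, one_pow]
  refine ⟨charDet ζ ^ (u * k * t), fun s hs => ?_, hζ.mul_linear _, ?_⟩
  · have h4 : (charDet ζ ^ (u * k * t)) s = 1 := by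
      refine eq_one_of_pow_coprime (IsPiNumber.coprime hs hv) ?_ ?_
      · rw [← map_pow, pow_orderOf_eq_one, map_one]
      · rw [← MonoidHom.pow_apply, hLv, MonoidHom.one_apply]
    rw [Pi.mul_apply, h4, one_mul]
  · ext j
    have h5 : (charDet ζ ^ (u * k * t)) (q j) * δ j = 1 := by
      obtain ⟨e, he⟩ := hDt
      have h6 := DFunLike.congr_fun hLq j
      rw [MonoidHom.comp_apply] at h6
      rw [h6, MonoidHom.pow_apply, ← pow_succ, he, pow_mul, ← MonoidHom.pow_apply, hδ,
        MonoidHom.one_apply, one_pow]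
    have h7 := congrFun hζq j
    simp only [Function.comp_apply, Pi.smul_apply, Pi.mul_apply, smul_eq_mul] at h7 ⊢
    rw [h7, mul_left_comm, mul_left_comm _ (μ j), h5, mul_one]

end LocalFactorization

section Step

variable {σ : Set ℕ} {G H : Type} [Group G] [Finite G] [Group H] [Finite H]

theorem Special.comp_mulEquiv {χ : G → ℂ} (h : Special σ G χ) (e : H ≃* G) :
    Special σ H (χ ∘ e) := by
  have hr : e.toMonoidHom.range = ⊤ := MonoidHom.range_eq_top.2 e.surjective
  refine h.comp_of_index (f := e.toMonoidHom) e.injective ?_ ?_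
  · rw [hr]
    infer_instance
  · rw [hr, Subgroup.index_top]
    exact isPiNumber_one _

/-- The special factors of a product are determined by the product. -/
theorem Special.eq_of_mul_eq_mul (hs : IsSep σ G) {μ μ' ν ν' : G → ℂ} (hμ : Special σ G μ)
    (hμ' : Special σ G μ') (hν : Special σᶜ G ν) (hν' : Special σᶜ G ν')
    (h : μ * ν = μ' * ν') : μ = μ' := by
  refine hμ.irr.eq_of_ip_ne_zero hμ'.irr fun h0 => ?_
  have h1 := Special.ip_mul_mul hs hμ hμ' hν hν'
  have h2 := Special.ip_mul_mul hs hμ hμ hν hν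
  rw [h0, zero_mul, ← h, h2, hμ.irr.ip_self, hν.irr.ip_self, one_mul] at h1
  exact one_ne_zero h1

/-- Let `N / K` be a `σᶜ`-group and `K ≤ T`.  If a character of `σ`-degree of `T` induces a
`σ`-indecomposable character whose restriction to `N` has factored constituents,
then `N ≤ T`. -/
theorem Indec.le_of_factored (hs : IsSep σ G) {K N T : Subgroup G} [hK : K.Normal]
    [hN : N.Normal] (hKN : K ≤ N) (hKT : K ≤ T) (hi : IsPiNumber σᶜ (K.relIndex N))
    {η : T → ℂ} (hη : IsIrrChar T η) {n : ℕ} (hη1 : η 1 = n) (hn : IsPiNumber σ n)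
    (h : Indec σ (push T.subtype η))
    (hfac : ∀ θ, IsIrrChar N θ → ip (push T.subtype η ∘ N.subtype) θ ≠ 0 →
      ∃ μ ν, Special σ N μ ∧ Special σᶜ N ν ∧ θ = μ * ν) : N ≤ T := by
  let J : Subgroup T := N.subgroupOf T
  let p : J →* N := T.subtype.subgroupComap N
  let k : K →* J := (Subgroup.inclusion hKT).codRestrict J fun x => hKN x.2
  have hpk : p.comp k = Subgroup.inclusion hKN := rfl
  have hpkr : (p.comp k).range = K.subgroupOf N := by
    rw [hpk, Subgroup.inclusion_range]
  have hkr : k.range = (K.subgroupOf N).comap p := by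
    ext x
    constructor
    · rintro ⟨y, rfl⟩
      exact y.2
    · intro hx
      exact ⟨⟨x, hx⟩, rfl⟩
  have hki : IsPiNumber σᶜ k.range.index := by
    rw [hkr, Subgroup.index_comap]
    exact hi.dvd (Subgroup.relIndex_dvd_index_of_normal _ _)
  have hkn : k.range.Normal := by
    rw [hkr]
    infer_instance
  have hpkn : (p.comp k).range.Normal := by
    rw [hpkr]
    infer_instance
  have hpki : IsPiNumber σᶜ (p.comp k).range.index := by
    rw [hpkr]
    exact hi
  have hkinj : Function.Injective k := fun x y hxy =>
    Subtype.ext (congrArg (fun z : J => ((z : T) : G)) hxy)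
  have hpkinj : Function.Injective (p.comp k) := Subgroup.inclusion_injective hKN
  have hsK : IsSep σ K := hs.subgroup K
  obtain ⟨ρ, hρ, hρη⟩ := hη.1.exists_irr_comp hη.2.1 J.subtype
  obtain ⟨r, hr, -⟩ := hρ.exists_degree_pos
  have hrσ : IsPiNumber σ r := hn.dvd (hη.degree_dvd hρ hρη hr hη1)
  have hχ : IsCharacter G (push T.subtype η) := hη.1.push _
  have hχη : ip (push T.subtype η ∘ T.subtype) η ≠ 0 := by
    rw [ip_comm, ← ip_push _ _ hχ.isClassFn]
    exact hχ.ip_self_ne_zero h.ne_zero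
  obtain ⟨θ, hθ, hθχ, hθρ⟩ := (hχ.comp N.subtype).exists_between p
    ((hχ.comp T.subtype).ip_comp_ne_zero_trans hη hχη J.subtype hρ.1 hρη)
  obtain ⟨μ, ν, hμ, hν, rfl⟩ := hfac θ hθ hθχ
  obtain ⟨δ, hρe, hδK, hμK, hμJ, D, hD0, hD, hδD⟩ := exists_linear_factor hkinj hkn hki hpkinj
    hpkn hpki hsK hμ hν hρ hr hrσ hθρ
  obtain ⟨ζ, hζ, hηζ, a, ha, hζρ⟩ := hη.exists_clifford hρ hρη
  let q : J →* stab J ρ := Subgroup.inclusion hρ.1.isClassFn.le_stab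
  obtain ⟨m, hm, -⟩ := hμJ.exists_degree_pos
  have hζq : ζ ∘ q = (a : ℂ) • ((μ ∘ p) * δ) := by
    rw [← hρe]
    ext x
    exact hζρ x
  have ham : IsPiNumber σ (a * m) := by
    refine hn.dvd ⟨(stab J ρ).index, ?_⟩
    have h1 : ζ 1 = (a * m : ℕ) := by
      have h2 := congrFun hζq 1
      rw [Function.comp_apply, map_one, Pi.smul_apply, Pi.mul_apply, hm, map_one, mul_one,
        smul_eq_mul] at h2
      rw [h2, Nat.cast_mul]
    have h3 := push_one_of_injective (stab J ρ).subtype_injective ζ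
    rw [← hηζ, hη1, h1, ← (stab J ρ).index_mul_card, Nat.cast_mul,
      mul_div_cancel_right₀ _ card_ne_zero'] at h3
    rw [mul_comm]
    exact_mod_cast h3
  obtain ⟨L, hL, hLζ, hLq⟩ := hζ.exists_twist hμJ.1 hζq hm ham hμ.orderOf_det (by
    rw [charDet_comp hμ.irr.1]
    ext x
    rw [MonoidHom.pow_apply, MonoidHom.comp_apply, ← MonoidHom.pow_apply, pow_orderOf_eq_one]
    rfl) hD0 hD hδD
  have hinv : ∀ s : stab J ρ, conjFn N (T.subtype.comp (stab J ρ).subtype s) μ = μ := by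
    intro s
    let g : G := ((s : T) : G)
    have hc : (conjFn N g μ) ∘ (p.comp k) = (μ ∘ p.comp k) ∘ (MulAut.conjNormal g : K ≃* K) := rfl
    have hsp : Special σ N (conjFn N g μ) := hμ.comp_mulEquiv (MulAut.conjNormal g : N ≃* N)
    refine hsp.eq_of_comp hμ hpkn hpki ?_
    rw [hc]
    refine Special.eq_of_mul_eq_mul hsK (hμK.comp_mulEquiv _) hμK (hδK.comp_mulEquiv
      (MulAut.conjNormal g : K ≃* K)) hδK ?_
    have h4 : (conjFn J (s : T) ρ) ∘ k = ρ ∘ k := by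
      rw [mem_stab.1 s.2]
    have h5 : ∀ y, ρ y = ((μ ∘ p) * δ) y := congrFun hρe
    ext x
    exact (h5 _).symm.trans ((congrFun h4 x).trans (h5 _))
  have hle := Indec.le_range_of_extension (i := T.subtype.comp (stab J ρ).subtype)
    (T.subtype_injective.comp (stab J ρ).subtype_injective)
    (Subgroup.inclusion_injective hρ.1.isClassFn.le_stab : Function.Injective q)
    (p := p) rfl (fun s hs' => ⟨⟨s, hs'⟩, rfl⟩) hμ.irr hμJ hinv hζ.1
    (by rw [← push_push, ← hηζ]; exact h) hLζ
    (by
      rw [hLq, ip_smul_left, hμJ.ip_self, mul_one]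
      exact_mod_cast ha.ne') hL
  intro x hx
  obtain ⟨s, rfl⟩ := hle hx
  exact (s : T).2

end Step

section Main

variable {σ : Set ℕ} {G : Type} [Group G] [Finite G]

theorem relIndex_sup_of_normal {N T : Subgroup G} [hN : N.Normal] :
    T.relIndex (N ⊔ T) = T.relIndex N := by
  have h1 := Subgroup.relIndex_mul_relIndex (N ⊓ T) T (N ⊔ T) inf_le_right le_sup_right
  have h2 := Subgroup.relIndex_mul_relIndex (N ⊓ T) N (N ⊔ T) inf_le_left le_sup_left
  rw [← h2, Subgroup.inf_relIndex_right, Subgroup.inf_relIndex_left,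
    Subgroup.relIndex_sup_left, mul_comm] at h1
  exact Nat.eq_of_mul_eq_mul_right (Nat.pos_of_ne_zero Subgroup.index_ne_zero_of_finite) h1

/-- Constituents of the restriction of a product of special characters to a normal subgroup are
again products of special characters. -/
theorem Special.exists_factors {H : Type} [Group H] [Finite H] (hs : IsSep σ H) {μ ν : G → ℂ}
    (hμ : Special σ G μ) (hν : Special σᶜ G ν) {f : H →* G} (hf : Function.Injective f)
    (hn : f.range.Normal) {κ : H → ℂ} (hκ : IsIrrChar H κ) (h : ip ((μ * ν) ∘ f) κ ≠ 0) :
    ∃ a b, Special σ H a ∧ Special σᶜ H b ∧ κ = a * b := by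
  have hμf := hμ.irr.1.comp f
  have hνf := hν.irr.1.comp f
  have h1 : ip (ν ∘ f) (dualFn (μ ∘ f) * κ) ≠ 0 := by
    rw [← ip_mul_left]
    exact h
  obtain ⟨b, hb, hbν, hb'⟩ := hνf.exists_common_constituent h1
  rw [← ip_mul_left, mul_comm, ip_mul_left] at hb'
  obtain ⟨a, ha, haμ, ha'⟩ := hμf.exists_common_constituent hb'
  rw [← ip_mul_left, mul_comm] at ha'
  have has := hμ.constituent hf hn ha haμ
  have hbs := hν.constituent hf hn hb hbν
  refine ⟨a, b, has, hbs, ?_⟩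
  refine (((ha.1.mul hb.1).isIrrChar_of_ip_self ?_).eq_of_ip_ne_zero hκ ha').symm
  rw [Special.ip_mul_mul hs has has hbs hbs, ha.ip_self, hb.ip_self, one_mul]

theorem Indec.isPiNumber_relIndex (hs : IsSep σ G) {U : Subgroup G} {η : U → ℂ}
    (hη : IsCharacter U η) {n : ℕ} (hη1 : η 1 = n) (hn : IsPiNumber σ n)
    (h : Indec σ (push U.subtype η)) {N : Subgroup G} (hN : N.Normal)
    (hfac : ∀ θ, IsIrrChar N θ → ip (push U.subtype η ∘ N.subtype) θ ≠ 0 →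
      ∃ μ ν, Special σ N μ ∧ Special σᶜ N ν ∧ θ = μ * ν) :
    IsPiNumber σ (U.relIndex (N ⊔ U)) := by
  induction hc : Nat.card N using Nat.strong_induction_on generalizing N with
  | _ c ih =>
  by_cases hbot : N = ⊥
  · rw [hbot, bot_sup_eq, Subgroup.relIndex_self]
    exact isPiNumber_one _
  obtain ⟨K, hK, hKN, hi⟩ := exists_normal_relIndex hs hbot
  have hlt : Nat.card K < c := by
    rw [← hc]
    exact Set.ncard_lt_ncard (SetLike.coe_ssubset_coe.2 hKN) (Set.toFinite _)
  have hKT := ih _ hlt hK (fun κ hκ hne => by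
    obtain ⟨θ, hθ, hθχ, hθκ⟩ := ((hη.push U.subtype).comp N.subtype).exists_between
      (Subgroup.inclusion hKN.le) (θ := κ) hne
    obtain ⟨μ, ν, hμ, hν, rfl⟩ := hfac θ hθ hθχ
    refine hμ.exists_factors (hs.subgroup K) hν (Subgroup.inclusion_injective hKN.le) ?_ hκ hθκ
    rw [Subgroup.inclusion_range]
    infer_instance) rfl
  set T := K ⊔ U with hT
  have hUT : U ≤ T := le_sup_right
  have hNT : N ⊔ U = N ⊔ T := by
    rw [hT, ← sup_assoc, sup_eq_left.2 hKN.le]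
  rw [hNT, ← Subgroup.relIndex_mul_relIndex U T (N ⊔ T) hUT le_sup_right]
  refine hKT.mul ?_
  rw [relIndex_sup_of_normal]
  rcases hi with hi | hi
  · exact hi.dvd (Subgroup.relIndex_dvd_of_le_left N le_sup_left)
  · have hpush : push T.subtype (push (Subgroup.inclusion hUT) η) = push U.subtype η := by
      rw [push_push]
      rfl
    have hd : Indec σ (push T.subtype (push (Subgroup.inclusion hUT) η)) := by rwa [hpush]
    have hirr := (hd.of_push T.subtype_injective (hη.push _)).isIrrChar
    have hdeg : push (Subgroup.inclusion hUT) η 1 = (U.relIndex T * n : ℕ) := by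
      rw [push_one_of_injective (Subgroup.inclusion_injective hUT), hη1,
        ← (U.subgroupOf T).index_mul_card,
        Nat.card_congr (Subgroup.subgroupOfEquivOfLe hUT).toEquiv, Nat.cast_mul,
        mul_div_cancel_right₀ _ card_ne_zero', Nat.cast_mul]
      rfl
    have hle := hd.le_of_factored hs hKN.le le_sup_left hi hirr hdeg (hKT.mul hn)
      (by rwa [hpush])
    rw [Subgroup.relIndex_eq_one.2 hle]
    exact isPiNumber_one _

end Main

/-- **Theorem (Statement 15).** Let `π` be a set of primes with `2 ∈ π` and let `G` be a
finite `π`-separable group.  Let `χ ∈ Irr(G)` be a lift of `φ ∈ I_π(G)` and suppose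
`N ⊴ G` is such that all irreducible constituents of `χ_N` are `π`-factored.  If `U ≤ G`
and `ψ ∈ Irr(U)` is `π`-factored with `ψ^G = χ`, then `|NU : U|` is a `π`-number. -/
theorem index_in_join_is_pi_number
    (π : Set ℕ) (h2 : 2 ∈ π)
    (G : Type) [Group G] [Fintype G] (hG : IsPiSeparable π G)
    (χ φ : G → ℂ) (hφ : IsIPiChar π G φ) (hlift : IsLiftOfPi π G χ φ)
    (N : Subgroup G) (hN : N.Normal)
    (hconst : ∀ θ : ↥N → ℂ, IsConstituent θ (resChar N χ) → IsPiFactored π ↥N θ)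
    (U : Subgroup G) (ψ : ↥U → ℂ) (hψirr : IsIrrChar ↥U ψ)
    (hψfac : IsPiFactored π ↥U ψ) (hind : indChar U ψ = χ) :
    IsPiNumber π ((U.subgroupOf (N ⊔ U)).index) := by
  have hs := hG.isSep
  rw [indChar_eq_push] at hind
  subst hind
  have h := hlift.indec hφ
  have hψ := h.of_push U.subtype_injective hψirr.1
  obtain ⟨α, β, hα, hβ, rfl⟩ := hψfac
  have hβ1 := (Indec.of_mul hα.1.1 hβ.1.1 hψ).degree_eq_one h2 (hs.subgroup U) hβ.special
  obtain ⟨n, hn, hnπ⟩ := hα.special.degree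
  refine h.isPiNumber_relIndex hs hψirr.1 (n := n) ?_ hnπ hN fun θ hθ hne => ?_
  · rw [Pi.mul_apply, hβ1, mul_one, hn]
  · obtain ⟨μ, ν, hμ, hν, he⟩ := hconst θ
      ((isConstituent_iff (hlift.1.1.comp N.subtype)).2 ⟨hθ, hne⟩)
    exact ⟨μ, ν, hμ.special, hν.special, he⟩
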